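/- Let G = ⟨S|R⟩ be a C'(1/6) group whose Morse boundary is σ-compact, i.e. there is a sequence (M_n) of Morse gauges such that every Morse geodesic ray in Cay(G,S) based at the identity is M_n-Morse for some n. Then X = Cay(G,S) satisfies the geodesic MLTG property: for every Morse gauge M there exist a scale L and a Morse gauge M' such that every geodesic in X which is L-locally M-Morse is M'-Morse. -/

import Mathlib

open Metric Set Filter

namespace MorseLTG

/-- A Morse gauge: a non-decreasing continuous function `[1, ∞) → [0, ∞)`. -/
def IsMorseGauge (M : ℝ → ℝ) : Prop :=
  MonotoneOn M (Set.Ici 1) ∧ ContinuousOn M (Set.Ici 1) ∧ ∀ t : ℝ, 1 ≤ t → 0 ≤ M t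

section Space

variable {X : Type*} [MetricSpace X]

/-- `γ` is a `Q`-quasi-geodesic on the set `I ⊆ ℝ`. -/
def QGeoOn (Q : ℝ) (I : Set ℝ) (γ : ℝ → X) : Prop :=
  ContinuousOn γ I ∧ ∀ s ∈ I, ∀ t ∈ I,
    |t - s| / Q - Q ≤ dist (γ s) (γ t) ∧ dist (γ s) (γ t) ≤ Q * |t - s| + Q

/-- `γ` is `M`-Morse on `I`: every `Q`-quasi-geodesic with endpoints on `γ|_I`
stays in the closed `M Q`-neighbourhood of the corresponding subsegment of `γ`. -/
def MorseOn (M : ℝ → ℝ) (I : Set ℝ) (γ : ℝ → X) : Prop :=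
  ∀ Q : ℝ, 1 ≤ Q → ∀ s ∈ I, ∀ t ∈ I, s ≤ t →
    ∀ (lam : ℝ → X) (a b : ℝ), a ≤ b → QGeoOn Q (Set.Icc a b) lam →
      lam a = γ s → lam b = γ t →
      ∀ u ∈ Set.Icc a b, ∃ v ∈ Set.Icc s t, dist (lam u) (γ v) ≤ M Q

/-- `γ` is a geodesic on `I` (an isometric embedding). -/
def GeodesicOn (I : Set ℝ) (γ : ℝ → X) : Prop :=
  ∀ s ∈ I, ∀ t ∈ I, dist (γ s) (γ t) = |t - s|

/-- A geodesic ray based at `x₀`. -/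
def GeodesicRayFrom (x₀ : X) (γ : ℝ → X) : Prop :=
  γ 0 = x₀ ∧ GeodesicOn (Set.Ici 0) γ

/-- A Morse geodesic ray (based anywhere). -/
def IsMorseGeodesicRay (γ : ℝ → X) : Prop :=
  GeodesicOn (Set.Ici 0) γ ∧ ∃ M : ℝ → ℝ, IsMorseGauge M ∧ MorseOn M (Set.Ici 0) γ

/-- `p` is `L`-locally an `M`-Morse `Q`-quasi-geodesic on `I`. -/
def LocMorseQGeoOn (Q : ℝ) (M : ℝ → ℝ) (L : ℝ) (I : Set ℝ) (p : ℝ → X) : Prop :=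
  ∀ s ∈ I, ∀ t ∈ I, s ≤ t → t - s ≤ L →
    QGeoOn Q (Set.Icc s t) p ∧ MorseOn M (Set.Icc s t) p

/-- `p` is `L`-locally `M`-Morse on `I`. -/
def LocMorseOn (M : ℝ → ℝ) (L : ℝ) (I : Set ℝ) (p : ℝ → X) : Prop :=
  ∀ s ∈ I, ∀ t ∈ I, s ≤ t → t - s ≤ L → MorseOn M (Set.Icc s t) p

/-- The Morse local-to-global property for a geodesic metric space. -/
def MLTG (X : Type*) [MetricSpace X] : Prop :=
  ∀ Q : ℝ, 1 ≤ Q → ∀ M : ℝ → ℝ, IsMorseGauge M →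
    ∃ (L Q' : ℝ) (M' : ℝ → ℝ), 0 < L ∧ 1 ≤ Q' ∧ IsMorseGauge M' ∧
      ∀ I : Set ℝ, I.OrdConnected → ∀ p : ℝ → X,
        LocMorseQGeoOn Q M L I p → QGeoOn Q' I p ∧ MorseOn M' I p

/-- `X` is a geodesic metric space. -/
def GeodesicSpace (X : Type*) [MetricSpace X] : Prop :=
  ∀ x y : X, ∃ γ : ℝ → X, γ 0 = x ∧ γ (dist x y) = y ∧
    GeodesicOn (Set.Icc 0 (dist x y)) γ

/-- Gromov hyperbolicity via thin geodesic triangles. -/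
def GromovHyperbolic (X : Type*) [MetricSpace X] : Prop :=
  ∃ δ : ℝ, 0 ≤ δ ∧
    ∀ (γ₁ γ₂ γ₃ : ℝ → X) (a₁ b₁ a₂ b₂ a₃ b₃ : ℝ),
      GeodesicOn (Set.Icc a₁ b₁) γ₁ → GeodesicOn (Set.Icc a₂ b₂) γ₂ →
        GeodesicOn (Set.Icc a₃ b₃) γ₃ →
      γ₁ b₁ = γ₂ a₂ → γ₂ b₂ = γ₃ a₃ → γ₃ b₃ = γ₁ a₁ →
      ∀ s ∈ Set.Icc a₁ b₁,
        ∃ p ∈ γ₂ '' Set.Icc a₂ b₂ ∪ γ₃ '' Set.Icc a₃ b₃, dist (γ₁ s) p ≤ δ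

/-- The set of closest-point projections of `x` to `A`. -/
def projSet (A : Set X) (x : X) : Set X :=
  {y ∈ A | ∀ z ∈ A, dist x y ≤ dist x z}

/-- A subset `A` is `C`-contracting. -/
def ContractingSet (C : ℝ) (A : Set X) : Prop :=
  ∀ x : X, Metric.diam (⋃ y ∈ Metric.ball x (Metric.infDist x A), projSet A y) ≤ C

/-- `γ` is a `C`-contracting geodesic on `I`. -/
def ContractingOn (C : ℝ) (I : Set ℝ) (γ : ℝ → X) : Prop :=
  GeodesicOn I γ ∧ ContractingSet C (γ '' I)

/-- The Morse boundary of `X` (with basepoint `x₀`) is σ-compact. -/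
def SigmaCompactMorseBoundary (x₀ : X) : Prop :=
  ∃ Ms : ℕ → ℝ → ℝ, (∀ n, IsMorseGauge (Ms n)) ∧
    ∀ γ : ℝ → X, GeodesicRayFrom x₀ γ → ∀ M : ℝ → ℝ, IsMorseGauge M →
      MorseOn M (Set.Ici 0) γ → ∃ n, MorseOn (Ms n) (Set.Ici 0) γ

/-- `Ms` is a strong exhaustion of the Morse boundary of `X` based at `x₀`. -/
def IsStrongExhaustion (x₀ : X) (Ms : ℕ → ℝ → ℝ) : Prop :=
  (∀ n, IsMorseGauge (Ms n)) ∧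
  (∀ γ : ℝ → X, GeodesicRayFrom x₀ γ → ∀ M : ℝ → ℝ, IsMorseGauge M →
    MorseOn M (Set.Ici 0) γ → ∃ n, MorseOn (Ms n) (Set.Ici 0) γ) ∧
  (∀ M : ℝ → ℝ, IsMorseGauge M → ∃ n, ∀ γ : ℝ → X, GeodesicRayFrom x₀ γ →
    MorseOn M (Set.Ici 0) γ → MorseOn (Ms n) (Set.Ici 0) γ)

/-- The Morse boundary of `X` (with basepoint `x₀`) is strongly σ-compact. -/
def StronglySigmaCompactMorseBoundary (x₀ : X) : Prop :=
  ∃ Ms : ℕ → ℝ → ℝ, IsStrongExhaustion x₀ Ms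

end Space

section Action

variable {G : Type*} [Group G] {X : Type*} [MetricSpace X]

/-- `φ` is an action of `G` on `X` by isometries. -/
def IsIsometricAction (φ : G → X → X) : Prop :=
  (∀ x : X, φ 1 x = x) ∧ (∀ g h : G, ∀ x : X, φ (g * h) x = φ g (φ h x)) ∧
    ∀ g : G, Isometry (φ g)

/-- `φ` is a geometric (proper and cocompact, isometric) action of `G` on `X`. -/
def IsGeometricAction (φ : G → X → X) : Prop :=
  IsIsometricAction φ ∧
  (∀ (x : X) (r : ℝ), {g : G | dist x (φ g x) ≤ r}.Finite) ∧
  (∃ (x₀ : X) (r : ℝ), ∀ y : X, ∃ g : G, dist y (φ g x₀) ≤ r)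

end Action

/-- `G` has contraction: it acts geometrically on some geodesic metric space
containing a strongly contracting geodesic ray. -/
def HasContraction (G : Type*) [Group G] : Prop :=
  ∃ (X : Type) (m : MetricSpace X), ∃ φ : G → X → X,
    letI := m
    IsGeometricAction φ ∧ GeodesicSpace X ∧
      ∃ (γ : ℝ → X) (C : ℝ), 0 ≤ C ∧ GeodesicOn (Set.Ici 0) γ ∧
        ContractingSet C (γ '' Set.Ici 0)

section Horo

variable {X : Type*} [MetricSpace X]

/-- The horofunction associated to a geodesic ray `γ` based at `x₀`
(for geodesic rays, the infimum below equals the limit of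
`t ↦ d(z, γ t) - d(x₀, γ t)` as `t → ∞`, since this function is non-increasing
and bounded below). -/
noncomputable def horofn (x₀ : X) (γ : ℝ → X) (z : X) : ℝ :=
  sInf ((fun t => dist z (γ t) - dist x₀ (γ t)) '' Set.Ici 0)

/-- The horofunction map `y ↦ ρ_y = d(·, y) - d(x₀, y)`. -/
noncomputable def horomap (x₀ y : X) : ContinuousMap X ℝ :=
  ⟨fun z => dist z y - dist x₀ y, by fun_prop⟩

end Horo

section HoroAction

variable {G : Type*} [Group G] {X : Type*} [MetricSpace X]

/-- The `G`-action on the horofunction compactification: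
`(g · f)(z) = f (g⁻¹ z) - f (g⁻¹ x₀)`. -/
noncomputable def horoAction (φ : G → X → X) (hc : ∀ g : G, Continuous (φ g)) (x₀ : X)
    (g : G) (f : ContinuousMap X ℝ) : ContinuousMap X ℝ :=
  ⟨fun z => f (φ g⁻¹ z) - f (φ g⁻¹ x₀), (f.continuous.comp (hc g⁻¹)).sub continuous_const⟩

end HoroAction

section Words

variable {S : Type*}

/-- A word over the symmetrised alphabet `S ∪ S⁻¹`. -/
abbrev Word (S : Type*) := List (S × Bool)

/-- The formal inverse of a word. -/
def wordInv (w : Word S) : Word S := (w.map fun a => (a.1, !a.2)).reverse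

/-- A word is reduced if it has no adjacent cancelling pair. -/
def ReducedWord (w : Word S) : Prop := w.Chain' fun a b => a.1 = b.1 → a.2 = b.2

/-- A word is cyclically reduced if all its cyclic shifts are reduced. -/
def CyclicallyReduced (w : Word S) : Prop := ∀ k : ℕ, ReducedWord (w.rotate k)

/-- The closure of `R ∪ R⁻¹` under cyclic shifts. -/
def symmClosure (R : Set (Word S)) : Set (Word S) :=
  {w | ∃ r ∈ R, ∃ k : ℕ, w = r.rotate k ∨ w = (wordInv r).rotate k}

/-- A piece: a (non-trivial) common prefix of two distinct elements of `R̄`. -/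
def IsPiece (R : Set (Word S)) (p : Word S) : Prop :=
  p ≠ [] ∧ ∃ r₁ ∈ symmClosure R, ∃ r₂ ∈ symmClosure R, r₁ ≠ r₂ ∧ p <+: r₁ ∧ p <+: r₂

/-- The `C'(lam)` small-cancellation condition. -/
def SmallCancellation (R : Set (Word S)) (lam : ℝ) : Prop :=
  (∀ r ∈ R, CyclicallyReduced r) ∧
  ∀ r ∈ symmClosure R, ∀ p : Word S, IsPiece R p → p <:+: r →
    (p.length : ℝ) < lam * r.length

/-- A viable function. -/
def Viable (f : ℕ → ℝ) : Prop :=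
  Monotone f ∧ (∀ n, 6 ≤ f n) ∧ Filter.Tendsto f Filter.atTop Filter.atTop

/-- The pair `(x, R)` satisfies the `C'(1/f)` small-cancellation condition. -/
def PairSmallCancellation (f : ℕ → ℝ) (x : Word S) (R : Set (Word S)) : Prop :=
  ∀ r ∈ symmClosure R, ∀ p : Word S, p ≠ [] → p <:+: x → p <:+: r →
    (p.length : ℝ) < (r.length : ℝ) / f r.length

/-- The increasing partial small-cancellation condition. -/
def IPSC (R : Set (Word S)) : Prop :=
  ∀ ns : ℕ → ℕ, (∀ i, 0 < ns i) →
    ∃ f : ℕ → ℝ, Viable f ∧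
      ∀ K : ℕ, ∃ i : ℕ, K ≤ i ∧ ∃ r ∈ symmClosure R, ∃ x y : Word S,
        r = x ++ y ∧ (ns i : ℝ) ≤ r.length ∧ (r.length : ℝ) / i ≤ x.length ∧
        PairSmallCancellation f x R

end Words

section Cayley

variable {G : Type*} [Group G] {S : Type*}

/-- The element of `G` spelled by a word over `S ∪ S⁻¹`. -/
def evalWord (σ : S → G) (w : Word S) : G :=
  (w.map fun a => if a.2 then σ a.1 else (σ a.1)⁻¹).prod

/-- The word metric on `G` with respect to the generating map `σ`. -/
noncomputable def wordDist (σ : S → G) (g h : G) : ℕ :=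
  sInf {n : ℕ | ∃ w : Word S, w.length = n ∧ g * evalWord σ w = h}

/-- A (discrete) edge path in the Cayley graph: consecutive points are adjacent. -/
def DIsPath (σ : S → G) (I : Set ℤ) (p : ℤ → G) : Prop :=
  ∀ n : ℤ, n ∈ I → n + 1 ∈ I → wordDist σ (p n) (p (n + 1)) ≤ 1

/-- A discrete `Q`-quasi-geodesic in the Cayley graph. -/
def DQGeoOn (σ : S → G) (Q : ℝ) (I : Set ℤ) (p : ℤ → G) : Prop :=
  DIsPath σ I p ∧ ∀ m ∈ I, ∀ n ∈ I,
    |(n : ℝ) - (m : ℝ)| / Q - Q ≤ (wordDist σ (p m) (p n) : ℝ) ∧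
      (wordDist σ (p m) (p n) : ℝ) ≤ Q * |(n : ℝ) - (m : ℝ)| + Q

/-- A discrete geodesic in the Cayley graph. -/
def DGeodesicOn (σ : S → G) (I : Set ℤ) (p : ℤ → G) : Prop :=
  ∀ m ∈ I, ∀ n ∈ I, (wordDist σ (p m) (p n) : ℤ) = |n - m|

/-- `p` is `M`-Morse on `I` in the Cayley graph. -/
def DMorseOn (σ : S → G) (M : ℝ → ℝ) (I : Set ℤ) (p : ℤ → G) : Prop :=
  ∀ Q : ℝ, 1 ≤ Q → ∀ s ∈ I, ∀ t ∈ I, s ≤ t →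
    ∀ (q : ℤ → G) (a b : ℤ), a ≤ b → DQGeoOn σ Q (Set.Icc a b) q →
      q a = p s → q b = p t →
      ∀ n ∈ Set.Icc a b, ∃ m ∈ Set.Icc s t, (wordDist σ (q n) (p m) : ℝ) ≤ M Q

/-- A geodesic ray in the Cayley graph based at the identity. -/
def DGeodesicRay (σ : S → G) (p : ℤ → G) : Prop :=
  p 0 = 1 ∧ DGeodesicOn σ (Set.Ici 0) p

/-- `p` is `L`-locally an `M`-Morse `Q`-quasi-geodesic. -/
def DLocMorseQGeoOn (σ : S → G) (Q : ℝ) (M : ℝ → ℝ) (L : ℝ) (I : Set ℤ) (p : ℤ → G) : Prop :=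
  ∀ s ∈ I, ∀ t ∈ I, s ≤ t → ((t - s : ℤ) : ℝ) ≤ L →
    DQGeoOn σ Q (Set.Icc s t) p ∧ DMorseOn σ M (Set.Icc s t) p

/-- `p` is `L`-locally `M`-Morse. -/
def DLocMorseOn (σ : S → G) (M : ℝ → ℝ) (L : ℝ) (I : Set ℤ) (p : ℤ → G) : Prop :=
  ∀ s ∈ I, ∀ t ∈ I, s ≤ t → ((t - s : ℤ) : ℝ) ≤ L → DMorseOn σ M (Set.Icc s t) p

/-- The Morse local-to-global property for the Cayley graph of `(G, σ)`. -/
def CayMLTG (σ : S → G) : Prop :=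
  ∀ Q : ℝ, 1 ≤ Q → ∀ M : ℝ → ℝ, IsMorseGauge M →
    ∃ (L Q' : ℝ) (M' : ℝ → ℝ), 0 < L ∧ 1 ≤ Q' ∧ IsMorseGauge M' ∧
      ∀ I : Set ℤ, I.OrdConnected → ∀ p : ℤ → G,
        DLocMorseQGeoOn σ Q M L I p → DQGeoOn σ Q' I p ∧ DMorseOn σ M' I p

/-- The geodesic Morse local-to-global property for the Cayley graph. -/
def CayGeodesicMLTG (σ : S → G) : Prop :=
  ∀ M : ℝ → ℝ, IsMorseGauge M →
    ∃ (L : ℝ) (M' : ℝ → ℝ), 0 < L ∧ IsMorseGauge M' ∧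
      ∀ I : Set ℤ, I.OrdConnected → ∀ p : ℤ → G, DGeodesicOn σ I p →
        DLocMorseOn σ M L I p → DMorseOn σ M' I p

/-- σ-compactness of the Morse boundary of the Cayley graph. -/
def CaySigmaCompact (σ : S → G) : Prop :=
  ∃ Ms : ℕ → ℝ → ℝ, (∀ n, IsMorseGauge (Ms n)) ∧
    ∀ p : ℤ → G, DGeodesicRay σ p → ∀ M : ℝ → ℝ, IsMorseGauge M →
      DMorseOn σ M (Set.Ici 0) p → ∃ n, DMorseOn σ (Ms n) (Set.Ici 0) p

/-- Strong σ-compactness of the Morse boundary of the Cayley graph. -/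
def CayStronglySigmaCompact (σ : S → G) : Prop :=
  ∃ Ms : ℕ → ℝ → ℝ, (∀ n, IsMorseGauge (Ms n)) ∧
    (∀ p : ℤ → G, DGeodesicRay σ p → ∀ M : ℝ → ℝ, IsMorseGauge M →
      DMorseOn σ M (Set.Ici 0) p → ∃ n, DMorseOn σ (Ms n) (Set.Ici 0) p) ∧
    (∀ M : ℝ → ℝ, IsMorseGauge M → ∃ n, ∀ p : ℤ → G, DGeodesicRay σ p →
      DMorseOn σ M (Set.Ici 0) p → DMorseOn σ (Ms n) (Set.Ici 0) p)

/-- The edge path starting at `g` labelled by the word `w`. -/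
def pathOfWord (σ : S → G) (g : G) (w : Word S) : ℤ → G :=
  fun n => g * evalWord σ (w.take n.toNat)

end Cayley

/-- The canonical generating map of a presented group `⟨S | R⟩`. -/
def presGen {S : Type*} (R : Set (Word S)) : S → PresentedGroup (FreeGroup.mk '' R) :=
  fun s => PresentedGroup.of s

end MorseLTG


open Metric Set Filter
set_option linter.unusedSectionVars false
namespace MorseLTG
section Part1
variable {S : Type*} {G : Type*} [Group G]

def fl {α : Type*} (a : α × Bool) : α × Bool := (a.1, !a.2)

@[simp] lemma fl_fl {α : Type*} (a : α × Bool) : fl (fl a) = a := by simp [fl]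
lemma fl_ne {α : Type*} (a : α × Bool) : fl a ≠ a := by
  intro h; have := congrArg Prod.snd h; simp [fl] at this
lemma fl_inj {α : Type*} {a b : α × Bool} : fl a = fl b ↔ a = b :=
  ⟨fun h => by rw [← fl_fl a, h, fl_fl], fun h => by rw [h]⟩

lemma wordInv_eq (w : Word S) : wordInv w = (w.map fl).reverse := rfl
@[simp] lemma wordInv_wordInv (w : Word S) : wordInv (wordInv w) = w := by
  simp only [wordInv_eq, List.map_reverse, List.reverse_reverse, List.map_map]
  have : (fl ∘ fl : S × Bool → _) = id := by funext x; simp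
  simp [this]
@[simp] lemma wordInv_length (w : Word S) : (wordInv w).length = w.length := by simp [wordInv]
@[simp] lemma wordInv_nil : wordInv ([] : Word S) = [] := rfl
lemma wordInv_append (u v : Word S) : wordInv (u ++ v) = wordInv v ++ wordInv u := by
  simp [wordInv]
lemma wordInv_cons (a) (v : Word S) : wordInv (a :: v) = wordInv v ++ [fl a] := by
  simp [wordInv, fl]
lemma wordInv_inj {u v : Word S} (h : wordInv u = wordInv v) : u = v := by
  rw [← wordInv_wordInv u, h, wordInv_wordInv]

def ev (σ : S → G) (x : S × Bool) : G := if x.2 then σ x.1 else (σ x.1)⁻¹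

lemma ev_fl (σ : S → G) (x) : ev σ (fl x) = (ev σ x)⁻¹ := by
  rcases x with ⟨x, b⟩; cases b <;> simp [ev, fl]

lemma evalWord_nil (σ : S → G) : evalWord σ [] = 1 := by simp [evalWord]
lemma evalWord_cons (σ : S → G) (a) (w : Word S) :
    evalWord σ (a :: w) = ev σ a * evalWord σ w := by simp [evalWord, ev]
lemma evalWord_append (σ : S → G) (u v : Word S) :
    evalWord σ (u ++ v) = evalWord σ u * evalWord σ v := by simp [evalWord]
lemma evalWord_inv (σ : S → G) (u : Word S) :
    evalWord σ (wordInv u) = (evalWord σ u)⁻¹ := by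
  induction u with
  | nil => simp [evalWord_nil]
  | cons a u ih => rw [wordInv_cons, evalWord_append, ih, evalWord_cons, evalWord_cons, evalWord_nil,
      ev_fl, mul_one, mul_inv_rev]

lemma evalWord_rotate (σ : S → G) (u : Word S) (k : ℕ) (h : evalWord σ u = 1) :
    evalWord σ (u.rotate k) = 1 := by
  obtain ⟨a, b, h1, h2⟩ : ∃ a b, u = a ++ b ∧ u.rotate k = b ++ a := by
    rw [List.rotate_eq_drop_append_take_mod]
    exact ⟨_, _, (List.take_append_drop (k % u.length) u).symm, rfl⟩
  rw [h1, evalWord_append] at h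
  rw [h2, evalWord_append]
  exact mul_eq_one_comm.mp h

lemma symm_rot {R : Set (Word S)} {w w' : Word S} (h : w ∈ symmClosure R) (h' : w ~r w') :
    w' ∈ symmClosure R := by
  obtain ⟨r, hr, k, h⟩ := h
  obtain ⟨j, rfl⟩ := h'
  refine ⟨r, hr, k + j, ?_⟩
  rcases h with rfl | rfl <;> simp [List.rotate_rotate]

lemma wordInv_rot {w w' : Word S} (h : w ~r w') : wordInv w ~r wordInv w' := by
  have := (h.map fl).reverse
  simpa [wordInv_eq] using this

lemma symm_inv {R : Set (Word S)} {w : Word S} (h : w ∈ symmClosure R) :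
    wordInv w ∈ symmClosure R := by
  obtain ⟨r, hr, k, h⟩ := h
  rcases h with rfl | rfl
  · exact symm_rot (w := wordInv r) ⟨r, hr, 0, by simp⟩ (wordInv_rot ⟨k, rfl⟩)
  · refine symm_rot (w := r) ⟨r, hr, 0, by simp⟩ ?_
    have := wordInv_rot (w := wordInv r) ⟨k, rfl⟩
    simpa using this

lemma symm_eval {σ : S → G} {R : Set (Word S)} (hR : ∀ r ∈ R, evalWord σ r = 1) {w : Word S}
    (h : w ∈ symmClosure R) : evalWord σ w = 1 := by
  obtain ⟨r, hr, k, h⟩ := h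
  rcases h with rfl | rfl
  · exact evalWord_rotate _ _ _ (hR r hr)
  · exact evalWord_rotate _ _ _ (by rw [evalWord_inv, hR r hr, inv_one])

lemma red_iff {w : Word S} : ReducedWord w ↔ w.IsChain (fun a b => a.1 = b.1 → a.2 = b.2) :=
  Iff.rfl

lemma reduced_inv {w : Word S} (h : ReducedWord w) : ReducedWord (wordInv w) := by
  rw [red_iff] at *
  rw [wordInv, List.isChain_reverse, List.isChain_map]
  refine h.imp ?_
  intro a b hab h1
  simp only [flip] at *
  simp [hab h1.symm]

lemma cycRed_inv {w : Word S} (h : CyclicallyReduced w) : CyclicallyReduced (wordInv w) := by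
  intro k
  obtain ⟨j, hj⟩ := wordInv_rot (w := wordInv w) (w' := (wordInv w).rotate k) ⟨k, rfl⟩
  have := reduced_inv (h j)
  rw [wordInv_wordInv] at hj
  rwa [hj, wordInv_wordInv] at this

lemma symm_cycRed {R : Set (Word S)} (hR : ∀ r ∈ R, CyclicallyReduced r) {w : Word S}
    (h : w ∈ symmClosure R) : CyclicallyReduced w := by
  obtain ⟨r, hr, k, h⟩ := h
  intro j
  rcases h with rfl | rfl
  · rw [List.rotate_rotate]; exact hR r hr _
  · rw [List.rotate_rotate]; exact cycRed_inv (hR r hr) _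

lemma symm_red {R : Set (Word S)} (hR : ∀ r ∈ R, CyclicallyReduced r) {w : Word S}
    (h : w ∈ symmClosure R) : ReducedWord w := by
  simpa using symm_cycRed hR h 0

lemma not_self_inv {w : Word S} (h : ReducedWord w) (h2 : wordInv w = w) : w = [] := by
  -- middle letter argument
  by_contra hne
  have hl : 0 < w.length := List.length_pos_iff.mpr hne
  have key : ∀ i (hi : i < w.length), w[w.length - 1 - i]'(by omega) = fl (w[i]) := by
    intro i hi
    have h3 : (wordInv w)[w.length - 1 - i]'(by simp; omega) = fl (w[i]) := by
      simp only [wordInv_eq, List.getElem_reverse, List.getElem_map, List.length_map]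
      congr 2; omega
    simpa only [h2] using h3
  rw [red_iff] at h
  rw [List.isChain_iff_getElem] at h
  rcases Nat.even_or_odd' w.length with ⟨m, hm | hm⟩
  · have h1 := key (m-1) (by omega)
    have h3 := h (m-1) (by omega)
    have e : w.length - 1 - (m-1) = m - 1 + 1 := by omega
    simp only [e] at h1
    rw [h1] at h3
    simp [fl] at h3
  · have h1 := key m (by omega)
    have e : w.length - 1 - m = m := by omega
    simp only [e] at h1
    exact fl_ne _ h1.symm

lemma not_rot_inv {w : Word S} (h : CyclicallyReduced w) (h2 : w ~r wordInv w) : w = [] := by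
  obtain ⟨k, hk⟩ := h2
  obtain ⟨a, b, h1, h3⟩ : ∃ a b, w = a ++ b ∧ w.rotate k = b ++ a := by
    rw [List.rotate_eq_drop_append_take_mod]
    exact ⟨_, _, (List.take_append_drop (k % w.length) w).symm, rfl⟩
  rw [h3, h1, wordInv_append] at hk
  have hr : ReducedWord w := by simpa using h 0
  obtain ⟨hb, ha⟩ := List.append_inj hk (by simp)
  rw [red_iff] at hr
  rw [h1] at hr
  have hra : ReducedWord a := hr.left_of_append
  have hrb : ReducedWord b := hr.right_of_append
  rw [h1, not_self_inv hra ha.symm, not_self_inv hrb hb.symm]; rfl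

abbrev Dt := ℕ × Bool

def Walk (vert : Dt → ℕ × G) : ℕ × G → List Dt → ℕ × G → Prop
  | u, [], v => u = v
  | u, d :: l, v => vert d = u ∧ Walk vert (vert (fl d)) l v

lemma walk_append {vert : Dt → ℕ × G} {l l' : List Dt} {u v} :
    Walk vert u (l ++ l') v ↔ ∃ m, Walk vert u l m ∧ Walk vert m l' v := by
  induction l generalizing u with
  | nil => simp [Walk]
  | cons d l ih => simp [Walk, ih, and_assoc]

lemma walk_mem {vert : Dt → ℕ × G} {l : List Dt} {u v} (h : Walk vert u l v) :
    u = v ∨ u ∈ l.map vert := by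
  cases l with
  | nil => left; exact h
  | cons d l => right; simp [h.1]

lemma walk_map {vert vert' : Dt → ℕ × G} (ρ : Dt → Dt) (m : ℕ × G → ℕ × G) {l : List Dt} {u v}
    (h : Walk vert u l v) (h1 : ∀ x ∈ l, vert' (ρ x) = m (vert x))
    (h2 : ∀ x ∈ l, vert' (fl (ρ x)) = m (vert (fl x))) :
    Walk vert' (m u) (l.map ρ) (m v) := by
  induction l generalizing u with
  | nil => simp only [Walk] at h; simp [Walk, h]
  | cons d l ih =>
    simp only [Walk, List.map_cons] at *
    refine ⟨by rw [h1 d (by simp), h.1], ?_⟩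
    rw [h2 d (by simp)]
    exact ih h.2 (fun x hx => h1 x (by simp [hx])) (fun x hx => h2 x (by simp [hx]))

lemma walk_congr {vert vert' : Dt → ℕ × G} {l : List Dt} {u v}
    (h : Walk vert u l v) (h1 : ∀ x ∈ l, vert' x = vert x)
    (h2 : ∀ x ∈ l, vert' (fl x) = vert (fl x)) : Walk vert' u l v := by
  have := walk_map (vert' := vert') id id h h1 h2
  simpa using this

lemma walk_rotate {vert : Dt → ℕ × G} {l l' : List Dt} {u} (h : Walk vert u l u) (h' : l ~r l') :
    ∃ u', Walk vert u' l' u' := by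
  obtain ⟨k, rfl⟩ := h'
  rw [List.rotate_eq_drop_append_take_mod]
  rw [← List.take_append_drop (k % l.length) l, walk_append] at h
  obtain ⟨m, h1, h2⟩ := h
  exact ⟨m, walk_append.mpr ⟨u, h2, h1⟩⟩

lemma walk_pos {σ : S → G} {lab : Dt → S × Bool} {vert : Dt → ℕ × G} {l : List Dt} {u v}
    (hp : ∀ d, (vert (fl d)).2 = (vert d).2 * ev σ (lab d)) (h : Walk vert u l v) :
    v.2 = u.2 * evalWord σ (l.map lab) := by
  induction l generalizing u with
  | nil => simp only [Walk] at h; simp [h, evalWord_nil]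
  | cons d l ih =>
    simp only [Walk, List.map_cons] at *
    rw [ih h.2, evalWord_cons, hp, h.1, mul_assoc]

open Classical in
structure Dg (σ : S → G) (R : Set (Word S)) (lab : Dt → S × Bool) (vert : Dt → ℕ × G)
    (base : ℕ × G) (outer : List Dt) (inner : List (List Dt)) : Prop where
  nd : (outer ++ inner.flatten).Nodup
  cl : ∀ d ∈ outer ++ inner.flatten, fl d ∈ outer ++ inner.flatten
  lab_fl : ∀ d, lab (fl d) = fl (lab d)
  pos : ∀ d, (vert (fl d)).2 = (vert d).2 * ev σ (lab d)
  wk : Walk vert base outer base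
  inn : ∀ l ∈ inner, l ≠ [] ∧ l.map lab ∈ symmClosure R ∧ ∃ u, Walk vert u l u
  eul : (outer ++ inner.flatten).length + 2 ≤
    2 * (insert base ((outer ++ inner.flatten).map vert).toFinset).card + 2 * inner.length

def RedDg (lab : Dt → S × Bool) (inner : List (List Dt)) : Prop :=
  ∀ l ∈ inner, ∀ l' ∈ inner, ∀ d y y', l ~r d :: y → l' ~r fl d :: y' →
    y.map lab ≠ wordInv (y'.map lab)

lemma RedDg.mono {lab : Dt → S × Bool} {i1 i2 : List (List Dt)} (h : RedDg lab i2)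
    (h' : i1 ⊆ i2) : RedDg lab i1 :=
  fun l hl l' hl' => h l (h' hl) l' (h' hl')

end Part1
end MorseLTG

namespace MorseLTG
section Part1b
variable {S : Type*} {G : Type*} [Group G]
variable {σ : S → G} {R : Set (Word S)} {lab : Dt → S × Bool} {vert : Dt → ℕ × G}
    {base : ℕ × G} {outer : List Dt} {inner : List (List Dt)}

open Classical in
lemma card_erase_le {α : Type*} {A B : Finset α} {v : α} (h : ∀ x ∈ A, x ≠ v → x ∈ B) :
    A.card ≤ B.card + 1 := by
  have h1 : A ⊆ insert v B := by
    intro x hx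
    by_cases hv : x = v
    · simp [hv]
    · simp [h x hx hv]
  exact (Finset.card_le_card h1).trans (Finset.card_insert_le _ _)

lemma Dg.change {inner' : List (List Dt)} (h : Dg σ R lab vert base outer inner)
    (hp : inner'.flatten.Perm inner.flatten) (hl : inner'.length = inner.length)
    (hi : ∀ l ∈ inner', l ≠ [] ∧ l.map lab ∈ symmClosure R ∧ ∃ u, Walk vert u l u) :
    Dg σ R lab vert base outer inner' := by
  classical
  have hp' := hp.append_left outer
  refine ⟨hp'.nodup_iff.mpr h.nd, ?_, h.lab_fl, h.pos, h.wk, hi, ?_⟩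
  · intro d hd
    exact hp'.mem_iff.mpr (h.cl d (hp'.mem_iff.mp hd))
  · rw [hp'.length_eq, hl, List.toFinset_eq_of_perm _ _ (hp'.map vert)]
    exact h.eul

lemma Dg.normalize (h : Dg σ R lab vert base outer inner) {l l' : List Dt} (hl : l ∈ inner)
    (hr : l ~r l') : ∃ I, inner.Perm (l :: I) ∧ Dg σ R lab vert base outer (l' :: I) := by
  obtain ⟨I, hI⟩ : ∃ I, inner.Perm (l :: I) := by
    classical
    exact ⟨_, List.perm_cons_erase hl⟩
  refine ⟨I, hI, h.change ?_ ?_ ?_⟩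
  · refine List.Perm.trans ?_ hI.flatten.symm
    simp only [List.flatten_cons]
    exact hr.perm.symm.append_right _
  · simp [hI.length_eq]
  · intro k hk
    rcases List.mem_cons.mp hk with rfl | hk
    · obtain ⟨h1, h2, u, h3⟩ := h.inn l hl
      refine ⟨?_, symm_rot h2 (hr.map lab), walk_rotate h3 hr⟩
      rintro rfl
      exact h1 (List.isRotated_nil_iff.mp hr)
    · exact h.inn k (hI.mem_iff.mpr (by simp [hk]))

lemma Dg.removeFace {A B y : List Dt} {d : Dt} {I : List (List Dt)}
    (h : Dg σ R lab vert base (A ++ d :: B) ((fl d :: y) :: I)) :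
    Dg σ R lab vert base (A ++ y ++ B) I := by
  have hp : ((A ++ d :: B) ++ ((fl d :: y) :: I).flatten).Perm
      (d :: fl d :: (A ++ y ++ B ++ I.flatten)) := by
    classical
    rw [List.perm_iff_count]; intro a
    simp [List.count_cons]; ring
  have hnd := hp.nodup_iff.mp h.nd
  have hw := walk_append.mp h.wk
  obtain ⟨m, hA, hd, hB⟩ := hw
  obtain ⟨-, -, u, hu1, hu2⟩ := h.inn (fl d :: y) (by simp)
  rw [fl_fl] at hu2
  have hwy : Walk vert m (y ++ B) base := walk_append.mpr ⟨u, by rwa [← hd], by rwa [← hu1]⟩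
  have hwk : Walk vert base (A ++ y ++ B) base := by
    rw [List.append_assoc]
    exact walk_append.mpr ⟨m, hA, hwy⟩
  refine ⟨?_, ?_, h.lab_fl, h.pos, hwk, fun l hl => h.inn l (by simp [hl]), ?_⟩
  · exact (List.nodup_cons.mp (List.nodup_cons.mp hnd).2).2
  · intro x hx
    have h1 : fl x ∈ d :: fl d :: (A ++ y ++ B ++ I.flatten) :=
      hp.mem_iff.mp (h.cl x (hp.mem_iff.mpr (by simp only [List.mem_cons]; right; right; exact hx)))
    simp only [List.mem_cons] at h1
    rcases h1 with h1 | h1 | h1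
    · exfalso
      have : x = fl d := by rw [← h1, fl_fl]
      subst this
      exact (List.nodup_cons.mp (List.nodup_cons.mp hnd).2).1 hx
    · exfalso
      have : x = d := fl_inj.mp h1
      subst this
      exact (List.nodup_cons.mp hnd).1 (by simp only [List.mem_cons]; right; exact hx)
    · exact h1
  · classical
    have he := h.eul
    rw [hp.length_eq] at he
    have hsub : (insert base (((A ++ d :: B) ++ ((fl d :: y) :: I).flatten).map vert).toFinset) ⊆
        (insert base ((A ++ y ++ B ++ I.flatten).map vert).toFinset) := by
      intro v hv
      rw [List.toFinset_eq_of_perm _ _ (hp.map vert)] at hv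
      simp only [List.map_cons, List.toFinset_cons, Finset.mem_insert, List.mem_toFinset] at hv ⊢
      have e1 : vert d = base ∨ vert d ∈ (A ++ y ++ B ++ I.flatten).map vert := by
        rcases walk_mem hwy with h1 | h1
        · left; rw [hd, h1]
        · right; rw [hd]; simp only [List.map_append, List.mem_append] at h1 ⊢; tauto
      have e2 : vert (fl d) = base ∨ vert (fl d) ∈ (A ++ y ++ B ++ I.flatten).map vert := by
        rcases walk_mem hB with h1 | h1
        · left; exact h1
        · right; simp only [List.map_append, List.mem_append] at h1 ⊢; tauto
      rcases hv with h1 | h1 | h1 | h1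
      · left; exact h1
      · rw [h1]; exact e1
      · rw [h1]; exact e2
      · right; exact h1
    have := Finset.card_le_card hsub
    simp only [List.length_cons] at he ⊢
    omega

lemma Dg.foldSpur {A B : List Dt} {d : Dt}
    (h : Dg σ R lab vert base (A ++ d :: fl d :: B) inner) :
    Dg σ R lab vert base (A ++ B) inner := by
  have hp : ((A ++ d :: fl d :: B) ++ inner.flatten).Perm
      (d :: fl d :: (A ++ B ++ inner.flatten)) := by
    classical
    rw [List.perm_iff_count]; intro a
    simp [List.count_cons]; ring
  have hnd := hp.nodup_iff.mp h.nd
  have hw := walk_append.mp h.wk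
  obtain ⟨m, hA, hd, hd', hB⟩ := hw
  rw [fl_fl, hd] at hB
  have hwk : Walk vert base (A ++ B) base := walk_append.mpr ⟨m, hA, hB⟩
  refine ⟨?_, ?_, h.lab_fl, h.pos, hwk, h.inn, ?_⟩
  · exact (List.nodup_cons.mp (List.nodup_cons.mp hnd).2).2
  · intro x hx
    have h1 : fl x ∈ d :: fl d :: (A ++ B ++ inner.flatten) :=
      hp.mem_iff.mp (h.cl x (hp.mem_iff.mpr (by simp only [List.mem_cons]; right; right; exact hx)))
    simp only [List.mem_cons] at h1
    rcases h1 with h1 | h1 | h1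
    · exfalso
      have : x = fl d := by rw [← h1, fl_fl]
      subst this
      exact (List.nodup_cons.mp (List.nodup_cons.mp hnd).2).1 hx
    · exfalso
      have : x = d := fl_inj.mp h1
      subst this
      exact (List.nodup_cons.mp hnd).1 (by simp only [List.mem_cons]; right; exact hx)
    · exact h1
  · classical
    have he := h.eul
    rw [hp.length_eq, List.toFinset_eq_of_perm _ _ (hp.map vert)] at he
    have := card_erase_le (A := (insert base ((d :: fl d :: (A ++ B ++ inner.flatten)).map vert).toFinset))
      (B := (insert base ((A ++ B ++ inner.flatten).map vert).toFinset)) (v := vert (fl d)) (by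
      intro v hv hne
      simp only [List.map_cons, List.toFinset_cons, Finset.mem_insert, List.mem_toFinset] at hv ⊢
      have e1 : vert d = base ∨ vert d ∈ (A ++ B ++ inner.flatten).map vert := by
        rcases walk_mem hB with h1 | h1
        · left; rw [hd, h1]
        · right; rw [hd]; simp only [List.map_append, List.mem_append] at h1 ⊢; tauto
      rcases hv with h1 | h1 | h1 | h1
      · left; exact h1
      · rw [h1]; exact e1
      · exact absurd h1 hne
      · right; exact h1)
    simp only [List.length_cons] at he
    omega

open Classical in
lemma Dg.fold {A B : List Dt} {d d' : Dt} (hdd : d' ≠ fl d) (hlab : lab d' = fl (lab d))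
    (h : Dg σ R lab vert base (A ++ d :: d' :: B) inner) :
    ∃ vert' base', base'.2 = base.2 ∧
      Dg σ R lab vert' base' ((A ++ B).map (fun x => if x = fl d' then d else x))
        (inner.map (List.map (fun x => if x = fl d' then d else x))) := by
  classical
  set ρ : Dt → Dt := fun x => if x = fl d' then d else x with hρ
  have hp : ((A ++ d :: d' :: B) ++ inner.flatten).Perm
      (d :: d' :: (A ++ B ++ inner.flatten)) := by
    rw [List.perm_iff_count]; intro a
    simp [List.count_cons]; ring
  have hnd := hp.nodup_iff.mp h.nd
  have hw := walk_append.mp h.wk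
  obtain ⟨u, hA, hd, hd', hB⟩ := hw
  set w := vert (fl d') with hwdef
  set m : ℕ × G → ℕ × G := fun v => if v = w then u else v with hm
  have hmw : m w = u := by simp [hm]
  have hmu : m u = u := by simp [hm]
  have hm2 : ∀ v, (m v).2 = v.2 := by
    intro v
    by_cases hv : v = w
    · have e1 := h.pos d
      have e2 := h.pos d'
      rw [hlab, hd', ev_fl] at e2
      rw [e1, hd] at e2
      simp only [hm, hv, if_true, hwdef, e2]
      group
    · simp [hm, hv]
  have hdnot : d ∉ (A ++ B ++ inner.flatten) := fun hh => (List.nodup_cons.mp hnd).1 (by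
    simp only [List.mem_cons]; right; exact hh)
  have hd'not : d' ∉ (A ++ B ++ inner.flatten) := (List.nodup_cons.mp (List.nodup_cons.mp hnd).2).1
  have hne' : d ≠ d' := fun hh => (List.nodup_cons.mp hnd).1 (by simp [hh])
  have hmemd : ∀ x, x ∈ A ++ B ++ inner.flatten → fl x = d ∨ fl x = d' ∨ fl x ∈ A ++ B ++ inner.flatten := by
    intro x hx
    have h1 : fl x ∈ d :: d' :: (A ++ B ++ inner.flatten) :=
      hp.mem_iff.mp (h.cl x (hp.mem_iff.mpr (by simp only [List.mem_cons]; right; right; exact hx)))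
    simpa only [List.mem_cons] using h1
  have hfd : fl d ∈ A ++ B ++ inner.flatten := by
    have h1 : fl d ∈ d :: d' :: (A ++ B ++ inner.flatten) :=
      hp.mem_iff.mp (h.cl d (hp.mem_iff.mpr (by simp)))
    rcases List.mem_cons.mp h1 with h1 | h1
    · exact absurd h1 (fl_ne d)
    rcases List.mem_cons.mp h1 with h1 | h1
    · exact absurd h1.symm hdd
    · exact h1
  have hfd' : fl d' ∈ A ++ B ++ inner.flatten := by
    have h1 : fl d' ∈ d :: d' :: (A ++ B ++ inner.flatten) :=
      hp.mem_iff.mp (h.cl d' (hp.mem_iff.mpr (by simp)))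
    rcases List.mem_cons.mp h1 with h1 | h1
    · exact absurd (by rw [← h1, fl_fl]) hdd
    rcases List.mem_cons.mp h1 with h1 | h1
    · exact absurd h1 (fl_ne d')
    · exact h1
  have r1 : ∀ x, m (vert (ρ x)) = m (vert x) := by
    intro x
    by_cases hx : x = fl d'
    · simp only [hρ, hx, if_true, hd, hmu]; rw [← hwdef, hmw]
    · simp [hρ, hx]
  have r2 : ∀ x, m (vert (fl (ρ x))) = m (vert (fl x)) := by
    intro x
    by_cases hx : x = fl d'
    · simp only [hρ, hx, if_true, fl_fl, hd']
    · simp [hρ, hx]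
  have rl : ∀ x, lab (ρ x) = lab x := by
    intro x
    by_cases hx : x = fl d'
    · simp only [hρ, hx, if_true, h.lab_fl, hlab, fl_fl]
    · simp [hρ, hx]
  have hall : (A ++ B).map ρ ++ (inner.map (List.map ρ)).flatten =
      (A ++ B ++ inner.flatten).map ρ := by simp [List.map_flatten]
  have hwB : Walk (m ∘ vert) u (B.map ρ) (m base) := by
    have := walk_map (vert' := m ∘ vert) ρ m hB (fun x _ => r1 x) (fun x _ => r2 x)
    rwa [hmw] at this
  refine ⟨m ∘ vert, m base, hm2 _, ?_, ?_, h.lab_fl, ?_, ?_, ?_, ?_⟩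
  · rw [hall]
    refine List.Nodup.map_on ?_ (List.nodup_cons.mp (List.nodup_cons.mp hnd).2).2
    intro x hx y hy hxy
    simp only [hρ] at hxy
    split_ifs at hxy with h1 h2 h2
    · rw [h1, h2]
    · rw [← hxy] at hy; exact absurd hy hdnot
    · rw [hxy] at hx; exact absurd hx hdnot
    · exact hxy
  · rw [hall]
    intro x hx
    obtain ⟨z, hz, rfl⟩ := List.mem_map.mp hx
    by_cases hzd : z = fl d'
    · refine List.mem_map.mpr ⟨fl d, hfd, ?_⟩
      have : fl d ≠ fl d' := fun hh => hne' (fl_inj.mp hh)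
      simp [hρ, hzd, this]
    · rcases hmemd z hz with h1 | h1 | h1
      · refine List.mem_map.mpr ⟨fl d', hfd', ?_⟩
        simp [hρ, hzd, h1]
      · exact absurd (by rw [← h1, fl_fl]) hzd
      · refine List.mem_map.mpr ⟨fl z, h1, ?_⟩
        have : fl z ≠ fl d' := fun hh => by rw [fl_inj.mp hh] at hz; exact hd'not hz
        simp [hρ, hzd, this]
  · intro x
    simp only [Function.comp, hm2]; exact h.pos x
  · rw [List.map_append]
    refine walk_append.mpr ⟨u, ?_, hwB⟩
    have := walk_map (vert' := m ∘ vert) ρ m hA (fun x _ => r1 x) (fun x _ => r2 x)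
    rwa [hmu] at this
  · intro l hl
    obtain ⟨k, hk, rfl⟩ := List.mem_map.mp hl
    obtain ⟨h1, h2, v, h3⟩ := h.inn k hk
    refine ⟨by simpa using h1, ?_, m v, walk_map (vert' := m ∘ vert) ρ m h3 (fun x _ => r1 x) (fun x _ => r2 x)⟩
    have : (k.map ρ).map lab = k.map lab := by
      rw [List.map_map]; exact List.map_congr_left (fun x _ => rl x)
    rwa [this]
  · rw [hall]
    have he := h.eul
    rw [hp.length_eq, List.toFinset_eq_of_perm _ _ (hp.map vert)] at he
    have := card_erase_le (A := (insert base ((d :: d' :: (A ++ B ++ inner.flatten)).map vert).toFinset))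
      (B := (insert (m base) (((A ++ B ++ inner.flatten).map ρ).map (m ∘ vert)).toFinset)) (v := w) (by
      intro v hv hne
      have hmv : m v = v := by simp [hm, hne]
      simp only [List.map_cons, List.toFinset_cons, Finset.mem_insert, List.mem_toFinset] at hv ⊢
      have key : ∀ x ∈ A ++ B ++ inner.flatten, v = vert x →
          v ∈ ((A ++ B ++ inner.flatten).map ρ).map (m ∘ vert) := by
        intro x hx hvx
        refine List.mem_map.mpr ⟨ρ x, List.mem_map.mpr ⟨x, hx, rfl⟩, ?_⟩
        simp only [Function.comp, r1, ← hvx, hmv]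
      have e1 : u = m base ∨ u ∈ ((A ++ B ++ inner.flatten).map ρ).map (m ∘ vert) := by
        rcases walk_mem hwB with h1 | h1
        · left; exact h1
        · right; simp only [List.map_append, List.mem_append] at h1 ⊢; tauto
      rcases hv with h1 | h1 | h1 | h1
      · left; rw [← hmv, h1]
      · rw [h1, hd]; exact e1
      · right; exact key (fl d) hfd (by rw [h1, hd'])
      · right
        obtain ⟨x, hx, hxv⟩ := List.mem_map.mp h1
        exact key x hx hxv.symm)
    simp only [List.length_cons, List.length_map] at he ⊢
    omega

end Part1b
end MorseLTG

namespace MorseLTG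
section Part1c
variable {S : Type*} {G : Type*} [Group G]
variable {σ : S → G} {R : Set (Word S)} {lab : Dt → S × Bool} {vert : Dt → ℕ × G}
    {base : ℕ × G} {outer : List Dt} {inner : List (List Dt)}

lemma exists_fresh (l : List Dt) : ∃ k : ℕ, ∀ b, (k, b) ∉ l := by
  obtain ⟨k, hk⟩ := Infinite.exists_notMem_finset (l.map Prod.fst).toFinset
  refine ⟨k, fun b hb => hk ?_⟩
  simp only [List.mem_toFinset, List.mem_map]
  exact ⟨_, hb, rfl⟩

/-- add a fresh edge `(k,true)` with label `x` from `u` to `v` -/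
lemma fresh_edge (lab : Dt → S × Bool) (vert : Dt → ℕ × G) (hl : ∀ d, lab (fl d) = fl (lab d))
    (hp : ∀ d, (vert (fl d)).2 = (vert d).2 * ev σ (lab d)) (k : ℕ) (x : S × Bool) (u v : ℕ × G)
    (huv : v.2 = u.2 * ev σ x) : ∃ (lab' : Dt → S × Bool) (vert' : Dt → ℕ × G),
    (∀ d, lab' (fl d) = fl (lab' d)) ∧ (∀ d, (vert' (fl d)).2 = (vert' d).2 * ev σ (lab' d)) ∧
    lab' (k, true) = x ∧ vert' (k, true) = u ∧ vert' (k, false) = v ∧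
    (∀ d : Dt, d.1 ≠ k → lab' d = lab d) ∧ (∀ d : Dt, d.1 ≠ k → vert' d = vert d) := by
  refine ⟨fun d => if d.1 = k then (if d.2 then x else fl x) else lab d,
    fun d => if d.1 = k then (if d.2 then u else v) else vert d, ?_, ?_, by simp, by simp, by simp,
    fun d hd => by simp [hd], fun d hd => by simp [hd]⟩
  · rintro ⟨j, b⟩
    have := hl (j, b)
    by_cases h : j = k
    · cases b <;> simp [fl, h]
    · simpa [fl, h] using this
  · rintro ⟨j, b⟩
    have := hp (j, b)
    by_cases h : j = k
    · cases b
      · have e : x.1 = (fl x).1 := rfl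
        simp only [fl, h, if_true, Bool.not_false]
        have := ev_fl σ x
        simp only [fl] at this
        simp [this, huv]
      · simp [fl, h, huv]
    · simpa [fl, h] using this

lemma Dg.insert1 {A B : List Dt} (h : Dg σ R lab vert base (A ++ B) inner) (x : S × Bool) :
    ∃ lab' vert' d, lab' d = x ∧ Dg σ R lab' vert' base (A ++ d :: fl d :: B) inner ∧
      (∀ e ∈ A ++ B ++ inner.flatten, lab' e = lab e) := by
  classical
  obtain ⟨k, hk⟩ := exists_fresh (A ++ B ++ inner.flatten)
  obtain ⟨m, hA, hB⟩ := walk_append.mp h.wk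
  obtain ⟨j, hj⟩ := Infinite.exists_notMem_finset
    ((insert base ((A ++ B ++ inner.flatten).map vert).toFinset).image Prod.fst)
  obtain ⟨lab', vert', h1, h2, h3, h4, h5, h6, h7⟩ := fresh_edge lab vert h.lab_fl h.pos k x m
    (j, m.2 * ev σ x) rfl
  have hne : ∀ e ∈ A ++ B ++ inner.flatten, e.1 ≠ k := by
    rintro ⟨e, b⟩ he rfl
    exact hk b he
  have hv : ∀ e ∈ A ++ B ++ inner.flatten, vert' e = vert e := fun e he => h7 e (hne e he)
  have hv' : ∀ e ∈ A ++ B ++ inner.flatten, vert' (fl e) = vert (fl e) :=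
    fun e he => h7 _ (hne e he)
  have hp : ((A ++ (k, true) :: fl (k, true) :: B) ++ inner.flatten).Perm
      ((k, true) :: (k, false) :: (A ++ B ++ inner.flatten)) := by
    rw [List.perm_iff_count]; intro a
    simp [List.count_cons, fl]; ring
  refine ⟨lab', vert', (k, true), h3, ⟨?_, ?_, h1, h2, ?_, ?_, ?_⟩, fun e he => h6 e (hne e he)⟩
  · rw [hp.nodup_iff]
    refine List.nodup_cons.mpr ⟨?_, List.nodup_cons.mpr ⟨hk _, h.nd⟩⟩
    simp only [List.mem_cons, not_or]
    exact ⟨by simp, hk _⟩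
  · intro e he
    rw [hp.mem_iff] at he ⊢
    simp only [List.mem_cons] at he ⊢
    rcases he with rfl | rfl | he
    · right; left; rfl
    · left; rfl
    · right; right; exact h.cl e he
  · refine walk_append.mpr ⟨m, walk_congr hA (fun x hx => hv x (by simp [hx]))
      (fun x hx => hv' x (by simp [hx])), h4, rfl, ?_⟩
    rw [fl_fl, h4]
    exact walk_congr hB (fun x hx => hv x (by simp [hx])) (fun x hx => hv' x (by simp [hx]))
  · intro l hl
    have hmem : ∀ x ∈ l, x ∈ A ++ B ++ inner.flatten := fun x hx => by
      simp only [List.mem_append, List.mem_flatten]; right; exact ⟨l, hl, hx⟩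
    obtain ⟨i1, i2, u, i3⟩ := h.inn l hl
    refine ⟨i1, ?_, u, walk_congr i3 (fun x hx => hv x (hmem x hx)) (fun x hx => hv' x (hmem x hx))⟩
    rwa [List.map_congr_left (fun x hx => h6 x (hne x (hmem x hx)))]
  · have he := h.eul
    rw [hp.length_eq, List.toFinset_eq_of_perm _ _ (hp.map vert')]
    have hsub : insert (j, m.2 * ev σ x) (insert base ((A ++ B ++ inner.flatten).map vert).toFinset)
        ⊆ insert base (((k, true) :: (k, false) :: (A ++ B ++ inner.flatten)).map vert').toFinset := by
      intro v hvv
      simp only [List.map_cons, List.toFinset_cons, Finset.mem_insert, List.mem_toFinset,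
        List.map_congr_left hv] at hvv ⊢
      rw [h5]; tauto
    have h8 := Finset.card_le_card hsub
    rw [Finset.card_insert_of_notMem] at h8
    · simp only [List.length_cons] at *
      omega
    · intro hh
      exact hj (Finset.mem_image.mpr ⟨_, hh, rfl⟩)

lemma Dg.insertList (t : Word S) {A B : List Dt} (h : Dg σ R lab vert base (A ++ B) inner) :
    ∃ lab' vert' y, y.map lab' = t ∧
      Dg σ R lab' vert' base (A ++ y ++ (y.map fl).reverse ++ B) inner ∧
      (∀ e ∈ A ++ B ++ inner.flatten, lab' e = lab e) := by
  induction t generalizing A B lab vert with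
  | nil => exact ⟨lab, vert, [], rfl, by simpa using h, fun _ _ => rfl⟩
  | cons x t ih =>
    obtain ⟨lab1, vert1, d, h1, h2, h3⟩ := h.insert1 x
    have h2' : Dg σ R lab1 vert1 base ((A ++ [d]) ++ (fl d :: B)) inner := by simpa using h2
    obtain ⟨lab2, vert2, y, h4, h5, h6⟩ := ih h2'
    refine ⟨lab2, vert2, d :: y, ?_, by simpa using h5, ?_⟩
    · simp only [List.map_cons, h4]
      rw [h6 d (by simp), h1]
    · intro e he
      rw [h6 e (by simp only [List.mem_append, List.mem_cons] at he ⊢; tauto), h3 e he]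

lemma Dg.bridge {A B y : List Dt} (h : Dg σ R lab vert base (A ++ y ++ B) inner)
    (hR : ∀ r ∈ R, evalWord σ r = 1) (x : S × Bool) (hx : fl x :: y.map lab ∈ symmClosure R) :
    ∃ lab' vert' d, lab' d = x ∧ Dg σ R lab' vert' base (A ++ d :: B) ((fl d :: y) :: inner) ∧
      (∀ e ∈ A ++ y ++ B ++ inner.flatten, lab' e = lab e) := by
  classical
  obtain ⟨k, hk⟩ := exists_fresh (A ++ y ++ B ++ inner.flatten)
  have hwk := h.wk
  rw [List.append_assoc] at hwk
  obtain ⟨m, hA, hwk⟩ := walk_append.mp hwk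
  obtain ⟨m', hy, hB⟩ := walk_append.mp hwk
  have hmm : m'.2 = m.2 * ev σ x := by
    rw [walk_pos h.pos hy]
    have := symm_eval hR hx
    rw [evalWord_cons, ev_fl, inv_mul_eq_one] at this
    rw [this]
  obtain ⟨lab', vert', h1, h2, h3, h4, h5, h6, h7⟩ := fresh_edge lab vert h.lab_fl h.pos k x m
    m' hmm
  have hne : ∀ e ∈ A ++ y ++ B ++ inner.flatten, e.1 ≠ k := by
    rintro ⟨e, b⟩ he rfl
    exact hk b he
  have hv : ∀ e ∈ A ++ y ++ B ++ inner.flatten, vert' e = vert e := fun e he => h7 e (hne e he)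
  have hv' : ∀ e ∈ A ++ y ++ B ++ inner.flatten, vert' (fl e) = vert (fl e) :=
    fun e he => h7 _ (hne e he)
  have hp : ((A ++ (k, true) :: B) ++ ((fl (k, true) :: y) :: inner).flatten).Perm
      ((k, true) :: (k, false) :: (A ++ y ++ B ++ inner.flatten)) := by
    rw [List.perm_iff_count]; intro a
    simp [List.count_cons, fl]; ring
  refine ⟨lab', vert', (k, true), h3, ⟨?_, ?_, h1, h2, ?_, ?_, ?_⟩, fun e he => h6 e (hne e he)⟩
  · rw [hp.nodup_iff]
    refine List.nodup_cons.mpr ⟨?_, List.nodup_cons.mpr ⟨hk _, h.nd⟩⟩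
    simp only [List.mem_cons, not_or]
    exact ⟨by simp, hk _⟩
  · intro e he
    rw [hp.mem_iff] at he ⊢
    simp only [List.mem_cons] at he ⊢
    rcases he with rfl | rfl | he
    · right; left; rfl
    · left; rfl
    · right; right; exact h.cl e he
  · refine walk_append.mpr ⟨m, walk_congr hA (fun x hx => hv x (by simp [hx]))
      (fun x hx => hv' x (by simp [hx])), h4, ?_⟩
    have : vert' (fl (k, true)) = m' := h5
    rw [this]
    exact walk_congr hB (fun x hx => hv x (by simp [hx])) (fun x hx => hv' x (by simp [hx]))
  · intro l hl
    rcases List.mem_cons.mp hl with rfl | hl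
    · refine ⟨by simp, ?_, m', h5, ?_⟩
      · rw [List.map_cons, h1, h3, List.map_congr_left (fun x hx => h6 x (hne x (by simp [hx])))]
        exact hx
      · rw [fl_fl, h4]
        exact walk_congr hy (fun x hx => hv x (by simp [hx])) (fun x hx => hv' x (by simp [hx]))
    have hmem : ∀ x ∈ l, x ∈ A ++ y ++ B ++ inner.flatten := fun x hx => by
      simp only [List.mem_append, List.mem_flatten]; right; exact ⟨l, hl, hx⟩
    obtain ⟨i1, i2, u, i3⟩ := h.inn l hl
    refine ⟨i1, ?_, u, walk_congr i3 (fun x hx => hv x (hmem x hx)) (fun x hx => hv' x (hmem x hx))⟩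
    rwa [List.map_congr_left (fun x hx => h6 x (hne x (hmem x hx)))]
  · have he := h.eul
    rw [hp.length_eq, List.toFinset_eq_of_perm _ _ (hp.map vert')]
    have hsub : (insert base ((A ++ y ++ B ++ inner.flatten).map vert).toFinset)
        ⊆ insert base (((k, true) :: (k, false) :: (A ++ y ++ B ++ inner.flatten)).map vert').toFinset := by
      intro v hvv
      simp only [List.map_cons, List.toFinset_cons, Finset.mem_insert, List.mem_toFinset,
        List.map_congr_left hv] at hvv ⊢
      tauto
    have h8 := Finset.card_le_card hsub
    simp only [List.length_cons] at *
    omega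

lemma Dg.init (σ : S → G) (R : Set (Word S)) (s : S) (g : G) :
    ∃ lab vert, Dg σ R lab vert (0, g) [] [] := by
  refine ⟨fun d => (s, d.2), fun d => (0, if d.2 then 1 else σ s), by simp, by simp, by simp [fl],
    ?_, rfl, by simp, by simp⟩
  rintro ⟨k, b⟩
  cases b <;> simp [fl, ev]

/-- there is a reduced diagram with boundary word `W` and at most `n` faces -/
def HasRed (σ : S → G) (R : Set (Word S)) (g : G) (n : ℕ) (W : Word S) : Prop :=
  ∃ lab vert base outer inner, Dg σ R lab vert base outer inner ∧ RedDg lab inner ∧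
    outer.map lab = W ∧ inner.length ≤ n ∧ base.2 = g

end Part1c
end MorseLTG

namespace MorseLTG
section Part1d
variable {S : Type*} {G : Type*} [Group G]
variable {σ : S → G} {R : Set (Word S)} {g : G}

lemma RedDg.congr {lab lab' : Dt → S × Bool} {inner : List (List Dt)} (h : RedDg lab inner)
    (hl : ∀ l ∈ inner, ∀ e ∈ l, lab' e = lab e) : RedDg lab' inner := by
  intro l h1 l' h2 d y y' h3 h4
  have e1 : y.map lab' = y.map lab :=
    List.map_congr_left (fun x hx => hl l h1 x (h3.perm.mem_iff.mpr (by simp [hx])))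
  have e2 : y'.map lab' = y'.map lab :=
    List.map_congr_left (fun x hx => hl l' h2 x (h4.perm.mem_iff.mpr (by simp [hx])))
  rw [e1, e2]
  exact h l h1 l' h2 d y y' h3 h4

lemma rot_map_cons {α β : Type*} {f : α → β} {l : List α} {e : β} {z : List β}
    (h : l.map f ~r e :: z) : ∃ e0 z0, l ~r e0 :: z0 ∧ f e0 = e ∧ z0.map f = z := by
  obtain ⟨k, hk⟩ := h
  rw [← List.map_rotate] at hk
  obtain ⟨e0, z0, h1, h2, h3⟩ := List.map_eq_cons_iff.mp hk
  exact ⟨e0, z0, ⟨k, h1⟩, h2, h3⟩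

lemma cancel_list {P : Word S → Prop} (hP : ∀ A a B, P (A ++ a :: fl a :: B) → P (A ++ B))
    (y A B : Word S) (h : P (A ++ wordInv y ++ y ++ B)) : P (A ++ B) := by
  induction y generalizing A B with
  | nil => simpa using h
  | cons a y ih =>
    rw [wordInv_cons] at h
    apply ih
    have := hP (A ++ wordInv y) (fl a) (y ++ B) (by simpa using h)
    simpa using this

lemma hasRed_fold (hcr : ∀ r ∈ R, CyclicallyReduced r) : ∀ n A a B,
    HasRed σ R g n (A ++ a :: fl a :: B) → HasRed σ R g n (A ++ B) := by
  intro n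
  induction n using Nat.strong_induction_on with
  | _ n ih =>
  rintro A a B ⟨lab, vert, base, outer, inner, hD, hred, hout, hlen, hb⟩
  obtain ⟨A', o1, rfl, hA', h1⟩ := List.map_eq_append_iff.mp hout
  obtain ⟨d, o2, rfl, hd, h2⟩ := List.map_eq_cons_iff.mp h1
  obtain ⟨d', B', rfl, hd', hB'⟩ := List.map_eq_cons_iff.mp h2
  by_cases hdd : d' = fl d
  · subst hdd
    exact ⟨lab, vert, base, _, inner, hD.foldSpur, hred, by simp [hA', hB'], hlen, hb⟩
  by_cases hc : ∃ l ∈ inner, ∃ l' ∈ inner, ∃ y y', l ~r fl d :: y ∧ l' ~r fl d' :: y' ∧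
      y.map lab = wordInv (y'.map lab)
  · obtain ⟨l, hl, l', hl', y, y', h3, h4, h5⟩ := hc
    obtain ⟨I, hI, hDI⟩ := hD.normalize hl h3
    rcases List.mem_cons.mp (hI.mem_iff.mp hl') with rfl | hl'I
    · exfalso
      obtain ⟨i1, i2, -⟩ := hD.inn l' hl
      have h6 := (h3.symm.trans h4).map lab
      simp only [List.map_cons, hD.lab_fl, hd, hd', fl_fl, h5] at h6
      have h7 : l'.map lab ~r a :: y'.map lab := by
        have := h4.map lab
        simpa [hD.lab_fl, hd'] using this
      have h8 : wordInv (a :: y'.map lab) ~r fl a :: wordInv (y'.map lab) := by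
        rw [wordInv_cons]
        exact List.isRotated_append
      have := not_rot_inv (symm_cycRed hcr (symm_rot i2 h7)) ((h8.trans h6).symm)
      simp at this
    · obtain ⟨J, hJ, hDJ⟩ := hDI.removeFace.normalize hl'I h4
      have hDJ' : Dg σ R lab vert base ((A' ++ y) ++ d' :: B') ((fl d' :: y') :: J) := by
        simpa using hDJ
      have hDK := hDJ'.removeFace
      have e1 := hI.length_eq
      have e2 := hJ.length_eq
      simp only [List.length_cons] at e1 e2
      have hsub : J ⊆ inner := by
        intro x hx
        rw [hI.mem_iff]
        exact List.mem_cons_of_mem _ (hJ.mem_iff.mpr (List.mem_cons_of_mem _ hx))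
      have hK : HasRed σ R g (n - 2) (A ++ wordInv (y'.map lab) ++ y'.map lab ++ B) :=
        ⟨lab, vert, base, _, J, hDK, hred.mono hsub, by simp [hA', hB', h5], by omega, hb⟩
      have hK2 := cancel_list (P := HasRed σ R g (n - 2)) (ih (n-2) (by omega)) _ _ _ hK
      obtain ⟨a1, a2, a3, a4, a5, b1, b2, b3, b4, b5⟩ := hK2
      exact ⟨a1, a2, a3, a4, a5, b1, b2, b3, by omega, b5⟩
  · classical
    obtain ⟨vert', base', hb', hD'⟩ := hD.fold hdd (by rw [hd, hd'])
    set ρ : Dt → Dt := fun x => if x = fl d' then d else x with hρ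
    have rl : ∀ x, lab (ρ x) = lab x := by
      intro x
      by_cases hx : x = fl d'
      · simp only [hρ, hx, if_true, hD.lab_fl, hd, hd', fl_fl]
      · simp [hρ, hx]
    have rl' : ∀ l : List Dt, (l.map ρ).map lab = l.map lab := fun l => by
      rw [List.map_map]; exact List.map_congr_left (fun x _ => rl x)
    refine ⟨lab, vert', base', _, _, hD', ?_, ?_, by simpa using hlen, by rw [hb', hb]⟩
    · intro l hl l' hl' e z z' h3 h4 h5
      obtain ⟨k, hk, rfl⟩ := List.mem_map.mp hl
      obtain ⟨k', hk', rfl⟩ := List.mem_map.mp hl'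
      obtain ⟨e0, z0, r1, r2, rfl⟩ := rot_map_cons h3
      obtain ⟨e1, z1, r3, r4, rfl⟩ := rot_map_cons h4
      rw [rl', rl'] at h5
      rw [← r2] at r4
      simp only [hρ] at r4
      split_ifs at r4 with c1 c2 c2
      · exact fl_ne d r4.symm
      · apply hc
        refine ⟨k, hk, k', hk', z0, z1, ?_, ?_, h5⟩
        · rw [r4, fl_fl]; exact r1
        · rw [← c1]; exact r3
      · apply hc
        refine ⟨k', hk', k, hk, z1, z0, ?_, ?_, by rw [h5, wordInv_wordInv]⟩
        · rw [← r4]; exact r3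
        · rw [← c2]; exact r1
      · rw [r4] at r3
        exact hred k hk k' hk' e0 z0 z1 r1 r3 h5
    · rw [rl']; simp [hA', hB']

lemma hasRed_insert (n : ℕ) (A B t : Word S) (h : HasRed σ R g n (A ++ B)) :
    HasRed σ R g n (A ++ t ++ wordInv t ++ B) := by
  obtain ⟨lab, vert, base, outer, inner, hD, hred, hout, hlen, hb⟩ := h
  obtain ⟨A', B', rfl, hA', hB'⟩ := List.map_eq_append_iff.mp hout
  obtain ⟨lab', vert', y, h1, h2, h3⟩ := hD.insertList t
  refine ⟨lab', vert', base, _, inner, h2, hred.congr ?_, ?_, hlen, hb⟩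
  · intro l hl e he
    exact h3 e (by simp only [List.mem_append, List.mem_flatten]; right; exact ⟨l, hl, he⟩)
  · have e1 : A'.map lab' = A := by
      rw [← hA']; exact List.map_congr_left (fun x hx => h3 x (by simp [hx]))
    have e2 : B'.map lab' = B := by
      rw [← hB']; exact List.map_congr_left (fun x hx => h3 x (by simp [hx]))
    have e3 : (y.map fl).map lab' = t.map fl := by
      rw [← h1, List.map_map, List.map_map]
      exact List.map_congr_left (fun x _ => h2.lab_fl x)
    simp only [List.map_append, e1, e2, h1, List.map_reverse, e3, wordInv_eq]

lemma hasRed_attach (hR : ∀ r ∈ R, evalWord σ r = 1) (n : ℕ) (A B r : Word S)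
    (hr : r ∈ symmClosure R) (h : HasRed σ R g n (A ++ B)) :
    HasRed σ R g (n + 1) (A ++ r ++ B) := by
  cases r with
  | nil =>
    obtain ⟨a1, a2, a3, a4, a5, b1, b2, b3, b4, b5⟩ := h
    exact ⟨a1, a2, a3, a4, a5, b1, b2, by simpa using b3, by omega, b5⟩
  | cons x t =>
  obtain ⟨lab, vert, base, outer, inner, hD, hred, hout, hlen, hb⟩ := h
  obtain ⟨A', B', rfl, hA', hB'⟩ := List.map_eq_append_iff.mp hout
  obtain ⟨lab', vert', y, h1, h2, h3⟩ := hD.insertList (wordInv t)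
  rw [List.append_assoc (A' ++ y)] at h2
  have hx : fl x :: y.map lab' ∈ symmClosure R := by
    rw [h1]
    refine symm_rot (symm_inv hr) ?_
    rw [wordInv_cons]; exact List.isRotated_append
  obtain ⟨lab2, vert2, d, k1, k2, k3⟩ := h2.bridge hR x hx
  have hl2 : ∀ e ∈ A' ++ B' ++ inner.flatten, lab2 e = lab e := by
    intro e he
    rw [k3 e (by simp only [List.mem_append] at he ⊢; tauto), h3 e he]
  refine ⟨lab2, vert2, base, _, _, k2, ?_, ?_, by simp; omega, hb⟩
  · have hold : RedDg lab2 inner := hred.congr (fun l hl e he =>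
      hl2 e (by simp only [List.mem_append, List.mem_flatten]; right; exact ⟨l, hl, he⟩))
    have hnd := k2.nd
    -- partners of the new face are outer
    have hpart : ∀ e ∈ fl d :: y, fl e ∈ A' ++ d :: ((y.map fl).reverse ++ B') := by
      intro e he
      rcases List.mem_cons.mp he with rfl | he
      · simp
      · simp only [List.mem_append, List.mem_cons, List.mem_reverse, List.mem_map]
        right; right; left; exact ⟨e, he, rfl⟩
    have hno : ∀ e ∈ fl d :: y, ∀ l ∈ (fl d :: y) :: inner, fl e ∉ l := by
      intro e he l hl hel
      exact (List.disjoint_of_nodup_append hnd) (hpart e he) (List.mem_flatten.mpr ⟨l, hl, hel⟩)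
    intro l hl l' hl' e z z' r1 r2
    rcases List.mem_cons.mp hl with rfl | hl0
    · exact absurd (r2.perm.mem_iff.mpr (by simp)) (hno e (r1.perm.mem_iff.mpr (by simp)) l' hl')
    rcases List.mem_cons.mp hl' with rfl | hl0'
    · refine absurd (r1.perm.mem_iff.mpr (by simp)) (hno (fl e) (r2.perm.mem_iff.mpr (by simp)) l hl)
    exact hold l hl0 l' hl0' e z z' r1 r2
  · have e1 : A'.map lab2 = A := by
      rw [← hA']; exact List.map_congr_left (fun x hx => hl2 x (by simp [hx]))
    have e2 : B'.map lab2 = B := by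
      rw [← hB']; exact List.map_congr_left (fun x hx => hl2 x (by simp [hx]))
    have e0 : y.map lab2 = y.map lab' := List.map_congr_left (fun x hx => k3 x (by simp [hx]))
    have e3 : (y.map fl).map lab2 = (wordInv t).map fl := by
      rw [← h1, ← e0, List.map_map, List.map_map]
      exact List.map_congr_left (fun x _ => k2.lab_fl x)
    simp only [List.map_append, e1, e2, List.map_cons, k1, List.map_reverse, e3]
    rw [← wordInv_eq, wordInv_wordInv]; simp

def HasRed' (σ : S → G) (R : Set (Word S)) (g : G) (W : Word S) : Prop := ∃ n, HasRed σ R g n W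

lemma hasRed_free (hcr : ∀ r ∈ R, CyclicallyReduced r) {W W' : Word S}
    (hW : FreeGroup.mk W = FreeGroup.mk W') (h : HasRed' σ R g W) : HasRed' σ R g W' := by
  obtain ⟨V, h1, h2⟩ := FreeGroup.Red.exact.mp hW
  have hV : HasRed' σ R g V := by
    refine Relation.ReflTransGen.head_induction_on (motive := fun X _ => HasRed' σ R g X → HasRed' σ R g V)
      h1 (fun h => h) ?_ h
    intro a c hac _ ih hh
    apply ih
    obtain ⟨n, hn⟩ := hh
    cases hac with
    | not => exact ⟨n, hasRed_fold hcr n _ _ _ hn⟩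
  refine Relation.ReflTransGen.head_induction_on (motive := fun X _ => HasRed' σ R g X)
      h2 hV ?_
  intro a c hac _ ih
  obtain ⟨n, hn⟩ := ih
  cases hac with
  | @not A B x b =>
    have := hasRed_insert n A B [(x, b)] hn
    exact ⟨n, by simpa [wordInv] using this⟩

lemma mk_wordInv (w : Word S) : FreeGroup.mk (wordInv w) = (FreeGroup.mk w)⁻¹ := by
  rw [FreeGroup.inv_mk]; rfl

lemma diagram_exists [Nonempty S] (hcr : ∀ r ∈ R, CyclicallyReduced r)
    (hR : ∀ r ∈ R, evalWord σ r = 1) (g : G) (W : Word S)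
    (hW : FreeGroup.mk W ∈ Subgroup.normalClosure (FreeGroup.mk '' R)) :
    HasRed' σ R g W := by
  classical
  suffices H : ∀ x ∈ Subgroup.normalClosure (FreeGroup.mk '' R), ∀ W, FreeGroup.mk W = x →
      HasRed' σ R g W from H _ hW W rfl
  have step : ∀ (u r W' : Word S), r ∈ symmClosure R → HasRed' σ R g W' →
      HasRed' σ R g (u ++ r ++ wordInv u ++ W') := by
    rintro u r W' hr ⟨n, hn⟩
    have h1 := hasRed_insert n [] W' u hn
    simp only [List.nil_append] at h1
    rw [List.append_assoc] at h1
    have := hasRed_attach hR n u (wordInv u ++ W') r hr h1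
    exact ⟨n+1, by simpa using this⟩
  have hconj : ∀ x ∈ Group.conjugatesOfSet (FreeGroup.mk '' R), ∃ u r, r ∈ R ∧
      x = FreeGroup.mk (u ++ r ++ wordInv u) := by
    intro x hx
    obtain ⟨_, ⟨r, hr, rfl⟩, hc⟩ := Group.mem_conjugatesOfSet_iff.mp hx
    obtain ⟨c, hc⟩ := isConj_iff.mp hc
    refine ⟨c.toWord, r, hr, ?_⟩
    rw [← hc, ← FreeGroup.mul_mk, ← FreeGroup.mul_mk, mk_wordInv, FreeGroup.mk_toWord]
  intro x hx
  refine Subgroup.closure_induction_left (p := fun x _ => ∀ W, FreeGroup.mk W = x → HasRed' σ R g W)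
    ?_ ?_ ?_ hx
  · intro W hW
    obtain ⟨s⟩ := ‹Nonempty S›
    obtain ⟨lab, vert, hD⟩ := Dg.init σ R s g
    refine hasRed_free hcr (W := []) (by rw [hW]; rfl) ⟨0, lab, vert, _, _, _, hD, ?_, rfl, le_rfl, rfl⟩
    intro l hl; simp at hl
  · intro x hx y hy ih W hW
    obtain ⟨u, r, hr, rfl⟩ := hconj x hx
    refine hasRed_free hcr ?_ (step u r y.toWord ⟨r, hr, 0, by simp⟩ (ih _ FreeGroup.mk_toWord))
    rw [hW, ← FreeGroup.mul_mk, FreeGroup.mk_toWord]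
  · intro x hx y hy ih W hW
    obtain ⟨u, r, hr, rfl⟩ := hconj x hx
    refine hasRed_free hcr ?_ (step u (wordInv r) y.toWord (symm_inv ⟨r, hr, 0, by simp⟩)
      (ih _ FreeGroup.mk_toWord))
    rw [hW, ← FreeGroup.mul_mk, FreeGroup.mk_toWord, ← mk_wordInv]
    simp [wordInv_append]

end Part1d
end MorseLTG

namespace MorseLTG
section Orb
variable {D : Type*} [Fintype D] [DecidableEq D] (f : Equiv.Perm D)

open Classical in
noncomputable def orb (d : D) : Finset D := Finset.univ.filter (fun x => f.SameCycle d x)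
noncomputable def nn (d : D) : ℕ := (orb f d).card

lemma mem_orb {d x : D} : x ∈ orb f d ↔ f.SameCycle d x := by simp [orb]
lemma self_orb (d : D) : d ∈ orb f d := by
  rw [mem_orb]
lemma pow_orb (d : D) (i : ℕ) : (f ^ i) d ∈ orb f d := by
  rw [mem_orb]; exact ⟨i, by simp⟩
lemma zpow_orb (d : D) (i : ℤ) : (f ^ i) d ∈ orb f d := by
  rw [mem_orb]; exact ⟨i, rfl⟩
lemma f_orb (d : D) : f d ∈ orb f d := by simpa using pow_orb f d 1
lemma orb_eq {d x : D} (h : x ∈ orb f d) : orb f x = orb f d := by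
  ext y
  rw [mem_orb] at *
  rw [mem_orb]
  exact ⟨fun h' => h.trans h', fun h' => h.symm.trans h'⟩
lemma nn_eq {d x : D} (h : x ∈ orb f d) : nn f x = nn f d := by rw [nn, orb_eq f h, nn]
lemma nn_pos (d : D) : 0 < nn f d := Finset.card_pos.mpr ⟨d, self_orb f d⟩

lemma mp_pos (d : D) : 0 < Function.minimalPeriod f d := by
  refine Function.IsPeriodicPt.minimalPeriod_pos (orderOf_pos f) ?_
  rw [Function.IsPeriodicPt, Function.IsFixedPt, ← Equiv.Perm.coe_pow, pow_orderOf_eq_one]; rfl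

lemma orb_image (d : D) : orb f d = (Finset.range (Function.minimalPeriod f d)).image
    (fun i => (f ^ i) d) := by
  ext x
  rw [mem_orb, Finset.mem_image]
  constructor
  · intro h
    obtain ⟨i, -, hi⟩ := h.exists_pow_eq''
    refine ⟨i % Function.minimalPeriod f d, Finset.mem_range.mpr (Nat.mod_lt _ (mp_pos f d)), ?_⟩
    rw [← hi.2, Equiv.Perm.coe_pow, Equiv.Perm.coe_pow, Function.iterate_mod_minimalPeriod_eq]
  · rintro ⟨i, -, hi⟩
    exact ⟨i, by simpa using hi⟩

lemma nn_mp (d : D) : nn f d = Function.minimalPeriod f d := by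
  rw [nn, orb_image, Finset.card_image_of_injOn, Finset.card_range]
  intro i hi j hj hij
  simp only [Finset.coe_range, Set.mem_Iio] at hi hj
  simp only [Equiv.Perm.coe_pow] at hij
  exact (Function.iterate_eq_iterate_iff_of_lt_minimalPeriod hi hj).mp hij

lemma pow_inj {d : D} {i j : ℕ} (hi : i < nn f d) (hj : j < nn f d)
    (h : (f ^ i) d = (f ^ j) d) : i = j := by
  rw [nn_mp] at hi hj
  simp only [Equiv.Perm.coe_pow] at h
  exact (Function.iterate_eq_iterate_iff_of_lt_minimalPeriod hi hj).mp h

lemma pow_nn (d : D) : (f ^ nn f d) d = d := by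
  rw [nn_mp, Equiv.Perm.coe_pow]; exact Function.iterate_minimalPeriod

lemma nn_dvd {d : D} {k : ℕ} (h : (f ^ k) d = d) : nn f d ∣ k := by
  rw [nn_mp]
  apply Function.IsPeriodicPt.minimalPeriod_dvd
  rw [Equiv.Perm.coe_pow] at h
  exact h

lemma pow_mod (d : D) (k : ℕ) : (f ^ (k % nn f d)) d = (f ^ k) d := by
  rw [nn_mp, Equiv.Perm.coe_pow, Equiv.Perm.coe_pow, Function.iterate_mod_minimalPeriod_eq]

lemma mem_orb_lt {d x : D} (h : x ∈ orb f d) : ∃ i < nn f d, (f ^ i) d = x := by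
  rw [orb_image] at h
  obtain ⟨i, hi, h⟩ := Finset.mem_image.mp h
  exact ⟨i, by rw [nn_mp]; exact Finset.mem_range.mp hi, h⟩

lemma sum_orb {M : Type*} [AddCommMonoid M] (d : D) (h : D → M) :
    ∑ x ∈ orb f d, h x = ∑ i ∈ Finset.range (nn f d), h ((f ^ i) d) := by
  have : orb f d = (Finset.range (nn f d)).image (fun i => (f ^ i) d) := by rw [nn_mp, ← orb_image]
  rw [this, Finset.sum_image]
  intro i hi j hj hij
  exact pow_inj f (by simpa using hi) (by simpa using hj) hij

lemma sum_orb_shift {M : Type*} [AddCommMonoid M] (d : D) (h : D → M) :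
    ∑ x ∈ orb f d, h (f x) = ∑ x ∈ orb f d, h x := by
  refine Finset.sum_bij (fun x _ => f x) ?_ (fun _ _ _ _ h => f.injective h) ?_ (fun _ _ => rfl)
  · intro x hx; rw [← orb_eq f hx]; exact f_orb f x
  · intro y hy
    refine ⟨f⁻¹ y, ?_, by simp⟩
    have := zpow_orb f y (-1)
    rw [orb_eq f hy] at this; simpa using this

lemma sum_fiber (h : D → ℝ) :
    ∑ x, h x = ∑ F ∈ Finset.univ.image (orb f), ∑ x ∈ F, h x := by
  classical
  rw [← Finset.sum_fiberwise_of_maps_to (g := orb f) (t := Finset.univ.image (orb f))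
    (fun x _ => Finset.mem_image_of_mem _ (Finset.mem_univ x))]
  refine Finset.sum_congr rfl ?_
  intro F hF
  obtain ⟨d, -, rfl⟩ := Finset.mem_image.mp hF
  congr 1
  ext x
  simp only [Finset.mem_filter, Finset.mem_univ, true_and]
  constructor
  · intro h; rw [← h]; exact self_orb f x
  · intro h; exact orb_eq f h

lemma sum_le_zero {h : D → ℝ} (hh : ∀ d, ∑ x ∈ orb f d, h x ≤ 0) : ∑ x, h x ≤ 0 := by
  rw [sum_fiber f]
  refine Finset.sum_nonpos ?_
  intro F hF
  obtain ⟨d, -, rfl⟩ := Finset.mem_image.mp hF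
  exact hh d

lemma sum_inv_orb (d : D) : ∑ x ∈ orb f d, (1 : ℝ) / nn f x = 1 := by
  rw [Finset.sum_congr rfl (fun x hx => by rw [nn_eq f hx])]
  rw [Finset.sum_const, nsmul_eq_mul]
  have : (0:ℝ) < nn f d := by exact_mod_cast nn_pos f d
  change ((nn f d : ℕ) : ℝ) * _ = 1
  field_simp

lemma card_orbs : ((Finset.univ.image (orb f)).card : ℝ) = ∑ x, (1 : ℝ) / nn f x := by
  rw [sum_fiber f, Finset.card_eq_sum_ones, Nat.cast_sum]
  refine Finset.sum_congr rfl ?_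
  intro F hF
  obtain ⟨d, -, rfl⟩ := Finset.mem_image.mp hF
  rw [sum_inv_orb]; simp

lemma card_image_le {α : Type*} [DecidableEq α] (v : D → α) (hv : ∀ d, v (f d) = v d) :
    ((Finset.univ.image v).card : ℝ) ≤ ∑ x, (1 : ℝ) / nn f x := by
  rw [← card_orbs, Nat.cast_le]
  have hv' : ∀ d x, x ∈ orb f d → v x = v d := by
    intro d x hx
    obtain ⟨i, -, rfl⟩ := mem_orb_lt f hx
    induction i with
    | zero => simp
    | succ i ih => rw [pow_succ', Equiv.Perm.mul_apply, hv]; exact ih (pow_orb f d i)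
  rcases isEmpty_or_nonempty D with hD | hD
  · simp
  choose! c hc using (fun F (hF : F ∈ Finset.univ.image (orb f)) => (Finset.mem_image.mp hF))
  refine Finset.card_le_card_of_surjOn (fun F => v (c F)) ?_
  intro y hy
  obtain ⟨x, -, rfl⟩ := Finset.mem_image.mp (Finset.mem_coe.mp hy)
  have hx : orb f x ∈ Finset.univ.image (orb f) := Finset.mem_image_of_mem _ (Finset.mem_univ _)
  refine ⟨orb f x, hx, ?_⟩
  have h2 := (hc _ hx).2
  have h3 := self_orb f (c (orb f x))
  rw [h2] at h3
  exact hv' _ _ h3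

end Orb

structure PM {S : Type*} {G : Type*} [Group G] (σ : S → G) (R : Set (Word S)) (W : Word S) (g : G)
    (D : Type) [Fintype D] [DecidableEq D] where
  φ : Equiv.Perm D
  μ : D → D
  lab : D → S × Bool
  pos : D → G
  o : ℕ → D
  μμ : ∀ d, μ (μ d) = d
  μne : ∀ d, μ d ≠ d
  lab_μ : ∀ d, lab (μ d) = fl (lab d)
  pos_φ : ∀ d, pos (φ d) = pos d * ev σ (lab d)
  pos_μ : ∀ d, pos (μ d) = pos d * ev σ (lab d)
  o_succ : ∀ i, φ (o i) = o (i + 1)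
  o_per : ∀ i, o (i + W.length) = o i
  o_inj : ∀ i j, i < W.length → j < W.length → o i = o j → i = j
  lab_o : ∀ i (h : i < W.length), lab (o i) = W[i]
  pos_o : pos (o 0) = g
  face : ∀ d, (∀ i, d ≠ o i) → (List.range (nn φ d)).map (fun j => lab ((φ ^ j) d)) ∈ symmClosure R
  red : ∀ d, (∀ i, d ≠ o i) → (∀ i, μ d ≠ o i) → nn φ d = nn φ (μ d) →
    ¬ ∀ j < nn φ d, lab ((φ ^ j) d) = fl (lab ((φ ^ (nn φ d - j)) (μ d)))
  eul : (1 : ℝ) ≤ ∑ d, ((1 : ℝ) / nn (φ * (Equiv.mk μ μ μμ μμ : Equiv.Perm D)) d - 1 / 2) +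
    ((open Classical in Finset.univ.filter (fun d => ∀ i, d ≠ o i)).sum (fun d => (1:ℝ) / nn φ d))

end MorseLTG

namespace MorseLTG

lemma nn_unique {D : Type*} [Fintype D] [DecidableEq D] {f : Equiv.Perm D} {d : D} {k : ℕ}
    (h0 : 0 < k) (h1 : (f ^ k) d = d) (h2 : ∀ i, 0 < i → i < k → (f ^ i) d ≠ d) : nn f d = k := by
  have h3 := Nat.le_of_dvd h0 (nn_dvd f h1)
  by_contra hne
  exact h2 _ (nn_pos f d) (lt_of_le_of_ne h3 hne) (pow_nn f d)

section FP
variable {α : Type*} [DecidableEq α]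

lemma formProd_notMem (L : List (List α)) {d : α} (hd : d ∉ L.flatten) :
    (L.map List.formPerm).prod d = d := by
  induction L with
  | nil => simp
  | cons l L ih =>
    simp only [List.flatten_cons, List.mem_append, not_or] at hd
    simp only [List.map_cons, List.prod_cons, Equiv.Perm.mul_apply]
    rw [ih hd.2, List.formPerm_apply_of_notMem hd.1]

lemma formProd_mem (L : List (List α)) (hL : L.flatten.Nodup) {l : List α} (hl : l ∈ L) {d : α}
    (hd : d ∈ l) : (L.map List.formPerm).prod d = l.formPerm d := by
  induction L with
  | nil => simp at hl
  | cons k L ih =>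
    simp only [List.flatten_cons] at hL
    have hdis := List.disjoint_of_nodup_append hL
    simp only [List.map_cons, List.prod_cons, Equiv.Perm.mul_apply]
    rcases List.mem_cons.mp hl with rfl | hl
    · rw [formProd_notMem L (hdis hd)]
    · rw [ih hL.of_append_right hl, List.formPerm_apply_of_notMem]
      intro h
      exact hdis h (List.mem_flatten.mpr ⟨l, hl, List.formPerm_apply_mem_of_mem hd⟩)

lemma formProd_pow (L : List (List α)) (hL : L.flatten.Nodup) {l : List α} (hl : l ∈ L) (i : ℕ)
    (hi : i < l.length) (j : ℕ) : ((L.map List.formPerm).prod ^ j) l[i] =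
      l[(i + j) % l.length]'(Nat.mod_lt _ (by omega)) := by
  have hnd : l.Nodup := (List.nodup_flatten.mp hL).1 l hl
  induction j with
  | zero => simp [Nat.mod_eq_of_lt hi]
  | succ j ih =>
    rw [pow_succ', Equiv.Perm.mul_apply, ih, formProd_mem L hL hl (List.getElem_mem _),
      List.formPerm_apply_getElem _ hnd]
    congr 1
    simp [Nat.add_assoc]
end FP

section
variable {S : Type*} {G : Type*} [Group G] {σ : S → G} {R : Set (Word S)} {g : G} {W : Word S}

lemma pm_exists (h : HasRed' σ R g W) (hW : W ≠ []) :
    ∃ (D : Type) (_ : Fintype D) (_ : DecidableEq D), Nonempty (PM σ R W g D) := by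
  classical
  obtain ⟨_, lab, vert, base, outer, inner, hD, hred, hout, -, hb⟩ := h
  set all := outer ++ inner.flatten with hall
  set Φ : Equiv.Perm Dt := ((outer :: inner).map List.formPerm).prod with hΦ
  have hL : (outer :: inner).flatten.Nodup := by simpa using hD.nd
  have hlen : outer.length = W.length := by rw [← hout]; simp
  have hP : 0 < outer.length := by rw [hlen]; exact List.length_pos_iff.mpr hW
  have hsplit : ∀ x ∈ all, ∃ l ∈ outer :: inner, ∃ i, ∃ hi : i < l.length, x = l[i] := by
    intro x hx
    have : x ∈ (outer :: inner).flatten := by simpa [hall] using hx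
    obtain ⟨l, hl, hx⟩ := List.mem_flatten.mp this
    obtain ⟨i, hi, rfl⟩ := List.getElem_of_mem hx
    exact ⟨l, hl, i, hi, rfl⟩
  have hmem : ∀ l ∈ outer :: inner, ∀ x ∈ l, x ∈ all := by
    intro l hl x hx
    have : x ∈ (outer :: inner).flatten := List.mem_flatten.mpr ⟨l, hl, hx⟩
    simpa [hall] using this
  have hmap1 : ∀ x, x ∈ all → Φ x ∈ all := by
    intro x hx
    obtain ⟨l, hl, i, hi, rfl⟩ := hsplit x hx
    have := formProd_pow _ hL hl i hi 1
    rw [pow_one] at this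
    rw [hΦ, this]
    exact hmem l hl _ (List.getElem_mem _)
  have hmap : ∀ x, Φ x ∈ all ↔ x ∈ all := by
    intro x
    refine ⟨fun h => ?_, hmap1 x⟩
    by_contra hx
    have : Φ x = x := formProd_notMem _ (by simpa [hall] using hx)
    exact hx (this ▸ h)
  let D := {x : Dt // x ∈ all}
  let φ : Equiv.Perm D := Φ.subtypePerm hmap
  have hφ : ∀ l ∈ outer :: inner, ∀ (i : ℕ) (hi : i < l.length) (x : D), x.1 = l[i] → ∀ j : ℕ,
      ((φ ^ j) x).1 = l[(i + j) % l.length]'(Nat.mod_lt _ (by omega)) := by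
    intro l hl i hi x hx j
    rw [← formProd_pow _ hL hl i hi j, ← hx]
    clear hx
    induction j with
    | zero => rfl
    | succ j ih => rw [pow_succ', pow_succ', Equiv.Perm.mul_apply, Equiv.Perm.mul_apply, ← ih]; rfl
  have hlnd : ∀ l ∈ outer :: inner, l.Nodup := fun l hl => (List.nodup_flatten.mp hL).1 l hl
  have hnn : ∀ l ∈ outer :: inner, ∀ (i : ℕ) (hi : i < l.length) (x : D), x.1 = l[i] →
      nn φ x = l.length := by
    intro l hl i hi x hx
    refine nn_unique (by omega) ?_ ?_
    · apply Subtype.ext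
      rw [hφ l hl i hi x hx, hx]
      congr 1; simp [Nat.mod_eq_of_lt hi]
    · intro j hj0 hj1 heq
      have := congrArg Subtype.val heq
      rw [hφ l hl i hi x hx, hx] at this
      have := (hlnd l hl).getElem_inj_iff.mp this
      rcases lt_or_ge (i + j) l.length with h | h
      · rw [Nat.mod_eq_of_lt h] at this; omega
      · rw [Nat.mod_eq_sub_mod h, Nat.mod_eq_of_lt (by omega)] at this; omega
  have hword : ∀ l ∈ outer :: inner, ∀ (i : ℕ) (hi : i < l.length) (x : D), x.1 = l[i] →
      (List.range (nn φ x)).map (fun j => ((φ ^ j) x).1) = l.rotate i := by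
    intro l hl i hi x hx
    apply List.ext_getElem
    · simp [hnn l hl i hi x hx]
    · intro k h1 h2
      simp only [List.getElem_map, List.getElem_range, List.getElem_rotate]
      rw [hφ l hl i hi x hx]
      congr 1; rw [Nat.add_comm]
  let o : ℕ → D := fun i => ⟨outer[i % outer.length]'(Nat.mod_lt _ hP),
    hmem outer (by simp) _ (List.getElem_mem _)⟩
  have hnotouter : ∀ d : D, (∀ i, d ≠ o i) → d.1 ∉ outer := by
    intro d hd hmem
    obtain ⟨i, hi, hx⟩ := List.getElem_of_mem hmem
    apply hd i
    apply Subtype.ext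
    simp only [o, Nat.mod_eq_of_lt hi, hx]
  have hinner : ∀ d : D, (∀ i, d ≠ o i) → ∃ l ∈ inner, ∃ i, ∃ hi : i < l.length, d.1 = l[i] := by
    intro d hd
    obtain ⟨l, hl, i, hi, hx⟩ := hsplit d.1 d.2
    rcases List.mem_cons.mp hl with rfl | hl
    · exact absurd (hx ▸ List.getElem_mem _) (hnotouter d hd)
    · exact ⟨l, hl, i, hi, hx⟩
  let μ : D → D := fun d => ⟨fl d.1, hD.cl d.1 d.2⟩
  have hvφ : ∀ d : D, vert (φ d).1 = vert (fl d.1) := by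
    have key : ∀ l (u : ℕ × G), Walk vert u l u → ∀ i (hi : i < l.length),
        vert (l[(i+1) % l.length]'(Nat.mod_lt _ (by omega))) = vert (fl l[i]) := by
      intro l u hu i hi
      have h1 : Walk vert u (l.take i ++ l[i] :: l.drop (i+1)) u := by
        rw [← List.drop_eq_getElem_cons hi, List.take_append_drop]; exact hu
      obtain ⟨m, -, -, h2⟩ := walk_append.mp h1
      rcases lt_or_ge (i+1) l.length with h3 | h3
      · rw [List.drop_eq_getElem_cons h3] at h2
        simp only [Nat.mod_eq_of_lt h3]; exact h2.1
      · rw [List.drop_eq_nil_of_le h3] at h2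
        have e : (i+1) % l.length = 0 := by
          have : i + 1 = l.length := by omega
          simp [this]
        simp only [e]
        rw [show vert (fl l[i]) = u from h2]
        cases l with
        | nil => simp at hi
        | cons a l => exact hu.1
    intro d
    obtain ⟨l, hl, i, hi, hx⟩ := hsplit d.1 d.2
    have h1 := hφ l hl i hi d hx 1
    rw [pow_one] at h1
    rw [h1, hx]
    rcases List.mem_cons.mp hl with rfl | hl
    · exact key _ _ hD.wk i hi
    · obtain ⟨-, -, u, hu⟩ := hD.inn l hl
      exact key _ _ hu i hi
  have hμμ : ∀ d, μ (μ d) = d := fun d => Subtype.ext (by simp [μ])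
  refine ⟨D, inferInstance, inferInstance, ⟨⟨φ, μ, fun d => lab d.1, fun d => (vert d.1).2, o, hμμ,
    ?_, ?_, ?_, ?_, ?_, ?_, ?_, ?_, ?_, ?_, ?_, ?_⟩⟩⟩
  · intro d h; exact fl_ne d.1 (congrArg Subtype.val h)
  · intro d; exact hD.lab_fl d.1
  · intro d; rw [hvφ]; exact hD.pos d.1
  · intro d; exact hD.pos d.1
  · intro i
    apply Subtype.ext
    have := hφ outer (by simp) (i % outer.length) (Nat.mod_lt _ hP) (o i) rfl 1
    rw [pow_one] at this
    rw [this]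
    simp only [o]; congr 1; simp
  · intro i; simp only [o, ← hlen]; congr 2; simp
  · intro i j hi hj hij
    have := congrArg Subtype.val hij
    simp only [o] at this
    have := (hlnd outer (by simp)).getElem_inj_iff.mp this
    rwa [Nat.mod_eq_of_lt (by omega), Nat.mod_eq_of_lt (by omega)] at this
  · intro i hi
    simp only [o, ← hout, List.getElem_map]
    congr 2; exact Nat.mod_eq_of_lt (by omega)
  · simp only [o, Nat.zero_mod]
    rw [← hb]
    have := hD.wk
    cases outer with
    | nil => simp at hP
    | cons a l => simp only [List.getElem_cons_zero]; rw [this.1]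
  · intro d hd
    obtain ⟨l, hl, i, hi, hx⟩ := hinner d hd
    have hw := hword l (by simp [hl]) i hi d hx
    have : (List.range (nn φ d)).map (fun j => lab ((φ ^ j) d).1) = (l.rotate i).map lab := by
      rw [← hw, List.map_map]; rfl
    rw [this]
    exact symm_rot (hD.inn l hl).2.1 (List.IsRotated.map ⟨i, rfl⟩ lab)
  · intro d hd hd' hn hall
    obtain ⟨l, hl, i, hi, hx⟩ := hinner d hd
    obtain ⟨l', hl', i', hi', hx'⟩ := hinner (μ d) hd'
    have hw := hword l (by simp [hl]) i hi d hx
    have hw' := hword l' (by simp [hl']) i' hi' (μ d) hx'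
    obtain ⟨n, hn1⟩ : ∃ n, nn φ d = n + 1 := ⟨nn φ d - 1, by have := nn_pos φ d; omega⟩
    rw [← hn, hn1] at hw'
    rw [hn1] at hw hall
    rw [List.range_succ_eq_map, List.map_cons] at hw hw'
    have := hred l hl l' hl' d.1 _ _ ⟨i, hw.symm⟩ ⟨i', hw'.symm⟩
    apply this
    apply List.ext_getElem
    · simp
    · intro k h1 h2
      simp only [List.length_map, List.length_range] at h1
      simp only [wordInv_eq, List.getElem_map, List.getElem_range, List.getElem_reverse,
        List.length_map, List.length_range]
      have e1 := hall (k+1) (by omega)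
      rw [e1]
      congr 5
      omega
  · have he := hD.eul
    have hcard : Fintype.card D = all.length := by
      rw [Fintype.card_of_subtype all.toFinset (by simp)]
      exact List.toFinset_card_of_nodup hD.nd
    have hV : (insert base (all.map vert).toFinset) = Finset.univ.image (fun d : D => vert d.1) := by
      ext v
      simp only [Finset.mem_insert, List.mem_toFinset, List.mem_map, Finset.mem_image,
        Finset.mem_univ, true_and]
      constructor
      · rintro (rfl | ⟨x, hx, rfl⟩)
        · refine ⟨o 0, ?_⟩
          have := hD.wk
          simp only [o, Nat.zero_mod]
          cases outer with
          | nil => simp at hP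
          | cons a l => exact this.1
        · exact ⟨⟨x, hx⟩, rfl⟩
      · rintro ⟨x, rfl⟩
        right; exact ⟨x.1, x.2, rfl⟩
    have h1 := card_image_le (φ * (Equiv.mk μ μ hμμ hμμ : Equiv.Perm D)) (fun d : D => vert d.1) (by
      intro d
      change vert (φ (μ d)).1 = _
      rw [hvφ]; simp [μ])
    have h2 : ((Finset.univ.filter (fun d => ∀ i, d ≠ o i)).sum (fun d => (1:ℝ) / nn φ d)) =
        inner.length := by
      have e1 : ((Finset.univ.filter (fun d => ∀ i, d ≠ o i)).sum (fun d => (1:ℝ) / nn φ d)) =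
          ∑ x ∈ inner.flatten.toFinset, (if hx : x ∈ all then (1:ℝ) / nn φ ⟨x, hx⟩ else 0) := by
        refine Finset.sum_bij (fun d _ => d.1) ?_ (fun _ _ _ _ h => Subtype.ext h) ?_ ?_
        · intro d hd
          simp only [Finset.mem_filter, Finset.mem_univ, true_and] at hd
          obtain ⟨l, hl, i, hi, hx⟩ := hinner d hd
          simp only [List.mem_toFinset, List.mem_flatten]
          exact ⟨l, hl, hx ▸ List.getElem_mem _⟩
        · intro x hx
          rw [List.mem_toFinset] at hx
          refine ⟨⟨x, by simp only [hall, List.mem_append]; right; exact hx⟩, ?_, rfl⟩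
          simp only [Finset.mem_filter, Finset.mem_univ, true_and]
          intro i hi
          have := congrArg Subtype.val hi
          simp only [o] at this
          exact List.disjoint_of_nodup_append hD.nd (this ▸ List.getElem_mem _) hx
        · intro d hd
          rw [dif_pos d.2]
      rw [e1, List.sum_toFinset _ hD.nd.of_append_right, List.map_flatten, List.sum_flatten,
        List.map_map]
      have e2 : ∀ l ∈ inner, (List.sum ∘ List.map (fun x => if hx : x ∈ all then (1:ℝ) / nn φ ⟨x, hx⟩ else 0)) l
          = 1 := by
        intro l hl
        have hpos : 0 < l.length := List.length_pos_iff.mpr (hD.inn l hl).1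
        have e3 : l.map (fun x => if hx : x ∈ all then (1:ℝ) / nn φ ⟨x, hx⟩ else 0) =
            l.map (fun x => (1:ℝ) / l.length) := by
          apply List.map_congr_left
          intro x hx
          rw [dif_pos (hmem l (by simp [hl]) x hx)]
          obtain ⟨i, hi, rfl⟩ := List.getElem_of_mem hx
          rw [hnn l (by simp [hl]) i hi _ rfl]
        simp only [Function.comp, e3]
        have : (l.length : ℝ) ≠ 0 := by positivity
        simp [this]
      rw [List.map_congr_left e2]
      simp
    rw [h2, Finset.sum_sub_distrib, Finset.sum_const, Finset.card_univ, hcard]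
    rw [hV] at he
    have he' : (all.length : ℝ) + 2 ≤ 2 * (Finset.univ.image (fun d : D => vert d.1)).card +
      2 * inner.length := by exact_mod_cast he
    simp only [nsmul_eq_mul]
    linarith
end
end MorseLTG

namespace MorseLTG
section Curv
variable {S : Type*} {G : Type*} [Group G] {σ : S → G} {R : Set (Word S)} {g : G} {W : Word S}
  {D : Type} [Fintype D] [DecidableEq D] (m : PM σ R W g D)

namespace PM
def out (d : D) : Prop := ∃ i, d = m.o i
def ψ : Equiv.Perm D := m.φ * (Equiv.mk m.μ m.μ m.μμ m.μμ : Equiv.Perm D)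
lemma ψ_apply (d : D) : m.ψ d = m.φ (m.μ d) := rfl
lemma μ_inj {a b : D} (h : m.μ a = m.μ b) : a = b := by rw [← m.μμ a, h, m.μμ]
lemma ψ_inv (d : D) : m.ψ⁻¹ d = m.μ (m.φ⁻¹ d) := by
  rw [Equiv.Perm.inv_eq_iff_eq, ψ_apply, m.μμ]; simp
def ess (d : D) : Prop := m.ψ (m.ψ d) ≠ d
def chi (d : D) : Prop := m.out (m.μ d)

lemma not_out {d : D} : ¬ m.out d ↔ ∀ i, d ≠ m.o i := by simp [out]

lemma o_add (i k : ℕ) : (m.φ ^ k) (m.o i) = m.o (i + k) := by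
  induction k with
  | zero => rfl
  | succ k ih => rw [pow_succ', Equiv.Perm.mul_apply, ih, m.o_succ, add_assoc]

lemma o_mod (i : ℕ) : m.o (i % W.length) = m.o i := by
  conv_rhs => rw [← Nat.mod_add_div i W.length]
  generalize i / W.length = q
  induction q with
  | zero => simp
  | succ q ih => rw [Nat.mul_succ, ← add_assoc, m.o_per, ← ih]

lemma out_φ {d : D} : m.out (m.φ d) ↔ m.out d := by
  constructor
  · rintro ⟨i, hi⟩
    refine ⟨i + (nn m.φ d - 1), ?_⟩
    rw [← o_add, ← hi, ← Equiv.Perm.mul_apply, ← pow_succ, Nat.sub_add_cancel (nn_pos _ _), pow_nn]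
  · rintro ⟨i, rfl⟩; exact ⟨i+1, m.o_succ i⟩

lemma out_orb {d x : D} (h : x ∈ orb m.φ d) : m.out x ↔ m.out d := by
  obtain ⟨i, -, rfl⟩ := mem_orb_lt _ h
  clear h
  induction i with
  | zero => rfl
  | succ i ih => rw [pow_succ', Equiv.Perm.mul_apply, out_φ, ih]

lemma ess_iff {d : D} : m.ess d ↔ 3 ≤ nn m.ψ d := by
  have h1 := nn_pos m.ψ d
  unfold ess
  constructor
  · intro h
    by_contra h2
    apply h
    have h3 := pow_nn m.ψ d
    have : nn m.ψ d = 1 ∨ nn m.ψ d = 2 := by omega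
    rcases this with h4 | h4 <;> rw [h4] at h3
    · simp only [pow_one] at h3; rw [h3, h3]
    · simpa [pow_two] using h3
  · intro h h2
    have : nn m.ψ d ∣ 2 := nn_dvd _ (by simpa [pow_two] using h2)
    have := Nat.le_of_dvd (by norm_num) this
    omega

lemma ess_orb {d x : D} (h : x ∈ orb m.ψ d) : m.ess x ↔ m.ess d := by
  rw [ess_iff, ess_iff, nn_eq _ h]

open Classical in
noncomputable def ov (d : D) : ℕ := ((orb m.ψ d).filter m.out).card

open Classical in
noncomputable def wt (d : D) : ℕ :=
  if m.ess d then
    if 2 ≤ m.ov d then 6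
    else if m.ov d = 1 then (if nn m.ψ d = 3 then 3 else 4)
    else (if nn m.ψ d = 3 then 2 else 3)
  else 0

lemma ov_orb {d x : D} (h : x ∈ orb m.ψ d) : m.ov x = m.ov d := by
  rw [ov, orb_eq _ h, ov]
lemma wt_orb {d x : D} (h : x ∈ orb m.ψ d) : m.wt x = m.wt d := by
  by_cases hx : m.ess d
  · have := (m.ess_orb h).mpr hx
    simp only [wt, ov_orb m h, nn_eq _ h, hx, this]
  · have := mt (m.ess_orb h).mp hx
    simp only [wt, hx, this, if_false]

open Classical in
lemma vert_ineq (d : D) : ∑ x ∈ orb m.ψ d, (12 * ((1 : ℝ) / nn m.ψ x - 1 / 2) +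
    (if m.out x then 0 else (m.wt x : ℝ)) - if m.ψ x = x then 6 else 0) ≤ 0 := by
  have e1 : ∑ x ∈ orb m.ψ d, (1 : ℝ) / nn m.ψ x = 1 := sum_inv_orb _ d
  have e2 : ∑ x ∈ orb m.ψ d, (if m.out x then 0 else (m.wt x : ℝ)) =
      (nn m.ψ d - m.ov d : ℝ) * m.wt d := by
    have : ∀ x ∈ orb m.ψ d, (if m.out x then 0 else (m.wt x : ℝ)) =
        (1 - if m.out x then 1 else 0) * (m.wt d : ℝ) := by
      intro x hx
      rw [wt_orb m hx]
      split_ifs <;> simp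
    rw [Finset.sum_congr rfl this, ← Finset.sum_mul, Finset.sum_sub_distrib, ov]
    simp [nn]
  rw [Finset.sum_sub_distrib, Finset.sum_add_distrib, ← Finset.mul_sum, Finset.sum_sub_distrib, e1, e2]
  rw [Finset.sum_const]
  change 12 * (1 - (nn m.ψ d) • _) + _ - _ ≤ _
  rw [nsmul_eq_mul]
  have hp := nn_pos m.ψ d
  have hov : m.ov d ≤ nn m.ψ d := Finset.card_le_card (Finset.filter_subset _ _)
  have hnn : 0 ≤ ∑ x ∈ orb m.ψ d, (if m.ψ x = x then (6:ℝ) else 0) :=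
    Finset.sum_nonneg fun x _ => by split_ifs <;> norm_num
  by_cases he : m.ess d
  · have h3 := (m.ess_iff).mp he
    have h3' : (3:ℝ) ≤ nn m.ψ d := by exact_mod_cast h3
    have h4' : nn m.ψ d ≠ 3 → (4:ℝ) ≤ nn m.ψ d := fun h => by
      have : 4 ≤ nn m.ψ d := by omega
      exact_mod_cast this
    rw [wt, if_pos he]
    split_ifs with a b c c
    · have : (2:ℝ) ≤ m.ov d := by exact_mod_cast a
      push_cast; nlinarith
    · rw [b, c]; push_cast; linarith
    · have := h4' c
      rw [b]; push_cast; linarith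
    · have : m.ov d = 0 := by omega
      rw [this, c]; push_cast; linarith
    · have : m.ov d = 0 := by omega
      have := h4' c
      rw [‹m.ov d = 0›]; push_cast; linarith
  · rw [wt, if_neg he]
    have h3 := mt (m.ess_iff).mpr he
    have : nn m.ψ d = 1 ∨ nn m.ψ d = 2 := by omega
    rcases this with h | h
    · have hd : m.ψ d = d := by have := pow_nn m.ψ d; rw [h] at this; simpa using this
      have : (6:ℝ) ≤ ∑ x ∈ orb m.ψ d, (if m.ψ x = x then (6:ℝ) else 0) := by
        have := Finset.single_le_sum (f := fun x => if m.ψ x = x then (6:ℝ) else 0)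
          (fun x _ => by split_ifs <;> norm_num) (self_orb m.ψ d)
        simpa [hd] using this
      rw [h]; push_cast; linarith
    · rw [h]; push_cast; linarith

open Classical in
noncomputable def faces : Finset (Finset D) := (Finset.univ.filter (fun d => ¬ m.out d)).image (orb m.φ)
noncomputable def FW (d : D) : ℕ := ∑ x ∈ orb m.φ d, m.wt x

open Classical in
lemma sum_faces (h : D → ℝ) : ∑ x, (if m.out x then 0 else h x) = ∑ F ∈ m.faces, ∑ x ∈ F, h x := by
  have : ∀ x, (if m.out x then 0 else h x) = if ¬ m.out x then h x else 0 := by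
    intro x; split_ifs <;> rfl
  rw [Finset.sum_congr rfl (fun x _ => this x), ← Finset.sum_filter, faces,
    ← Finset.sum_fiberwise_of_maps_to (g := orb m.φ)
      (fun x hx => Finset.mem_image_of_mem _ hx)]
  refine Finset.sum_congr rfl ?_
  intro F hF
  obtain ⟨d, hd, rfl⟩ := Finset.mem_image.mp hF
  congr 1
  ext x
  simp only [Finset.mem_filter, Finset.mem_univ, true_and] at hd ⊢
  constructor
  · intro h; rw [← h.2]; exact self_orb _ x
  · intro h; exact ⟨by rwa [out_orb m h], orb_eq _ h⟩

open Classical in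
lemma curv : (12 : ℤ) ≤ ∑ F ∈ m.faces, (12 - ∑ x ∈ F, (m.wt x : ℤ)) +
    6 * ((Finset.univ.filter (fun d => m.ψ d = d)).card : ℤ) := by
  have h1 := sum_le_zero m.ψ m.vert_ineq
  have h2 := m.eul
  change _ ≤ ∑ d, ((1 : ℝ) / nn m.ψ d - 1 / 2) + _ at h2
  rw [Finset.sum_sub_distrib, Finset.sum_add_distrib, ← Finset.mul_sum] at h1
  have h3 : ∑ x, (if m.ψ x = x then (6:ℝ) else 0) =
    6 * ((Finset.univ.filter (fun d => m.ψ d = d)).card : ℝ) := by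
    rw [← Finset.sum_filter, Finset.sum_const, nsmul_eq_mul, mul_comm]
  rw [h3, m.sum_faces (fun x => (m.wt x : ℝ))] at h1
  have h5 : ∑ d ∈ Finset.univ.filter (fun d => ∀ i, d ≠ m.o i), (1:ℝ) / nn m.φ d =
      ∑ F ∈ m.faces, (1 : ℝ) := by
    have h6 : ∀ F ∈ m.faces, (1:ℝ) = ∑ x ∈ F, (1:ℝ) / nn m.φ x := by
      intro F hF
      obtain ⟨d, -, rfl⟩ := Finset.mem_image.mp hF
      rw [sum_inv_orb]
    rw [Finset.sum_congr rfl h6, ← m.sum_faces, Finset.sum_filter]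
    refine Finset.sum_congr rfl fun x _ => ?_
    simp only [← m.not_out]
    split_ifs <;> rfl
  rw [h5] at h2
  have : (12 : ℝ) ≤ ∑ F ∈ m.faces, (12 - ∑ x ∈ F, (m.wt x : ℝ)) +
    6 * ((Finset.univ.filter (fun d => m.ψ d = d)).card : ℝ) := by
    rw [Finset.sum_sub_distrib]
    have : ∑ F ∈ m.faces, (12:ℝ) = 12 * ∑ F ∈ m.faces, (1:ℝ) := by rw [Finset.mul_sum]; simp
    linarith
  exact_mod_cast this
end PM
end Curv
end MorseLTG

namespace MorseLTG
section Face
variable {S : Type*} {G : Type*} [Group G] {σ : S → G} {R : Set (Word S)} {g : G} {W : Word S}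
  {D : Type} [Fintype D] [DecidableEq D] (m : PM σ R W g D)

namespace PM
noncomputable def fw (d : D) (k : ℕ) : Word S := (List.range k).map (fun j => m.lab ((m.φ ^ j) d))
@[simp] lemma fw_length (d : D) (k : ℕ) : (m.fw d k).length = k := by simp [fw]
lemma fw_get (d : D) (k i : ℕ) (h : i < (m.fw d k).length) : (m.fw d k)[i] = m.lab ((m.φ ^ i) d) := by
  simp [fw]

lemma face' {d : D} (h : ¬ m.out d) : m.fw d (nn m.φ d) ∈ symmClosure R := m.face d (m.not_out.mp h)

lemma pow_φ_pos (d : D) (k : ℕ) : m.pos ((m.φ ^ k) d) = m.pos d * evalWord σ (m.fw d k) := by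
  induction k with
  | zero => simp [fw, evalWord_nil]
  | succ k ih =>
    rw [pow_succ', Equiv.Perm.mul_apply, m.pos_φ, ih]
    simp only [fw, List.range_succ, List.map_append, evalWord_append, ← mul_assoc]
    simp [evalWord_cons, evalWord_nil]

lemma pos_ψ (d : D) : m.pos (m.ψ d) = m.pos d := by
  rw [ψ_apply, m.pos_φ, m.pos_μ, m.lab_μ, ev_fl]; group

lemma no_spur (hcr : ∀ r ∈ R, CyclicallyReduced r) {d : D} (h : ¬ m.out d) : m.ψ d ≠ d := by
  intro h1
  rw [ψ_apply] at h1
  have h2 : ¬ m.out (m.μ d) := by rw [← h1, out_φ] at h; exact h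
  have hr := symm_red hcr (m.face' h2)
  have hn : 2 ≤ nn m.φ (m.μ d) := by
    by_contra hlt
    have h0 := nn_pos m.φ (m.μ d)
    have : nn m.φ (m.μ d) = 1 := by omega
    have h3 := pow_nn m.φ (m.μ d)
    rw [this, pow_one, h1] at h3
    exact m.μne d h3.symm
  have := List.isChain_iff_getElem.mp (red_iff.mp hr) 0 (by rw [fw_length]; omega)
  simp only [fw_get, zero_add, pow_one, pow_zero, Equiv.Perm.one_apply, h1, m.lab_μ, fl] at this
  simp at this

lemma flip {d : D} (h : ¬ m.ess (m.φ d)) : m.φ (m.μ (m.φ d)) = m.μ d := by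
  unfold ess at h
  push Not at h
  rw [ψ_apply, ψ_apply] at h
  have := m.φ.injective h
  rw [← m.μμ (m.φ (m.μ (m.φ d))), this]

lemma flip_pow {d : D} {j : ℕ} (h : ∀ i, 0 < i → i < j → ¬ m.ess ((m.φ ^ i) d)) {i : ℕ} (hi : i < j) :
    (m.φ ^ i) (m.μ ((m.φ ^ i) d)) = m.μ d := by
  induction i with
  | zero => rfl
  | succ i ih =>
    have h1 := h (i+1) (by omega) hi
    rw [pow_succ', Equiv.Perm.mul_apply] at h1
    have := m.flip h1
    rw [← ih (by omega), ← this, pow_succ, Equiv.Perm.mul_apply, ← pow_succ, pow_succ',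
      Equiv.Perm.mul_apply]

lemma orb_flip {d : D} {j : ℕ} (h : ∀ i, 0 < i → i < j → ¬ m.ess ((m.φ ^ i) d)) {i : ℕ} (hi : i < j) :
    m.μ ((m.φ ^ i) d) ∈ orb m.φ (m.μ d) := by
  rw [← m.flip_pow h hi]
  rw [mem_orb]
  exact (mem_orb m.φ |>.mp (pow_orb m.φ _ i)).symm

lemma arc_inner (hsc : SmallCancellation R (1/6)) {d : D} (hd : ¬ m.out d) (hd' : ¬ m.out (m.μ d)) {j : ℕ}
    (hj : 1 ≤ j) (h : ∀ i, 0 < i → i < j → ¬ m.ess ((m.φ ^ i) d)) :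
    6 * j < nn m.φ d ∧ 6 * j < nn m.φ (m.μ d) := by
  set n := nn m.φ d with hn
  set n' := nn m.φ (m.μ d) with hn'
  have hnp : 0 < n := nn_pos _ _
  have hnp' : 0 < n' := nn_pos _ _
  set u := m.fw d n with hu
  have huR : u ∈ symmClosure R := m.face' hd
  have e1 : nn m.φ (m.φ (m.μ d)) = n' := nn_eq _ (f_orb _ _)
  set v := wordInv (m.fw (m.φ (m.μ d)) n') with hv
  have hvR : v ∈ symmClosure R := by
    apply symm_inv
    rw [← e1]; exact m.face' (by rwa [out_φ])
  have hul : u.length = n := by simp [hu]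
  have hvl : v.length = n' := by simp [hv]
  have hvg : ∀ i (hi : i < v.length), v[i] = fl (m.lab ((m.φ ^ (n' - i)) (m.μ d))) := by
    intro i hi
    simp only [hv, wordInv_eq, List.getElem_reverse, List.getElem_map, fw_get, List.length_map, fw_length]
    rw [← Equiv.Perm.mul_apply, ← pow_succ]
    congr 4
    omega
  have huv : u ≠ v := by
    intro huv
    have hnn : n = n' := by rw [← hul, huv, hvl]
    refine m.red d (m.not_out.mp hd) (m.not_out.mp hd') hnn ?_
    intro i hi
    have h1 : u[i]'(by omega) = v[i]'(by omega) := by simp only [huv]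
    rw [hvg] at h1
    simp only [hu, fw_get] at h1
    rw [h1, ← hnn]
  have hagree : ∀ i, i < j → ∀ (h1 : i < u.length) (h2 : i < v.length), u[i] = v[i] := by
    intro i hi h1 h2
    rw [hvg]
    simp only [hu, fw_get]
    have h3 := m.flip_pow h hi
    have h4 : (m.φ ^ (n' - i)) (m.μ d) = m.μ ((m.φ ^ i) d) := by
      rw [← h3, ← Equiv.Perm.mul_apply, ← pow_add, Nat.sub_add_cancel (by omega)]
      have : n' = nn m.φ (m.μ ((m.φ ^ i) d)) := (nn_eq _ (m.orb_flip h hi)).symm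
      rw [this, pow_nn]
    rw [h4, m.lab_μ, fl_fl]
  set l := min j (min n n') with hl
  have htake : u.take l = v.take l := by
    apply List.ext_getElem
    · simp [hul, hvl]; omega
    · intro i h1 h2
      simp only [List.getElem_take]
      simp only [List.length_take] at h1
      exact hagree i (by omega) _ _
  have hlen : (u.take l).length = l := by simp [hul]; omega
  have hp : IsPiece R (u.take l) :=
    ⟨by rw [← List.length_pos_iff, hlen]; omega, u, huR, v, hvR, huv, List.take_prefix _ _,
      by rw [htake]; exact List.take_prefix _ _⟩
  have q1 := hsc.2 u huR _ hp (List.take_prefix _ _).isInfix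
  have q2 := hsc.2 v hvR _ hp (by rw [htake]; exact (List.take_prefix _ _).isInfix)
  rw [hlen, hul] at q1
  rw [hlen, hvl] at q2
  have q1' : 6 * l < n := by
    have : (6 * l : ℝ) < n := by linarith
    exact_mod_cast this
  have q2' : 6 * l < n' := by
    have : (6 * l : ℝ) < n' := by linarith
    exact_mod_cast this
  omega

lemma chi_ψ {d : D} : m.out (m.ψ d) ↔ m.chi d := by rw [ψ_apply, out_φ]; rfl
lemma chi_ψi {d : D} : m.out (m.ψ⁻¹ d) ↔ m.chi (m.φ⁻¹ d) := by rw [ψ_inv]; rfl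
lemma ψi_orb (d : D) : m.ψ⁻¹ d ∈ orb m.ψ d := by
  have := zpow_orb m.ψ d (-1); simpa using this
lemma φi_orb (d : D) : m.φ⁻¹ d ∈ orb m.φ d := by
  have := zpow_orb m.φ d (-1); simpa using this

lemma noness_chi {d : D} (h : ¬ m.ess d) : m.chi (m.φ⁻¹ d) ↔ m.chi d := by
  rw [← chi_ψi, ← chi_ψ]
  unfold ess at h; push Not at h
  have : m.ψ⁻¹ d = m.ψ d := by rw [Equiv.Perm.inv_eq_iff_eq, h]
  rw [this]

open Classical in
noncomputable def ind (p : Prop) : ℕ := if p then 1 else 0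

open Classical in
lemma wt_ge {d : D} (h : m.ess d) :
    2 + ind (m.chi (m.φ⁻¹ d)) + ind (m.chi d) ≤ m.wt d ∧
    3 * ind (m.chi (m.φ⁻¹ d)) + 3 * ind (m.chi d) ≤ m.wt d := by
  have h1 : m.chi d → 1 ≤ m.ov d := fun hc => Finset.card_pos.mpr
    ⟨m.ψ d, Finset.mem_filter.mpr ⟨f_orb _ _, m.chi_ψ.mpr hc⟩⟩
  have h2 : m.chi (m.φ⁻¹ d) → 1 ≤ m.ov d := fun hc => Finset.card_pos.mpr
    ⟨m.ψ⁻¹ d, Finset.mem_filter.mpr ⟨m.ψi_orb d, m.chi_ψi.mpr hc⟩⟩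
  have h3 : m.chi d → m.chi (m.φ⁻¹ d) → 2 ≤ m.ov d := by
    intro a b
    have hne : m.ψ d ≠ m.ψ⁻¹ d := by
      intro he; apply h; rw [he]; simp
    rw [← Finset.card_pair hne]
    refine Finset.card_le_card ?_
    intro x hx
    rcases Finset.mem_insert.mp hx with rfl | hx
    · exact Finset.mem_filter.mpr ⟨f_orb _ _, m.chi_ψ.mpr a⟩
    · rw [Finset.mem_singleton.mp hx]
      exact Finset.mem_filter.mpr ⟨m.ψi_orb d, m.chi_ψi.mpr b⟩
  rw [wt, if_pos h]
  simp only [ind]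
  by_cases a : m.chi d <;> by_cases b : m.chi (m.φ⁻¹ d) <;> simp only [a, b, if_true, if_false]
  · rw [if_pos (h3 a b)]; omega
  · have := h1 a
    split_ifs <;> omega
  · have := h2 b
    split_ifs <;> omega
  · split_ifs <;> omega

open Classical in
noncomputable def Es (d : D) : Finset D := (orb m.φ d).filter m.ess
open Classical in
noncomputable def Oc (d : D) : Finset D := (m.Es d).filter m.chi
open Classical in
noncomputable def Kc (d : D) : Finset D := (m.Es d).filter (fun x => ¬ m.chi x)

lemma card_Es (d : D) : (m.Oc d).card + (m.Kc d).card = (m.Es d).card := by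
  classical exact Finset.card_filter_add_card_filter_not _

open Classical in
lemma sum_chi (d : D) : ∑ x ∈ m.Es d, ind (m.chi (m.φ⁻¹ x)) = (m.Oc d).card ∧
    ∑ x ∈ m.Es d, ind (m.chi x) = (m.Oc d).card := by
  have h2 : ∑ x ∈ m.Es d, ind (m.chi x) = (m.Oc d).card := by
    simp only [ind, Oc]; rw [Finset.card_filter]
  refine ⟨?_, h2⟩
  rw [← h2]
  have h3 := sum_orb_shift m.φ d (fun x => ind (m.chi (m.φ⁻¹ x)))
  have h6 : ∀ x, m.φ⁻¹ (m.φ x) = x := fun x => by simp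
  simp only [h6] at h3
  have h4 : ∀ f : D → ℕ, ∑ x ∈ orb m.φ d, f x = ∑ x ∈ m.Es d, f x +
      ∑ x ∈ (orb m.φ d).filter (fun x => ¬ m.ess x), f x := fun f =>
    (Finset.sum_filter_add_sum_filter_not _ _ _).symm
  rw [h4, h4] at h3
  have h5 : ∑ x ∈ (orb m.φ d).filter (fun x => ¬ m.ess x), ind (m.chi (m.φ⁻¹ x)) =
      ∑ x ∈ (orb m.φ d).filter (fun x => ¬ m.ess x), ind (m.chi x) := by
    refine Finset.sum_congr rfl fun x hx => ?_
    rw [propext (m.noness_chi (Finset.mem_filter.mp hx).2)]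
  omega

open Classical in
lemma FW_Es (d : D) : m.FW d = ∑ x ∈ m.Es d, m.wt x := by
  rw [FW, Es, Finset.sum_filter]
  refine Finset.sum_congr rfl fun x _ => ?_
  split_ifs with h
  · rfl
  · simp [wt, h]

lemma FW_ge (d : D) : 6 * (m.Oc d).card ≤ m.FW d ∧
    4 * (m.Oc d).card + 2 * (m.Kc d).card ≤ m.FW d := by
  rw [FW_Es]
  have hm : ∀ x ∈ m.Es d, m.ess x := fun x hx => by
    classical exact (Finset.mem_filter.mp hx).2
  have h1 := Finset.sum_le_sum fun x hx => (m.wt_ge (hm x hx)).2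
  have h2 := Finset.sum_le_sum fun x hx => (m.wt_ge (hm x hx)).1
  obtain ⟨a, b⟩ := m.sum_chi d
  have c := m.card_Es d
  simp only [Finset.sum_add_distrib, ← Finset.mul_sum, Finset.sum_const, smul_eq_mul, a, b] at h1 h2
  omega

lemma FW_eq {d : D} (h : m.FW d = 4 * (m.Oc d).card + 2 * (m.Kc d).card) {x : D} (hx : x ∈ m.Es d) :
    m.wt x = 2 + ind (m.chi (m.φ⁻¹ x)) + ind (m.chi x) := by
  rw [FW_Es] at h
  have hm : ∀ x ∈ m.Es d, m.ess x := fun x hx => by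
    classical exact (Finset.mem_filter.mp hx).2
  obtain ⟨a, b⟩ := m.sum_chi d
  have c := m.card_Es d
  have h2 : ∑ x ∈ m.Es d, (2 + ind (m.chi (m.φ⁻¹ x)) + ind (m.chi x)) = ∑ x ∈ m.Es d, m.wt x := by
    simp only [Finset.sum_add_distrib, Finset.sum_const, smul_eq_mul, a, b]
    omega
  exact ((Finset.sum_eq_sum_iff_of_le fun x hx => (m.wt_ge (hm x hx)).1).mp h2 x hx).symm

/-- length of the arc starting at s -/
noncomputable def bb (s : D) : ℕ := sInf {j | 1 ≤ j ∧ m.ess ((m.φ ^ j) s)}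
lemma bb_spec' {s : D} (j : ℕ) (hj : 1 ≤ j) (h : m.ess ((m.φ ^ j) s)) :
    1 ≤ m.bb s ∧ m.ess ((m.φ ^ (m.bb s)) s) ∧ m.bb s ≤ j :=
  ⟨(Nat.sInf_mem (s := {j | 1 ≤ j ∧ m.ess ((m.φ ^ j) s)}) ⟨j, hj, h⟩).1,
    (Nat.sInf_mem (s := {j | 1 ≤ j ∧ m.ess ((m.φ ^ j) s)}) ⟨j, hj, h⟩).2, Nat.sInf_le ⟨hj, h⟩⟩
lemma bb_spec {s : D} (h : m.ess s) : 1 ≤ m.bb s ∧ m.ess ((m.φ ^ (m.bb s)) s) ∧ m.bb s ≤ nn m.φ s :=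
  m.bb_spec' _ (nn_pos _ _) (by rwa [pow_nn])
lemma bb_lt {s : D} {i : ℕ} (h0 : 0 < i) (h1 : i < m.bb s) : ¬ m.ess ((m.φ ^ i) s) :=
  fun h => Nat.notMem_of_lt_sInf h1 ⟨h0, h⟩

lemma cover {d : D} (h : (m.Es d).Nonempty) : nn m.φ d ≤ ∑ s ∈ m.Es d, m.bb s := by
  classical
  have hsub : orb m.φ d ⊆ (m.Es d).biUnion fun s => (Finset.range (m.bb s)).image fun j => (m.φ ^ j) s := by
    intro x hx
    obtain ⟨e, he⟩ := h
    have he' := Finset.mem_filter.mp he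
    have hxe : x ∈ orb m.φ e := by rw [orb_eq _ he'.1]; exact hx
    obtain ⟨i, -, hi⟩ := mem_orb_lt _ hxe
    have hex : ∃ i, ∃ s ∈ m.Es d, (m.φ ^ i) s = x := ⟨i, e, he, hi⟩
    obtain ⟨s, hs, hsx⟩ := Nat.find_spec hex
    refine Finset.mem_biUnion.mpr ⟨s, hs, Finset.mem_image.mpr ⟨Nat.find hex, ?_, hsx⟩⟩
    rw [Finset.mem_range]
    by_contra hlt
    push Not at hlt
    have hs' := Finset.mem_filter.mp hs
    have hb := m.bb_spec hs'.2
    refine Nat.find_min hex (m := Nat.find hex - m.bb s) (by omega) ⟨(m.φ ^ m.bb s) s, ?_, ?_⟩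
    · refine Finset.mem_filter.mpr ⟨?_, hb.2.1⟩
      rw [← orb_eq _ hs'.1]; exact pow_orb _ _ _
    · rw [← Equiv.Perm.mul_apply, ← pow_add, Nat.sub_add_cancel hlt, hsx]
  calc nn m.φ d ≤ _ := Finset.card_le_card hsub
    _ ≤ _ := Finset.card_biUnion_le
    _ ≤ _ := Finset.sum_le_sum fun s _ => by
      simpa using Finset.card_image_le (s := Finset.range (m.bb s)) (f := fun j => (m.φ ^ j) s)

lemma mem_Es {d x : D} : x ∈ m.Es d ↔ x ∈ orb m.φ d ∧ m.ess x := by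
  classical exact Finset.mem_filter
lemma mem_Oc {d x : D} : x ∈ m.Oc d ↔ x ∈ m.Es d ∧ m.chi x := by
  classical exact Finset.mem_filter
lemma mem_Kc {d x : D} : x ∈ m.Kc d ↔ x ∈ m.Es d ∧ ¬ m.chi x := by
  classical exact Finset.mem_filter

lemma bb_inner (hsc : SmallCancellation R (1/6)) {d : D} (hd : ¬ m.out d) {x : D} (hx : x ∈ m.Kc d) :
    6 * m.bb x < nn m.φ d := by
  obtain ⟨h1, h2⟩ := m.mem_Kc.mp hx
  obtain ⟨h3, h4⟩ := m.mem_Es.mp h1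
  rw [← nn_eq _ h3]
  exact (m.arc_inner hsc (by rwa [m.out_orb h3]) h2 (m.bb_spec h4).1 fun i => m.bb_lt).1

lemma cover' (hsc : SmallCancellation R (1/6)) {d : D} (hd : ¬ m.out d) (h : (m.Es d).Nonempty) :
    nn m.φ d ≤ ∑ s ∈ m.Oc d, m.bb s + ∑ s ∈ m.Kc d, m.bb s ∧
    6 * ∑ s ∈ m.Kc d, m.bb s + (m.Kc d).card ≤ (m.Kc d).card * nn m.φ d := by
  classical
  constructor
  · refine (m.cover h).trans (le_of_eq ?_)
    exact (Finset.sum_filter_add_sum_filter_not _ _ _).symm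
  · rw [Finset.mul_sum]
    have := Finset.sum_le_sum (s := m.Kc d) (f := fun s => 6 * m.bb s + 1) (g := fun _ => nn m.φ d)
      fun s hs => m.bb_inner hsc hd hs
    simpa [Finset.sum_add_distrib] using this

lemma face_nonpos (hsc : SmallCancellation R (1/6)) {d : D} (hd : ¬ m.out d) (h : (m.Es d).Nonempty)
    (hO : ∀ s ∈ m.Oc d, 2 * m.bb s ≤ nn m.φ d) : 12 ≤ m.FW d ∧
    (m.FW d = 12 → ((m.Oc d).card = 2 ∧ (m.Kc d).card ≤ 2) ∨ ((m.Oc d).card = 1 ∧ (m.Kc d).card = 4)) := by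
  obtain ⟨c1, c2⟩ := m.cover' hsc hd h
  obtain ⟨f1, f2⟩ := m.FW_ge d
  have c3 : 2 * ∑ s ∈ m.Oc d, m.bb s ≤ (m.Oc d).card * nn m.φ d := by
    rw [Finset.mul_sum]
    have := Finset.sum_le_sum hO
    simpa using this
  have hp := nn_pos m.φ d
  rcases Nat.lt_or_ge 1 (m.Oc d).card with ho | ho
  · constructor
    · omega
    · intro h; left; omega
  · generalize (m.Oc d).card = o at *
    generalize (m.Kc d).card = k at *
    generalize nn m.φ d = n at *
    generalize ∑ s ∈ m.Oc d, m.bb s = A at *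
    generalize ∑ s ∈ m.Kc d, m.bb s = B at *
    interval_cases o
    · have : 7 ≤ k := by
        by_contra hk
        have : k ≤ 6 := by omega
        interval_cases k <;> omega
      omega
    · have : 4 ≤ k := by
        by_contra hk
        have : k ≤ 3 := by omega
        interval_cases k <;> omega
      omega

lemma Es_empty (hsc : SmallCancellation R (1/6)) {d : D} (hd : ¬ m.out d) (h : ¬ (m.Es d).Nonempty) (i : ℕ) :
    m.μ (m.o i) ∈ orb m.φ d := by
  have hne : ∀ j, ¬ m.ess ((m.φ ^ j) d) := fun j hj => h ⟨_, m.mem_Es.mpr ⟨pow_orb _ _ _, hj⟩⟩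
  by_cases hc : m.out (m.μ d)
  · obtain ⟨k, hk⟩ := hc
    have h1 : ∀ j, m.μ ((m.φ ^ j) d) ∈ orb m.φ (m.μ d) ∧ (m.φ ^ j) (m.μ ((m.φ ^ j) d)) = m.μ d := fun j =>
      ⟨m.orb_flip (j := j+1) (fun i _ _ => hne i) (by omega),
        m.flip_pow (j := j+1) (fun i _ _ => hne i) (by omega)⟩
    have h2 : m.o i ∈ orb m.φ (m.μ d) := by
      have h3 : ∀ i, m.o i ∈ orb m.φ (m.o 0) := fun i => by
        rw [← Nat.zero_add i, ← m.o_add]; exact pow_orb _ _ _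
      rw [hk, orb_eq _ (h3 k)]; exact h3 i
    have h4 : m.μ d ∈ orb m.φ (m.o i) := by rw [orb_eq _ h2]; exact self_orb _ _
    obtain ⟨j, -, hj⟩ := mem_orb_lt _ h4
    have := (h1 j).2
    rw [← hj] at this
    have := (m.φ ^ j).injective this
    rw [← this, m.μμ]
    exact pow_orb _ _ _
  · have := (m.arc_inner hsc hd hc (nn_pos m.φ d) fun i _ _ => hne i).1
    omega

end PM
end Face
end MorseLTG

namespace MorseLTG
section Arc
variable {S : Type*} {G : Type*} [Group G] {σ : S → G} {R : Set (Word S)} {g : G} {W : Word S}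
  {D : Type} [Fintype D] [DecidableEq D] (m : PM σ R W g D)

namespace PM
lemma out_lt (hW : W ≠ []) {d : D} (h : m.out d) : ∃ i < W.length, d = m.o i := by
  obtain ⟨i, rfl⟩ := h
  exact ⟨i % W.length, Nat.mod_lt _ (List.length_pos_iff.mpr hW), (m.o_mod i).symm⟩

lemma outer_arc (hW : W ≠ []) {s : D} (hc : m.chi s) {j : ℕ} (hj : 1 ≤ j)
    (h : ∀ i, 0 < i → i < j → ¬ m.ess ((m.φ ^ i) s)) :
    ∃ i0 < W.length, ∀ t < j, m.μ ((m.φ ^ (j - 1 - t)) s) = m.o (i0 + t) := by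
  have h1 : m.out (m.μ ((m.φ ^ (j-1)) s)) := by
    rw [m.out_orb (m.orb_flip h (by omega))]; exact hc
  obtain ⟨i0, hi0, h2⟩ := m.out_lt hW h1
  refine ⟨i0, hi0, fun t ht => ?_⟩
  have h3 := m.flip_pow h (i := j - 1 - t) (by omega)
  have h4 := m.flip_pow h (i := j - 1) (by omega)
  apply (m.φ ^ (j - 1 - t)).injective
  rw [h3, ← h4, h2, ← m.o_add, ← Equiv.Perm.mul_apply, ← pow_add]
  congr 2; omega

lemma arc_le (hW : W ≠ []) {s : D} (hc : m.chi s) {j : ℕ} (hj : 1 ≤ j) (hjn : j ≤ nn m.φ s)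
    (h : ∀ i, 0 < i → i < j → ¬ m.ess ((m.φ ^ i) s)) : j ≤ W.length := by
  obtain ⟨i0, -, h0⟩ := m.outer_arc hW hc hj h
  by_contra hlt
  have h1 := h0 0 (by omega)
  have h2 := h0 W.length (by omega)
  rw [Nat.add_zero] at h1
  rw [m.o_per, ← h1] at h2
  have := pow_inj m.φ (d := s) (by omega) (by omega) (m.μ_inj h2)
  have := List.length_pos_iff.mpr hW
  omega

lemma arc_word {s : D} {j i0 : ℕ} (h0 : ∀ t < j, m.μ ((m.φ ^ (j - 1 - t)) s) = m.o (i0 + t)) :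
    m.fw (m.o i0) j = wordInv (m.fw s j) := by
  apply List.ext_getElem
  · simp
  · intro t h1 h2
    rw [fw_length] at h1
    simp only [wordInv_eq, List.getElem_reverse, List.getElem_map, fw_get, List.length_map, fw_length]
    rw [← m.lab_μ, h0 t h1, m.o_add]

/-- the relator across an outer arc -/
lemma arc_rel {s : D} (hs : ¬ m.out s) {j : ℕ} (hjn : j ≤ nn m.φ s) :
    ∃ r ∈ symmClosure R, r.length = nn m.φ s ∧ wordInv (m.fw s j) <+: r := by
  have h1 := symm_inv (m.face' hs)
  have h2 : m.fw s (nn m.φ s) = m.fw s j ++ m.fw ((m.φ ^ j) s) (nn m.φ s - j) := by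
    apply List.ext_getElem
    · simp; omega
    · intro t h3 h4
      rw [List.getElem_append]
      simp only [fw_get, fw_length]
      split_ifs with h5
      · rfl
      · rw [← Equiv.Perm.mul_apply, ← pow_add]; congr 3; omega
  rw [h2, wordInv_append] at h1
  refine ⟨_, symm_rot h1 List.isRotated_append, ?_, List.prefix_append _ _⟩
  simp; omega

lemma rot_word (i0 : ℕ) (hi : i0 < W.length) : m.fw (m.o i0) W.length = W.rotate i0 := by
  apply List.ext_getElem
  · simp
  · intro t h1 h2
    rw [fw_get, List.getElem_rotate, m.o_add, ← m.o_mod, Nat.add_comm, m.lab_o]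
lemma fw_prefix (d : D) {j k : ℕ} (h : j ≤ k) : m.fw d j <+: m.fw d k := by
  have : m.fw d j = (m.fw d k).take j := by
    rw [fw, fw, ← List.map_take, List.take_range, Nat.min_eq_left h]
  rw [this]; exact List.take_prefix _ _

lemma spur_out (hcr : ∀ r ∈ R, CyclicallyReduced r) (hW : W ≠ []) {d : D} (h : m.ψ d = d) :
    ∃ i < W.length, d = m.o (i + 1) ∧ m.μ d = m.o i := by
  have h1 : m.out d := by by_contra h1; exact m.no_spur hcr h1 h
  have h2 : m.out (m.μ d) := by rw [← m.out_φ, ← m.ψ_apply, h]; exact h1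
  obtain ⟨i, hi, h3⟩ := m.out_lt hW h2
  refine ⟨i, hi, ?_, h3⟩
  rw [← m.o_succ, ← h3, ← m.ψ_apply, h]

lemma spur_word (hW : W ≠ []) {i : ℕ} (h : m.μ (m.o (i+1)) = m.o i) : ¬ CyclicallyReduced W := by
  intro hc
  have hp := List.length_pos_iff.mpr hW
  have h2 : 2 ≤ W.length := by
    by_contra h2
    have h3 : W.length = 1 := by omega
    have := m.o_per i
    rw [h3] at this
    exact m.μne _ (h.trans this.symm)
  have h3 := hc (i % W.length)
  rw [← m.rot_word _ (Nat.mod_lt _ hp)] at h3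
  have := List.isChain_iff_getElem.mp (red_iff.mp h3) 0 (by rw [fw_length]; omega)
  simp only [fw_get, zero_add, pow_one, pow_zero, Equiv.Perm.one_apply, m.o_mod, m.o_succ] at this
  rw [← h, m.lab_μ] at this
  simp [fl] at this
end PM

lemma greendlinger (hsc : SmallCancellation R (1/6)) (hR : ∀ r ∈ R, evalWord σ r = 1) (hW : W ≠ [])
    (hc : CyclicallyReduced W) (hN : FreeGroup.mk W ∈ Subgroup.normalClosure (FreeGroup.mk '' R)) :
    ∃ k, ∃ r ∈ symmClosure R, ∃ u, u <+: W.rotate k ∧ u <+: r ∧ r.length < 2 * u.length := by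
  have : Nonempty S := by
    rcases W with _ | ⟨a, w⟩
    · exact absurd rfl hW
    · exact ⟨a.1⟩
  obtain ⟨D, i1, i2, ⟨m⟩⟩ := pm_exists (diagram_exists (σ := σ) hsc.1 hR 1 W hN) hW
  by_contra hno
  have key : ∀ (s : D), ¬ m.out s → m.chi s → ∀ j, 1 ≤ j → j ≤ nn m.φ s →
      (∀ i, 0 < i → i < j → ¬ m.ess ((m.φ ^ i) s)) → 2 * j ≤ nn m.φ s := by
    intro s h1 h2 j h3 h4 h5
    by_contra hlt
    obtain ⟨i0, hi0, h6⟩ := m.outer_arc hW h2 h3 h5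
    obtain ⟨r, hr, hrl, hpr⟩ := m.arc_rel h1 h4
    refine hno ⟨i0, r, hr, _, ?_, hpr, ?_⟩
    · rw [← m.arc_word h6, ← m.rot_word i0 hi0]
      exact m.fw_prefix _ (m.arc_le hW h2 h3 h4 h5)
    · rw [hrl, wordInv_length, m.fw_length]; omega
  have hc0 := m.curv
  have hs : (Finset.univ.filter (fun d => m.ψ d = d)) = ∅ := by
    rw [Finset.filter_eq_empty_iff]
    intro d _ hd
    obtain ⟨i, -, h1, h2⟩ := m.spur_out hsc.1 hW hd
    rw [h1] at h2
    exact m.spur_word hW h2 hc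
  rw [hs] at hc0
  have : ∑ F ∈ m.faces, (12 - ∑ x ∈ F, (m.wt x : ℤ)) ≤ 0 := by
    refine Finset.sum_nonpos fun F hF => ?_
    classical
    obtain ⟨d, hd, rfl⟩ := Finset.mem_image.mp hF
    have hd' := (Finset.mem_filter.mp hd).2
    have hE : (m.Es d).Nonempty := by
      by_contra hE
      have h1 := m.Es_empty hsc hd' hE 0
      have h2 : ¬ m.out (m.μ (m.o 0)) := by rwa [m.out_orb h1]
      have h3 : m.chi (m.μ (m.o 0)) := ⟨0, m.μμ _⟩
      have := key _ h2 h3 _ (nn_pos _ _) le_rfl fun i _ _ hi => hE ⟨(m.φ ^ i) (m.μ (m.o 0)),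
        m.mem_Es.mpr ⟨by rw [← orb_eq _ h1]; exact pow_orb _ _ _, hi⟩⟩
      have := nn_pos m.φ (m.μ (m.o 0))
      omega
    have := (m.face_nonpos hsc hd' hE (fun s hs => by
      obtain ⟨h1, h2⟩ := m.mem_Oc.mp hs
      obtain ⟨h3, h4⟩ := m.mem_Es.mp h1
      rw [← nn_eq _ h3]
      have h5 := m.bb_spec h4
      exact key s (by rwa [m.out_orb h3]) h2 _ h5.1 h5.2.2 (fun i => m.bb_lt))).1
    have h6 : (m.FW d : ℤ) = ∑ x ∈ orb m.φ d, (m.wt x : ℤ) := by simp [PM.FW]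
    omega
  simp only [Finset.card_empty, Nat.cast_zero, mul_zero, add_zero] at hc0
  omega

lemma mk_rot_mem {N : Subgroup (FreeGroup S)} [N.Normal] {w w' : Word S} (h : w ~r w')
    (hw : FreeGroup.mk w ∈ N) : FreeGroup.mk w' ∈ N := by
  obtain ⟨k, rfl⟩ := h
  rw [← List.take_append_drop (k % w.length) w, ← FreeGroup.mul_mk] at hw
  rw [List.rotate_eq_drop_append_take_mod, ← FreeGroup.mul_mk]
  exact (inferInstance : N.Normal).mem_comm hw

lemma mk_symm_mem {N : Subgroup (FreeGroup S)} [N.Normal] {w : Word S} (h : w ∈ symmClosure R)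
    (hR : ∀ r ∈ R, r.length = w.length → FreeGroup.mk r ∈ N) : FreeGroup.mk w ∈ N := by
  obtain ⟨r, hr, k, h | h⟩ := h
  · rw [h]; exact mk_rot_mem ⟨k, rfl⟩ (hR r hr (by rw [h]; simp))
  · rw [h]; refine mk_rot_mem ⟨k, rfl⟩ ?_
    rw [mk_wordInv]; exact N.inv_mem (hR r hr (by rw [h]; simp))

lemma dehn (hsc : SmallCancellation R (1/6)) (hR : ∀ r ∈ R, evalWord σ r = 1) (n : ℕ) :
    ∀ W : Word S, W.length = n → FreeGroup.mk W ∈ Subgroup.normalClosure (FreeGroup.mk '' R) →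
    FreeGroup.mk W ∈ Subgroup.normalClosure (FreeGroup.mk '' {r ∈ R | r.length < 2 * n}) := by
  induction n using Nat.strong_induction_on with
  | _ n ih =>
  intro W hWn hN
  rcases eq_or_ne W [] with rfl | hW
  · exact one_mem _
  have hmono : ∀ k ≤ n, Subgroup.normalClosure (FreeGroup.mk '' {r ∈ R | r.length < 2 * k}) ≤
      Subgroup.normalClosure (FreeGroup.mk '' {r ∈ R | r.length < 2 * n}) := fun k hk =>
    Subgroup.normalClosure_mono (Set.image_mono fun r hr => ⟨hr.1, by have := hr.2; omega⟩)
  have hstep : ∀ W', W'.length < n → FreeGroup.mk W' ∈ Subgroup.normalClosure (FreeGroup.mk '' R) →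
      FreeGroup.mk W' ∈ Subgroup.normalClosure (FreeGroup.mk '' {r ∈ R | r.length < 2 * n}) :=
    fun W' h1 h2 => hmono _ h1.le (ih _ h1 W' rfl h2)
  by_cases hc : CyclicallyReduced W
  · obtain ⟨k, r, hr, u, ⟨v, hv⟩, ⟨t, ht⟩, hlen⟩ := greendlinger hsc hR hW hc hN
    have hl : u.length + v.length = n := by rw [← List.length_append, hv, List.length_rotate, hWn]
    have hrl : u.length + t.length = r.length := by rw [← List.length_append, ht]
    have hrN : FreeGroup.mk r ∈ Subgroup.normalClosure (FreeGroup.mk '' {r ∈ R | r.length < 2 * n}) := by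
      refine mk_symm_mem hr fun r' hr' hl' => Subgroup.subset_normalClosure ⟨r', ⟨hr', ?_⟩, rfl⟩
      omega
    have hrN' := Subgroup.normalClosure_mono (Set.image_mono (Set.sep_subset R _)) hrN
    have e : FreeGroup.mk (W.rotate k) = FreeGroup.mk r * FreeGroup.mk (wordInv t ++ v) := by
      rw [← hv, ← ht, ← FreeGroup.mul_mk, ← FreeGroup.mul_mk, ← FreeGroup.mul_mk, mk_wordInv]; group
    refine mk_rot_mem (List.IsRotated.symm ⟨k, rfl⟩) ?_
    have h1 := mk_rot_mem ⟨k, rfl⟩ hN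
    rw [e] at h1 ⊢
    refine mul_mem hrN (hstep _ ?_ ?_)
    · simp; omega
    · exact (Subgroup.mul_mem_cancel_left _ hrN').mp h1
  · unfold CyclicallyReduced at hc
    push Not at hc
    obtain ⟨k, hk⟩ := hc
    rw [red_iff, List.isChain_iff_getElem] at hk
    push Not at hk
    obtain ⟨i, hi, h1, h2⟩ := hk
    refine mk_rot_mem (List.IsRotated.symm ⟨k, rfl⟩) ?_
    have h3 := mk_rot_mem ⟨k, rfl⟩ hN
    set V := W.rotate k
    have hVl : V.length = n := by simp [V, hWn]
    have e1 : V = V.take i ++ (V[i] :: fl V[i] :: V.drop (i+2)) := by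
      conv_lhs => rw [← List.take_append_drop i V]
      rw [List.drop_eq_getElem_cons (by omega), List.drop_eq_getElem_cons (by omega)]
      congr 3
      refine Prod.ext h1.symm ?_
      simp only [fl]
      revert h2; generalize V[i].2 = a; generalize V[i+1].2 = b
      cases a <;> cases b <;> simp
    have e2 : FreeGroup.mk V = FreeGroup.mk (V.take i ++ V.drop (i+2)) := by
      conv_lhs => rw [e1]
      exact Quot.sound FreeGroup.Red.Step.not
    rw [e2] at h3 ⊢
    refine hstep _ ?_ h3
    simp; omega
end Arc

section Pres
variable {S : Type*} {R : Set (Word S)}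
abbrev GP (R : Set (Word S)) := PresentedGroup (FreeGroup.mk '' R)

lemma eval_pres (w : Word S) : evalWord (presGen R) w = PresentedGroup.mk (FreeGroup.mk '' R) (FreeGroup.mk w) := by
  induction w with
  | nil => rw [evalWord_nil, ← FreeGroup.one_eq_mk, map_one]
  | cons a w ih =>
    rw [evalWord_cons, ih, ← List.singleton_append, ← FreeGroup.mul_mk, map_mul]
    congr 1
    rcases a with ⟨a, b⟩
    cases b
    · have : FreeGroup.mk [(a, false)] = (FreeGroup.of a)⁻¹ := by
        rw [FreeGroup.of, FreeGroup.inv_mk]; rfl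
      simp [ev, presGen, this, PresentedGroup.of]
    · simp [ev, presGen, PresentedGroup.of, FreeGroup.of]

lemma eval_one_iff (w : Word S) : evalWord (presGen R) w = 1 ↔
    FreeGroup.mk w ∈ Subgroup.normalClosure (FreeGroup.mk '' R) := by
  rw [eval_pres]
  exact PresentedGroup.mk_eq_one_iff

lemma rel_one : ∀ r ∈ R, evalWord (presGen R) r = 1 := fun r hr => by
  rw [eval_one_iff]; exact Subgroup.subset_normalClosure ⟨r, hr, rfl⟩

lemma symm_mono {R' : Set (Word S)} (h : R' ⊆ R) : symmClosure R' ⊆ symmClosure R :=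
  fun _ ⟨r, hr, h'⟩ => ⟨r, h hr, h'⟩

lemma sc_mono {R' : Set (Word S)} (h : R' ⊆ R) {l : ℝ} (hsc : SmallCancellation R l) :
    SmallCancellation R' l :=
  ⟨fun r hr => hsc.1 r (h hr), fun r hr p ⟨h1, r1, hr1, r2, hr2, h2⟩ hpr =>
    hsc.2 r (symm_mono h hr) p ⟨h1, r1, symm_mono h hr1, r2, symm_mono h hr2, h2⟩ hpr⟩

lemma diag (hsc : SmallCancellation R (1/6)) {W : Word S} (hW : W ≠ [])
    (h : evalWord (presGen R) W = 1) (g : GP R) :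
    ∃ (D : Type) (_ : Fintype D) (_ : DecidableEq D),
      Nonempty (PM (presGen R) {r ∈ R | r.length < 2 * W.length} W g D) := by
  have : Nonempty S := by
    rcases W with _ | ⟨a, w⟩
    · exact absurd rfl hW
    · exact ⟨a.1⟩
  refine pm_exists (diagram_exists (fun r hr => hsc.1 r hr.1) (fun r hr => rel_one r hr.1) g W ?_) hW
  exact dehn hsc rel_one _ W rfl ((eval_one_iff W).mp h)
end Pres
end MorseLTG

namespace MorseLTG
section WD
variable {S : Type*} {G : Type*} [Group G] {σ : S → G}

def Gd (σ : S → G) (w : Word S) : Prop := ∀ w', evalWord σ w' = evalWord σ w → w.length ≤ w'.length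

lemma Gd.nil : Gd σ [] := fun w' _ => Nat.zero_le _
lemma Gd.infix {w z : Word S} (h : Gd σ w) (hz : z <:+: w) : Gd σ z := by
  obtain ⟨a, b, rfl⟩ := hz
  intro z' hz'
  have := h (a ++ z' ++ b) (by simp only [evalWord_append, hz'])
  simp at this; omega
lemma Gd.inv {w : Word S} (h : Gd σ w) : Gd σ (wordInv w) := by
  intro w' hw'
  have := h (wordInv w') (by rw [evalWord_inv, hw', evalWord_inv, inv_inv])
  simpa using this
lemma Gd.red {w : Word S} (h : Gd σ w) : ReducedWord w := by
  rw [red_iff, List.isChain_iff_getElem]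
  intro i hi h1
  by_contra h2
  have e1 : w = w.take i ++ (w[i] :: fl w[i] :: w.drop (i+2)) := by
    conv_lhs => rw [← List.take_append_drop i w]
    rw [List.drop_eq_getElem_cons (by omega), List.drop_eq_getElem_cons (by omega)]
    congr 3
    refine Prod.ext h1.symm ?_
    simp only [fl]
    revert h2; generalize w[i].2 = a; generalize w[i+1].2 = b
    cases a <;> cases b <;> simp
  have := h (w.take i ++ w.drop (i+2)) (by
    conv_rhs => rw [e1]
    simp [evalWord_append, evalWord_cons, ev_fl])
  simp at this; omega
lemma Gd.half {R : Set (Word S)} (hR : ∀ r ∈ R, evalWord σ r = 1) {z r : Word S} (h : Gd σ z)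
    (hr : r ∈ symmClosure R) (hz : z <:+: r) : 2 * z.length ≤ r.length := by
  obtain ⟨a, b, hab⟩ := hz
  have h1 := symm_eval hR hr
  rw [← hab, evalWord_append, evalWord_append] at h1
  have := h (wordInv a ++ wordInv b) (by
    rw [evalWord_append, evalWord_inv, evalWord_inv]
    rw [mul_assoc] at h1
    have := eq_inv_of_mul_eq_one_right h1
    rw [eq_mul_inv_iff_mul_eq.mpr this])
  rw [← hab]; simp at this ⊢; omega
lemma infix_pre {R : Set (Word S)} {z r : Word S} (hr : r ∈ symmClosure R) (hz : z <:+: r) :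
    ∃ r' ∈ symmClosure R, r'.length = r.length ∧ z <+: r' := by
  obtain ⟨a, b, rfl⟩ := hz
  refine ⟨z ++ (b ++ a), symm_rot hr ?_, by simp; omega, List.prefix_append _ _⟩
  rw [List.append_assoc, ← List.append_assoc z]; exact List.isRotated_append

def gen (σ : S → G) : Prop := ∀ x : G, ∃ w, evalWord σ w = x

lemma gd_exists (hg : gen σ) (x : G) : ∃ w, Gd σ w ∧ evalWord σ w = x := by
  classical
  obtain ⟨w, hw⟩ := hg x
  have hex : ∃ n, ∃ w, evalWord σ w = x ∧ w.length = n := ⟨_, w, hw, rfl⟩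
  obtain ⟨v, hv, hl⟩ := Nat.find_spec hex
  refine ⟨v, fun w' hw' => ?_, hv⟩
  rw [hl]; exact Nat.find_min' hex ⟨w', hw'.trans hv, rfl⟩

lemma wd_le (g : G) (w : Word S) : wordDist σ g (g * evalWord σ w) ≤ w.length := Nat.sInf_le ⟨w, rfl, rfl⟩
lemma wd_spec (hg : gen σ) (g h : G) : ∃ w, Gd σ w ∧ g * evalWord σ w = h ∧ wordDist σ g h = w.length := by
  obtain ⟨w, hw, h1⟩ := gd_exists hg (g⁻¹ * h)
  refine ⟨w, hw, by rw [h1]; group, le_antisymm ?_ ?_⟩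
  · have := wd_le (σ := σ) g w
    rwa [h1, mul_inv_cancel_left] at this
  · obtain ⟨w', h2, h3⟩ := Nat.sInf_mem (s := {n : ℕ | ∃ w : Word S, w.length = n ∧ g * evalWord σ w = h})
      ⟨_, w, rfl, by rw [h1]; group⟩
    rw [wordDist, ← h2]
    exact hw w' (by rw [h1, ← h3]; group)
lemma wd_gd {w : Word S} (hg : gen σ) (g : G) (h : Gd σ w) : wordDist σ g (g * evalWord σ w) = w.length := by
  obtain ⟨v, h1, h2, h3⟩ := wd_spec hg g (g * evalWord σ w)
  rw [h3]
  have := mul_left_cancel h2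
  exact le_antisymm (h1 w this.symm) (h v this)
lemma gd_of_wd {w : Word S} (hg : gen σ) (g : G) (h : w.length ≤ wordDist σ g (g * evalWord σ w)) : Gd σ w := by
  intro w' hw'
  have := wd_le (σ := σ) g w'
  rw [hw'] at this; omega
lemma wd_mul (k g h : G) : wordDist σ (k * g) (k * h) = wordDist σ g h := by
  unfold wordDist
  congr 1; ext n; simp [mul_assoc]
lemma wd_symm (hg : gen σ) (g h : G) : wordDist σ g h = wordDist σ h g := by
  have : ∀ g h, wordDist σ h g ≤ wordDist σ g h := by
    intro g h
    obtain ⟨v, h1, h2, h3⟩ := wd_spec hg g h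
    rw [h3, ← wordInv_length v]
    have := wd_le (σ := σ) h (wordInv v)
    rwa [evalWord_inv, ← h2, mul_inv_cancel_right, h2] at this
  exact le_antisymm (this h g) (this g h)
lemma wd_tri (hg : gen σ) (a b c : G) : wordDist σ a c ≤ wordDist σ a b + wordDist σ b c := by
  obtain ⟨u, -, h2, h3⟩ := wd_spec hg a b
  obtain ⟨v, -, h2', h3'⟩ := wd_spec hg b c
  have := wd_le (σ := σ) a (u ++ v)
  rw [evalWord_append, ← mul_assoc, h2, h2', List.length_append] at this
  omega
lemma wd_self (g : G) : wordDist σ g g = 0 := by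
  have := wd_le (σ := σ) g []
  rw [evalWord_nil, mul_one] at this
  simpa using this

lemma gen_pres {R : Set (Word S)} : gen (presGen R) := by
  intro x
  classical
  obtain ⟨y, rfl⟩ := PresentedGroup.mk_surjective _ x
  exact ⟨y.toWord, by rw [eval_pres, FreeGroup.mk_toWord]⟩
end WD

section Arc2
variable {S : Type*} {G : Type*} [Group G] {σ : S → G} {R : Set (Word S)} {g : G} {W : Word S}
  {D : Type} [Fintype D] [DecidableEq D] (m : PM σ R W g D)
namespace PM
lemma o_word {i k : ℕ} (h : i + k ≤ W.length) : m.fw (m.o i) k = (W.drop i).take k := by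
  apply List.ext_getElem
  · simp; omega
  · intro t h1 h2
    rw [fw_length] at h1
    simp only [fw_get, List.getElem_take, List.getElem_drop, m.o_add]
    rw [m.lab_o]
lemma fw_infix (d : D) {a b k : ℕ} (h : a + b ≤ k) : m.fw ((m.φ ^ a) d) b <:+: m.fw d k := by
  have : m.fw ((m.φ ^ a) d) b = ((m.fw d k).drop a).take b := by
    apply List.ext_getElem
    · simp; omega
    · intro t h1 h2
      simp only [fw_get, List.getElem_take, List.getElem_drop]
      rw [← Equiv.Perm.mul_apply, ← pow_add, Nat.add_comm]
  rw [this]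
  exact (List.take_prefix _ _).isInfix.trans (List.drop_suffix _ _).isInfix

lemma arc_sub (hW : W ≠ []) {s : D} (hs : ¬ m.out s) (hc : m.chi s) {j : ℕ} (hj : 1 ≤ j) (hjn : j ≤ nn m.φ s)
    (h : ∀ i, 0 < i → i < j → ¬ m.ess ((m.φ ^ i) s)) :
    j ≤ W.length ∧ ∃ i0 < W.length, (∀ t < j, m.μ (m.o (i0 + t)) = (m.φ ^ (j - 1 - t)) s) ∧
    ∃ r ∈ symmClosure R, r.length = nn m.φ s ∧ ∀ a b, a + b ≤ j → m.fw (m.o (i0 + a)) b <:+: r := by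
  refine ⟨m.arc_le hW hc hj hjn h, ?_⟩
  obtain ⟨i0, hi0, h6⟩ := m.outer_arc hW hc hj h
  obtain ⟨r, hr, hrl, hpr⟩ := m.arc_rel hs hjn
  refine ⟨i0, hi0, fun t ht => by rw [← h6 t ht, m.μμ], r, hr, hrl, fun a b hab => ?_⟩
  rw [← m.o_add]
  refine (m.fw_infix _ hab).trans ?_
  rw [m.arc_word h6]; exact hpr.isInfix

lemma FW_eq_sum (d : D) : (12 : ℤ) - ∑ x ∈ orb m.φ d, (m.wt x : ℤ) = 12 - (m.FW d : ℤ) := by simp [FW]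

lemma FW_pos {d : D} (h : (m.Es d).Nonempty) : 2 ≤ m.FW d := by
  have h1 := m.FW_ge d
  have h2 := m.card_Es d
  have := Finset.card_pos.mpr h
  omega
end PM
end Arc2
end MorseLTG

namespace MorseLTG
section Geo
variable {S : Type*} {R : Set (Word S)}

lemma red_get {w : Word S} (h : ReducedWord w) {i : ℕ} (hi : i + 1 < w.length) : w[i] ≠ fl w[i+1] := by
  intro he
  have := List.isChain_iff_getElem.mp (red_iff.mp h) i hi
  rw [he] at this
  simp [fl] at this

lemma winv_get {w : Word S} {i : ℕ} (hi : i < (wordInv w).length) :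
    (wordInv w)[i] = fl (w[w.length - 1 - i]'(by simp at hi; omega)) := by
  simp [wordInv_eq]

lemma PM.spur_lab {G : Type*} [Group G] {σ : S → G} {g : G} {W : Word S}
    {D : Type} [Fintype D] [DecidableEq D] (m : PM σ R W g D) {i : ℕ} (hi : i < W.length)
    (h : m.μ (m.o (i+1)) = m.o i) : W[i] = fl (W[(i+1) % W.length]'(Nat.mod_lt _ (by omega))) := by
  have h1 := m.lab_μ (m.o (i+1))
  rw [h, m.lab_o i hi, ← m.o_mod (i+1), m.lab_o _ (Nat.mod_lt _ (by omega))] at h1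
  exact h1

def ov3 (R : Set (Word S)) (w : Word S) : Prop :=
  ∀ z r, z ≠ [] → z <:+: w → r ∈ symmClosure R → z <:+: r → 3 * z.length < r.length

lemma ov3.infix {w z : Word S} (h : ov3 R w) (hz : z <:+: w) : ov3 R z :=
  fun y r h1 h2 => h y r h1 (h2.trans hz)

lemma red_infix {w z : Word S} (h : ReducedWord w) (hz : z <:+: w) : ReducedWord z :=
  List.IsChain.infix h hz

lemma take_last {w : Word S} (h : w ≠ []) : w = w.take (w.length - 1) ++ [w[w.length-1]'(by
    have := List.length_pos_iff.mpr h; omega)] := by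
  have := List.length_pos_iff.mpr h
  conv_lhs => rw [← List.take_append_drop (w.length - 1) w]
  rw [List.drop_eq_getElem_cons (by omega), List.drop_of_length_le (by omega)]

/-- the bigon step: no cancellation at the corners -/
lemma geo_core (hsc : SmallCancellation R (1/6)) {w g : Word S} (hov : ov3 R w) (hg : Gd (presGen R) g)
    (he : evalWord (presGen R) w = evalWord (presGen R) g) (hlt : g.length < w.length)
    (hns : ∀ i (hi : i < (w ++ wordInv g).length), (w ++ wordInv g)[i] ≠
      fl ((w ++ wordInv g)[(i+1) % (w ++ wordInv g).length]'(Nat.mod_lt _ (by omega)))) : False := by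
  set W := w ++ wordInv g with hWd
  have hP : W.length = w.length + g.length := by simp [hWd]
  have hW : W ≠ [] := by rw [← List.length_pos_iff]; omega
  have hW1 : evalWord (presGen R) W = 1 := by rw [hWd, evalWord_append, evalWord_inv, he, mul_inv_cancel]
  obtain ⟨D, i1, i2, ⟨m⟩⟩ := diag hsc hW hW1 1
  set R' := {r ∈ R | r.length < 2 * W.length} with hR'
  have hsub : R' ⊆ R := fun r hr => hr.1
  have hsc' := sc_mono hsub hsc
  classical
  have hc0 := m.curv
  have hs : (Finset.univ.filter (fun d => m.ψ d = d)) = ∅ := by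
    rw [Finset.filter_eq_empty_iff]
    intro d _ hd
    obtain ⟨i, hi, h1, h2⟩ := m.spur_out hsc'.1 hW hd
    rw [h1] at h2
    exact hns i hi (m.spur_lab hi h2)
  simp only [hs, Finset.card_empty, Nat.cast_zero, mul_zero, add_zero] at hc0
  set e1 := m.μ (m.o (w.length - 1)) with he1
  set e2 := m.μ (m.o (W.length - 1)) with he2
  -- letters of sub-arcs
  have hw1 : ∀ i k, i + k ≤ w.length → ∀ r ∈ symmClosure R', m.fw (m.o i) k <:+: r → 0 < k → 3 * k < r.length := by
    intro i k hik r hr hz hk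
    rw [← m.fw_length (m.o i) k]
    refine hov _ r ?_ ?_ (symm_mono hsub hr) hz
    · rw [← List.length_pos_iff, m.fw_length]; exact hk
    · rw [m.o_word (by omega), hWd, List.drop_append_of_le_length (by omega), List.take_append_of_le_length (by simp; omega)]
      exact (List.take_prefix _ _).isInfix.trans (List.drop_suffix _ _).isInfix
  have hg1 : ∀ i k, w.length ≤ i → i + k ≤ W.length → ∀ r ∈ symmClosure R', m.fw (m.o i) k <:+: r → 2 * k ≤ r.length := by
    intro i k hi hik r hr hz
    rw [← m.fw_length (m.o i) k]
    refine Gd.half rel_one ?_ (symm_mono hsub hr) hz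
    rw [m.o_word hik, hWd, List.drop_append, List.drop_of_length_le hi, List.nil_append]
    exact hg.inv.infix ((List.take_prefix _ _).isInfix.trans (List.drop_suffix _ _).isInfix)
  -- arcs
  have harc : ∀ d, ¬ m.out d → ∀ s ∈ m.Oc d, ∃ i0 < W.length, m.bb s ≤ W.length ∧
      (∀ t < m.bb s, m.μ (m.o (i0 + t)) ∈ orb m.φ d) ∧
      ∃ r ∈ symmClosure R', r.length = nn m.φ d ∧ ∀ a b, a + b ≤ m.bb s → m.fw (m.o (i0 + a)) b <:+: r := by
    intro d hd s hs
    obtain ⟨h1, h2⟩ := m.mem_Oc.mp hs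
    obtain ⟨h3, h4⟩ := m.mem_Es.mp h1
    have h5 := m.bb_spec h4
    obtain ⟨h6, i0, hi0, h7, r, hr, hrl, h8⟩ := m.arc_sub hW (by rwa [m.out_orb h3]) h2 h5.1 h5.2.2 (fun i => m.bb_lt)
    refine ⟨i0, hi0, h6, fun t ht => ?_, r, hr, by rw [hrl, nn_eq _ h3], h8⟩
    rw [h7 t ht, ← orb_eq _ h3]; exact pow_orb _ _ _
  -- unmarked faces
  have hun : ∀ d, ¬ m.out d → e1 ∉ orb m.φ d → e2 ∉ orb m.φ d → 12 ≤ m.FW d := by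
    intro d hd h1 h2
    have hE : (m.Es d).Nonempty := by
      by_contra hE; exact h2 (m.Es_empty hsc' hd hE _)
    refine (m.face_nonpos hsc' hd hE fun s hs => ?_).1
    obtain ⟨i0, hi0, hb, ht, r, hr, hrl, hz⟩ := harc d hd s hs
    have q1 : i0 + m.bb s ≤ W.length := by
      by_contra hcon
      apply h2
      have := ht (W.length - 1 - i0) (by omega)
      rwa [show i0 + (W.length - 1 - i0) = W.length - 1 by omega] at this
    have q2 : i0 + m.bb s ≤ w.length ∨ w.length ≤ i0 := by
      by_contra hcon
      push Not at hcon
      apply h1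
      have := ht (w.length - 1 - i0) (by omega)
      rwa [show i0 + (w.length - 1 - i0) = w.length - 1 by omega] at this
    have hz0 := hz 0 (m.bb s) (by omega)
    rw [Nat.add_zero] at hz0
    rw [← hrl]
    rcases q2 with q2 | q2
    · rcases Nat.eq_zero_or_pos (m.bb s) with hb0 | hb0
      · omega
      · have := hw1 i0 _ q2 r hr hz0 hb0; omega
    · exact hg1 i0 _ q2 q1 r hr hz0
  -- marked once
  have hone : ∀ d, ¬ m.out d → ¬ (e1 ∈ orb m.φ d ∧ e2 ∈ orb m.φ d) → 8 ≤ m.FW d := by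
    intro d hd h12
    have hE : (m.Es d).Nonempty := by
      by_contra hE; exact h12 ⟨m.Es_empty hsc' hd hE _, m.Es_empty hsc' hd hE _⟩
    have hb5 : ∀ s ∈ m.Oc d, 6 * m.bb s ≤ 5 * nn m.φ d := by
      intro s hs
      obtain ⟨i0, hi0, hb, ht, r, hr, hrl, hz⟩ := harc d hd s hs
      rw [← hrl]
      have hz0 := hz 0 (m.bb s) (by omega)
      rw [Nat.add_zero] at hz0
      by_cases h2 : i0 + m.bb s ≤ W.length
      · rcases Nat.lt_or_ge (w.length) (i0 + m.bb s) with q | q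
        · rcases Nat.lt_or_ge i0 w.length with q' | q'
          · have z1 := hz 0 (w.length - i0) (by omega)
            rw [Nat.add_zero] at z1
            have z2 := hz (w.length - i0) (m.bb s - (w.length - i0)) (by omega)
            rw [show i0 + (w.length - i0) = w.length by omega] at z2
            have := hw1 _ _ (by omega) r hr z1 (by omega)
            have := hg1 _ _ le_rfl (by omega) r hr z2
            omega
          · have := hg1 i0 _ q' h2 r hr hz0; omega
        · rcases Nat.eq_zero_or_pos (m.bb s) with hb0 | hb0
          · omega
          · have := hw1 i0 _ q r hr hz0 hb0; omega
      · have e2m : e2 ∈ orb m.φ d := by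
          have := ht (W.length - 1 - i0) (by omega)
          rwa [show i0 + (W.length - 1 - i0) = W.length - 1 by omega] at this
        have e1m : e1 ∉ orb m.φ d := fun h => h12 ⟨h, e2m⟩
        have q1 : w.length ≤ i0 := by
          by_contra hcon
          apply e1m
          have := ht (w.length - 1 - i0) (by omega)
          rwa [show i0 + (w.length - 1 - i0) = w.length - 1 by omega] at this
        have z1 := hz 0 (W.length - i0) (by omega)
        rw [Nat.add_zero] at z1
        have z2 := hz (W.length - i0) (m.bb s - (W.length - i0)) (by omega)
        have q3 : m.o (i0 + (W.length - i0)) = m.o 0 := by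
          rw [show i0 + (W.length - i0) = 0 + W.length by omega, m.o_per]
        have q2 : m.bb s - (W.length - i0) ≤ w.length := by
          by_contra hcon
          apply e1m
          have := ht (W.length - i0 + (w.length - 1)) (by omega)
          rwa [show i0 + (W.length - i0 + (w.length - 1)) = (w.length - 1) + W.length by omega, m.o_per] at this
        rw [q3] at z2
        have := hg1 _ _ q1 (by omega) r hr z1
        have := hw1 _ _ (by omega) r hr z2 (by omega)
        omega
    obtain ⟨c1, c2⟩ := m.cover' hsc' hd hE
    obtain ⟨f1, f2⟩ := m.FW_ge d
    have c3 : 6 * ∑ s ∈ m.Oc d, m.bb s ≤ (m.Oc d).card * (5 * nn m.φ d) := by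
      rw [Finset.mul_sum]
      have := Finset.sum_le_sum hb5
      simpa using this
    have hp := nn_pos m.φ d
    rcases Nat.lt_or_ge 1 (m.Oc d).card with ho | ho
    · omega
    · generalize (m.Oc d).card = o at *
      generalize (m.Kc d).card = k at *
      by_contra hcon
      have hk : k ≤ 3 := by omega
      interval_cases o <;> interval_cases k <;> omega
  -- a face marked twice has essential corners
  have htwo : ∀ d, ¬ m.out d → 1 ≤ m.FW d := by
    intro d hd
    by_cases hE : (m.Es d).Nonempty
    · have := m.FW_pos hE; omega
    exfalso
    have h1 := m.Es_empty hsc' hd hE (W.length - 1)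
    change e2 ∈ _ at h1
    have hne : ∀ j, ¬ m.ess ((m.φ ^ j) e2) := fun j hj => hE ⟨_, m.mem_Es.mpr
      ⟨by rw [← orb_eq _ h1]; exact pow_orb _ _ _, hj⟩⟩
    have hchi : m.chi e2 := ⟨_, m.μμ _⟩
    have h2 : ¬ m.out e2 := by rwa [m.out_orb h1]
    have hnP := m.arc_le hW hchi (nn_pos m.φ e2) le_rfl fun i _ _ => hne i
    obtain ⟨hjP, i0, hi0, ht, r, hr, hrl, hz⟩ := m.arc_sub hW h2 hchi (nn_pos m.φ e2) le_rfl fun i _ _ => hne i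
    have hfl := m.flip_pow (d := e2) (j := nn m.φ e2 + 1) (fun i _ _ => hne i) (i := nn m.φ e2) (by omega)
    rw [pow_nn, he2, m.μμ, ← he2, m.o_add] at hfl
    have hPn : W.length ≤ nn m.φ e2 := by
      by_contra hcon
      have hq := nn_pos m.φ e2
      have h5 : m.o (W.length - 1 + nn m.φ e2) = m.o (nn m.φ e2 - 1) := by
        rw [show W.length - 1 + nn m.φ e2 = (nn m.φ e2 - 1) + W.length by omega, m.o_per]
      rw [h5] at hfl
      have := m.o_inj _ _ (by omega) (by omega) hfl
      have := nn_pos m.φ e2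
      omega
    have hl := ht (nn m.φ e2 - 1) (by have := nn_pos m.φ e2; omega)
    rw [Nat.sub_self, pow_zero, Equiv.Perm.one_apply, he2] at hl
    have hl' := m.μ_inj hl
    have hi00 : i0 = 0 := by
      rw [← he2, show nn m.φ e2 = W.length by omega] at hl'
      by_contra hcon
      have h5 : m.o (i0 + (W.length - 1)) = m.o (i0 - 1) := by
        rw [show i0 + (W.length - 1) = (i0 - 1) + W.length by omega, m.o_per]
      rw [h5] at hl'
      have := m.o_inj _ _ (by omega) (by omega) hl'
      omega
    have := hw1 0 w.length (by omega) r hr (by have := hz 0 w.length (by omega); rwa [hi00] at this) (by omega)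
    omega
  -- sum up
  set Mk := m.faces.filter (fun F => e1 ∈ F ∨ e2 ∈ F) with hMk
  have hsum : ∑ F ∈ m.faces, (12 - ∑ x ∈ F, (m.wt x : ℤ)) ≤ ∑ F ∈ Mk, (12 - ∑ x ∈ F, (m.wt x : ℤ)) := by
    rw [← Finset.sum_filter_add_sum_filter_not m.faces (fun F => e1 ∈ F ∨ e2 ∈ F)]
    have : ∑ F ∈ m.faces.filter (fun F => ¬ (e1 ∈ F ∨ e2 ∈ F)), (12 - ∑ x ∈ F, (m.wt x : ℤ)) ≤ 0 := by
      refine Finset.sum_nonpos fun F hF => ?_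
      obtain ⟨hF1, hF2⟩ := Finset.mem_filter.mp hF
      obtain ⟨d, hd, rfl⟩ := Finset.mem_image.mp hF1
      rw [m.FW_eq_sum]
      push Not at hF2
      have := hun d (Finset.mem_filter.mp hd).2 hF2.1 hF2.2
      omega
    linarith
  have hMsub : Mk ⊆ {orb m.φ e1, orb m.φ e2} := by
    intro F hF
    obtain ⟨hF1, hF2⟩ := Finset.mem_filter.mp hF
    obtain ⟨d, hd, rfl⟩ := Finset.mem_image.mp hF1
    rw [Finset.mem_insert, Finset.mem_singleton]
    rcases hF2 with h | h
    · left; exact (orb_eq _ h).symm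
    · right; exact (orb_eq _ h).symm
  by_cases heq : orb m.φ e1 = orb m.φ e2
  · rw [heq, Finset.pair_eq_singleton] at hMsub
    rcases Finset.subset_singleton_iff.mp hMsub with h | h
    · rw [h] at hsum; simp only [Finset.sum_empty] at hsum; omega
    · have hmem : orb m.φ e2 ∈ Mk := by rw [h]; simp
      obtain ⟨d, hd, hdd⟩ := Finset.mem_image.mp (Finset.mem_filter.mp hmem).1
      rw [h, Finset.sum_singleton, ← hdd, m.FW_eq_sum] at hsum
      have := htwo d (Finset.mem_filter.mp hd).2
      omega
  · have h8 : ∀ F ∈ Mk, (12 - ∑ x ∈ F, (m.wt x : ℤ)) ≤ 4 := by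
      intro F hF
      obtain ⟨d, hd, rfl⟩ := Finset.mem_image.mp (Finset.mem_filter.mp hF).1
      rw [m.FW_eq_sum]
      have := hone d (Finset.mem_filter.mp hd).2 (fun h => heq (by rw [orb_eq _ h.1, orb_eq _ h.2]))
      omega
    have h9 := Finset.sum_le_card_nsmul Mk _ _ h8
    have h10 : Mk.card ≤ 2 := (Finset.card_le_card hMsub).trans Finset.card_le_two
    rw [nsmul_eq_mul] at h9
    have : (Mk.card : ℤ) ≤ 2 := by exact_mod_cast h10
    linarith
end Geo
end MorseLTG

namespace MorseLTG
section Geo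
variable {S : Type*} {R : Set (Word S)}

lemma geo_aux (hsc : SmallCancellation R (1/6)) : ∀ (N : ℕ) (w g : Word S), w.length + g.length ≤ N →
    ReducedWord w → ov3 R w → Gd (presGen R) g → evalWord (presGen R) w = evalWord (presGen R) g →
    w.length ≤ g.length := by
  intro N
  induction N with
  | zero => intro w g h; omega
  | succ N ih =>
    intro w g hN hw hov hg he
    by_contra hlt
    push Not at hlt
    have hw0 : 0 < w.length := by omega
    refine geo_core hsc hov hg he hlt fun i hi heq => ?_
    have hL : (w ++ wordInv g).length = w.length + g.length := by simp
    rw [hL] at hi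
    rcases Nat.lt_or_ge (i+1) (w.length + g.length) with h1 | h1
    · have e1 : (i + 1) % (w ++ wordInv g).length = i + 1 := Nat.mod_eq_of_lt (by omega)
      simp only [e1] at heq
      rcases Nat.lt_trichotomy (i+1) w.length with h2 | h2 | h2
      · rw [List.getElem_append_left (by omega), List.getElem_append_left (by omega)] at heq
        exact red_get hw h2 heq
      · rw [List.getElem_append_left (by omega), List.getElem_append_right (by omega), winv_get, fl_fl] at heq
        have hg0 : 0 < g.length := by omega
        have tw := take_last (List.length_pos_iff.mp hw0)
        have tg := take_last (List.length_pos_iff.mp hg0)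
        have e3 : w[w.length-1] = g[g.length-1] := by
          have a1 : w[w.length-1] = w[i] := by congr 1; omega
          rw [a1, heq]; congr 1; omega
        have := ih (w.take (w.length-1)) (g.take (g.length-1)) (by simp; omega)
          (red_infix hw (List.take_prefix _ _).isInfix) (hov.infix (List.take_prefix _ _).isInfix)
          (hg.infix (List.take_prefix _ _).isInfix) (by
            rw [tw, tg, evalWord_append, evalWord_append, e3] at he
            exact mul_right_cancel he)
        simp at this; omega
      · rw [List.getElem_append_right (by omega), List.getElem_append_right (by omega)] at heq
        have hr := hg.inv.red
        refine red_get hr (i := i - w.length) (by simp; omega) ?_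
        rw [heq]; congr 2; omega
    · have e1 : (i + 1) % (w ++ wordInv g).length = 0 := by
        rw [hL, show i + 1 = w.length + g.length by omega, Nat.mod_self]
      simp only [e1] at heq
      rw [List.getElem_append_left hw0] at heq
      rcases Nat.eq_zero_or_pos g.length with hg0 | hg0
      · have hgn : g = [] := List.length_eq_zero_iff.mp hg0
        rw [List.getElem_append_left (by omega)] at heq
        have hw2 : 2 ≤ w.length := by
          by_contra hc
          have : i = 0 := by omega
          subst this
          exact fl_ne _ heq.symm
        have dec : w = [w[0]] ++ ((w.drop 1).take (w.length - 2) ++ [fl w[0]]) := by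
          have a1 : w = [w[0]] ++ w.drop 1 := by
            conv_lhs => rw [← List.drop_zero (l := w), List.drop_eq_getElem_cons hw0]
            simp
          have a2 : w.drop 1 ≠ [] := by rw [← List.length_pos_iff]; simp; omega
          have a3 := take_last a2
          have a4 : (w.drop 1)[(w.drop 1).length - 1]'(by simp; omega) = fl w[0] := by
            rw [List.getElem_drop, ← heq]; congr 1; simp; omega
          rw [a4] at a3
          simp only [List.length_drop, Nat.sub_sub] at a3
          conv_lhs => rw [a1, a3]
        have hv := congrArg (evalWord (presGen R)) dec
        rw [evalWord_append, evalWord_append, evalWord_cons, evalWord_cons, ev_fl, evalWord_nil, he, hgn,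
          evalWord_nil, mul_one, mul_one] at hv
        have hv2 : evalWord (presGen R) ((w.drop 1).take (w.length-2)) = evalWord (presGen R) [] := by
          rw [evalWord_nil]
          have := congrArg (fun x => (ev (presGen R) w[0])⁻¹ * x * ev (presGen R) w[0]) hv
          simpa [mul_assoc] using this.symm
        have hi2 : (w.drop 1).take (w.length-2) <:+: w :=
          (List.take_prefix _ _).isInfix.trans (List.drop_suffix _ _).isInfix
        have := ih _ [] (by simp; omega) (red_infix hw hi2) (hov.infix hi2) Gd.nil hv2
        simp at this
        refine red_get hw (i := 0) (by omega) ?_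
        have a5 : w[0+1] = w[i] := by congr 1; omega
        rw [a5, heq, fl_fl]
      · rw [List.getElem_append_right (by omega), winv_get, fl_inj] at heq
        have tw : w = w[0] :: w.drop 1 := by
          conv_lhs => rw [← List.drop_zero (l := w), List.drop_eq_getElem_cons hw0]
        have tg : g = g[0] :: g.drop 1 := by
          conv_lhs => rw [← List.drop_zero (l := g), List.drop_eq_getElem_cons hg0]
        have e3 : w[0] = g[0] := by
          rw [← heq]; congr 1; omega
        have := ih (w.drop 1) (g.drop 1) (by simp; omega)
          (red_infix hw (List.drop_suffix _ _).isInfix) (hov.infix (List.drop_suffix _ _).isInfix)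
          (hg.infix (List.drop_suffix _ _).isInfix) (by
            rw [tw, tg, evalWord_cons, evalWord_cons, e3] at he
            exact mul_left_cancel he)
        simp at this; omega

lemma geo (hsc : SmallCancellation R (1/6)) {w : Word S} (hw : ReducedWord w) (hov : ov3 R w) : Gd (presGen R) w := by
  intro w' hw'
  obtain ⟨g, hg, h1⟩ := gd_exists (gen_pres (R := R)) (evalWord (presGen R) w)
  have h2 := geo_aux hsc _ w g le_rfl hw hov hg h1.symm
  have := hg w' (by rw [hw', h1])
  omega
end Geo
end MorseLTG

namespace MorseLTG
section Quad
variable {S : Type*} {G : Type*} [Group G] {σ : S → G} {R : Set (Word S)} {g : G} {W : Word S}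
  {D : Type} [Fintype D] [DecidableEq D] {m : PM σ R W g D}

lemma PM.arc_of (m : PM σ R W g D) {d x : D} (h : (m.Es d).Nonempty) (hx : x ∈ orb m.φ d) :
    ∃ s ∈ m.Es d, ∃ t < m.bb s, (m.φ ^ t) s = x := by
  classical
  obtain ⟨e, he⟩ := h
  obtain ⟨he1, he2⟩ := m.mem_Es.mp he
  have hex : ∃ k, m.ess ((m.φ ^ k)⁻¹ x) := by
    have hx' : e ∈ orb m.φ x := by rw [orb_eq _ hx]; exact he1
    have : x ∈ orb m.φ e := by rw [orb_eq _ he1]; exact hx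
    obtain ⟨k, _, hk⟩ := mem_orb_lt _ this
    exact ⟨k, by rw [← hk]; simpa using he2⟩
  have h1 := Nat.find_spec hex
  set k := Nat.find hex with hk
  refine ⟨(m.φ ^ k)⁻¹ x, m.mem_Es.mpr ⟨?_, h1⟩, k, ?_, by simp⟩
  · rw [← orb_eq _ hx]
    have := zpow_orb m.φ x (-(k:ℤ))
    simpa using this
  · by_contra hlt
    push Not at hlt
    obtain ⟨b1, b2, -⟩ := m.bb_spec h1
    have := Nat.find_min hex (m := k - m.bb ((m.φ ^ k)⁻¹ x)) (by omega)
    apply this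
    convert b2 using 1
    generalize m.bb ((m.φ ^ k)⁻¹ x) = b at *
    obtain ⟨c, hc⟩ := Nat.exists_eq_add_of_le hlt
    rw [hc, Nat.add_sub_cancel_left, pow_add, mul_inv_rev, Equiv.Perm.mul_apply]
    have : Commute (m.φ ^ b) (m.φ ^ c)⁻¹ := ((Commute.refl m.φ).pow_pow b c).inv_right
    rw [← Equiv.Perm.mul_apply (m.φ ^ b), this.eq, Equiv.Perm.mul_apply]
    simp

lemma PM.arc_chi (m : PM σ R W g D) {s : D} {j : ℕ} (h : ∀ i, 0 < i → i < j → ¬ m.ess ((m.φ ^ i) s)) {t : ℕ} (ht : t < j) :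
    m.chi ((m.φ ^ t) s) ↔ m.chi s := by
  induction t with
  | zero => simp
  | succ t ih =>
    rw [← ih (by omega), ← m.noness_chi (h (t+1) (by omega) ht), pow_succ', Equiv.Perm.mul_apply]
    simp

lemma PM.face_dist (m : PM σ R W g D) (hg : gen σ) {d x y : D} (hx : x ∈ orb m.φ d) (hy : y ∈ orb m.φ d) :
    2 * wordDist σ (m.pos x) (m.pos y) ≤ nn m.φ d := by
  have hy' : y ∈ orb m.φ x := by rwa [orb_eq _ hx]
  obtain ⟨k, hk, rfl⟩ := mem_orb_lt _ hy'
  rw [nn_eq _ hx] at hk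
  have h1 : wordDist σ (m.pos x) (m.pos ((m.φ ^ k) x)) ≤ k := by
    rw [m.pow_φ_pos]; simpa using wd_le (σ := σ) (m.pos x) (m.fw x k)
  have h2 : wordDist σ (m.pos ((m.φ ^ k) x)) (m.pos x) ≤ nn m.φ d - k := by
    have : (m.φ ^ (nn m.φ d - k)) ((m.φ ^ k) x) = x := by
      rw [← Equiv.Perm.mul_apply, ← pow_add, Nat.sub_add_cancel hk.le, ← nn_eq _ hx, pow_nn]
    have h3 := wd_le (σ := σ) (m.pos ((m.φ ^ k) x)) (m.fw ((m.φ ^ k) x) (nn m.φ d - k))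
    rw [← m.pow_φ_pos, this] at h3
    simpa using h3
  rw [wd_symm hg] at h2
  omega

structure QH (m : PM σ R W g D) (cs : Finset ℕ) (l n0 N A : ℕ) : Prop where
  hsc : SmallCancellation R (1/6)
  hg : gen σ
  one : ∀ r ∈ R, evalWord σ r = 1
  hW : W ≠ []
  Pmem : W.length ∈ cs
  lmem : l ∈ cs
  hcs : ∀ c ∈ cs, l ≤ c ∧ c ≤ W.length
  l1 : 1 ≤ l
  card : cs.card ≤ 4
  gd : ∀ i k, i + k ≤ W.length → (∀ c ∈ cs, i + k ≤ c ∨ c ≤ i) → Gd σ ((W.drop i).take k)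
  small : ∀ r ∈ symmClosure R, r.length < 2 * W.length
  ov : ∀ i k, i + k ≤ l → ∀ r ∈ symmClosure R, n0 ≤ r.length → (W.drop i).take k <:+: r → N * k ≤ r.length
  N7 : 7 ≤ N
  near : ∀ i ≤ l, ∀ j, l ≤ j → j ≤ W.length → wordDist σ (m.pos (m.o i)) (m.pos (m.o j)) ≤ n0 → i ≤ A ∨ l ≤ i + A

namespace QH
variable {cs : Finset ℕ} {l n0 N A : ℕ} (q : QH m cs l n0 N A)
include q

lemma lP : l ≤ W.length := (q.hcs l q.lmem).2

lemma arc {d : D} (hd : ¬ m.out d) {s : D} (hs : s ∈ m.Oc d) : ∃ i0 < W.length, m.bb s ≤ W.length ∧ 1 ≤ m.bb s ∧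
      (∀ t < m.bb s, m.μ (m.o (i0 + t)) = (m.φ ^ (m.bb s - 1 - t)) s) ∧
      (∀ t < m.bb s, m.μ (m.o (i0 + t)) ∈ orb m.φ d) ∧
      ∃ r ∈ symmClosure R, r.length = nn m.φ d ∧ ∀ a b, a + b ≤ m.bb s → m.fw (m.o (i0 + a)) b <:+: r := by
  obtain ⟨h1, h2⟩ := m.mem_Oc.mp hs
  obtain ⟨h3, h4⟩ := m.mem_Es.mp h1
  have h5 := m.bb_spec h4
  obtain ⟨h6, i0, hi0, h7, r, hr, hrl, h8⟩ := m.arc_sub q.hW (by rwa [m.out_orb h3]) h2 h5.1 h5.2.2 (fun i => m.bb_lt)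
  refine ⟨i0, hi0, h6, h5.1, h7, fun t ht => ?_, r, hr, by rw [hrl, nn_eq _ h3], h8⟩
  rw [h7 t ht, ← orb_eq _ h3]; exact pow_orb _ _ _

/-- a face is marked if it contains the partner of the last dart of a side -/
def mkd (m : PM σ R W g D) (cs : Finset ℕ) (d : D) : Prop := ∃ c ∈ cs, m.μ (m.o (c - 1)) ∈ orb m.φ d

lemma arc_side {d : D} (hk : ¬ mkd m cs d) {i0 b : ℕ} (hi : i0 < W.length)
    (h : ∀ t < b, m.μ (m.o (i0 + t)) ∈ orb m.φ d) : i0 + b ≤ W.length ∧ ∀ c ∈ cs, i0 + b ≤ c ∨ c ≤ i0 := by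
  have key : ∀ c ∈ cs, i0 + b ≤ c ∨ c ≤ i0 := by
    intro c hc
    by_contra hcon
    push Not at hcon
    refine hk ⟨c, hc, ?_⟩
    have := h (c - 1 - i0) (by omega)
    rwa [show i0 + (c - 1 - i0) = c - 1 by omega] at this
  refine ⟨?_, key⟩
  rcases key _ q.Pmem with h | h
  · exact h
  · omega

lemma half {d : D} (hd : ¬ m.out d) (hk : ¬ mkd m cs d) {s : D} (hs : s ∈ m.Oc d) : 2 * m.bb s ≤ nn m.φ d := by
  obtain ⟨i0, hi0, -, -, -, ht, r, hr, hrl, hz⟩ := q.arc hd hs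
  obtain ⟨h1, h2⟩ := q.arc_side hk hi0 ht
  have h3 := q.gd i0 (m.bb s) h1 h2
  have h4 := hz 0 (m.bb s) (by omega)
  rw [Nat.add_zero, m.o_word h1] at h4
  have := h3.half q.one hr h4
  rw [hrl] at this
  have hl : ((W.drop i0).take (m.bb s)).length = m.bb s := by simp; omega
  omega

lemma Es_ne {d : D} (hd : ¬ m.out d) (hk : ¬ mkd m cs d) : (m.Es d).Nonempty := by
  by_contra hE
  exact hk ⟨l, q.lmem, m.Es_empty q.hsc hd hE _⟩

lemma FW12 {d : D} (hd : ¬ m.out d) (hk : ¬ mkd m cs d) : 12 ≤ m.FW d ∧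
    (m.FW d = 12 → ((m.Oc d).card = 2 ∧ (m.Kc d).card ≤ 2) ∨ ((m.Oc d).card = 1 ∧ (m.Kc d).card = 4)) :=
  m.face_nonpos q.hsc hd (q.Es_ne hd hk) fun s hs => q.half hd hk hs

lemma posd {i j : ℕ} (hij : i ≤ j) (hj : j ≤ l) : wordDist σ (m.pos (m.o i)) (m.pos (m.o j)) = j - i := by
  have hP := q.lP
  have h1 := q.gd i (j - i) (by omega) (fun c hc => by have := q.hcs c hc; omega)
  have h2 := wd_gd q.hg (m.pos (m.o i)) h1
  rw [← m.o_word (by omega), ← m.pow_φ_pos, m.o_add, m.fw_length] at h2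
  rwa [show i + (j - i) = j by omega] at h2

lemma pos_succ (i : ℕ) : m.pos (m.μ (m.o i)) = m.pos (m.o (i+1)) := by
  rw [m.pos_μ, ← m.o_succ, m.pos_φ]

lemma inner {i : ℕ} (h1 : A < i) (h2 : i + 1 + A < l) : ¬ m.out (m.μ (m.o i)) := by
  intro hout
  obtain ⟨j, hj, he⟩ := m.out_lt q.hW hout
  have e1 : m.pos (m.o j) = m.pos (m.o (i+1)) := by rw [← he, q.pos_succ]
  rcases Nat.lt_or_ge j l with hjl | hjl
  · have e2 : j = i + 1 := by
      rcases Nat.le_total j (i+1) with h | h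
      · have := q.posd h (by omega)
        rw [e1, wd_self] at this; omega
      · have := q.posd h (by omega)
        rw [e1, wd_self] at this; omega
    have e3 : m.pos (m.o i) = m.pos (m.o (j+1)) := by
      rw [← q.pos_succ, ← he, m.μμ]
    have := q.posd (i := i) (j := j+1) (by omega) (by omega)
    rw [← e3, wd_self] at this; omega
  · have := q.near (i+1) (by omega) j hjl hj.le (by rw [e1, wd_self]; omega)
    omega

lemma arc_mid {d : D} (hd : ¬ m.out d) (hk : ¬ mkd m cs d) {i : ℕ} (hi : i < l) (hm : m.μ (m.o i) ∈ orb m.φ d) :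
    ∃ s ∈ m.Oc d, ∃ i0, i0 ≤ i ∧ i < i0 + m.bb s ∧ i0 + m.bb s ≤ l ∧
      (∀ t < m.bb s, m.μ (m.o (i0 + t)) = (m.φ ^ (m.bb s - 1 - t)) s) ∧ ∃ r ∈ symmClosure R, r.length = nn m.φ d ∧
        (W.drop i0).take (m.bb s) <:+: r := by
  have hP := q.lP
  obtain ⟨s, hs, t, ht, hst⟩ := m.arc_of (q.Es_ne hd hk) hm
  have hc : m.chi s := by
    rw [← m.arc_chi (fun i => m.bb_lt) ht, hst]; exact ⟨i, m.μμ _⟩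
  have hO : s ∈ m.Oc d := m.mem_Oc.mpr ⟨hs, hc⟩
  obtain ⟨i0, hi0, -, hb1, h7, h8, r, hr, hrl, hz⟩ := q.arc hd hO
  obtain ⟨h1, h2⟩ := q.arc_side hk hi0 h8
  have h9 := h7 (m.bb s - 1 - t) (by omega)
  rw [show m.bb s - 1 - (m.bb s - 1 - t) = t by omega, hst] at h9
  have h10 := m.o_inj _ _ (by omega) (by omega) (m.μ_inj h9)
  refine ⟨s, hO, i0, by omega, by omega, ?_, h7, r, hr, hrl, ?_⟩
  · rcases h2 l q.lmem with h | h <;> omega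
  · have := hz 0 (m.bb s) (by omega)
    rwa [Nat.add_zero, m.o_word h1] at this

lemma arc_disj {s1 s2 : D} (h1 : m.ess s1) (h2 : m.ess s2) {x y : ℕ} (hx : x < m.bb s1) (hy : y < m.bb s2)
    (h : (m.φ ^ x) s1 = (m.φ ^ y) s2) : s1 = s2 := by
  rcases Nat.le_total x y with hxy | hxy
  · obtain ⟨c, rfl⟩ := Nat.exists_eq_add_of_le hxy
    rw [pow_add, Equiv.Perm.mul_apply] at h
    have h3 := (m.φ ^ x).injective h
    rcases Nat.eq_zero_or_pos c with h0 | h0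
    · rw [h0] at h3; exact h3
    · exact absurd (h3 ▸ h1) (m.bb_lt h0 (by omega))
  · obtain ⟨c, rfl⟩ := Nat.exists_eq_add_of_le hxy
    rw [pow_add, Equiv.Perm.mul_apply] at h
    have h3 := (m.φ ^ y).injective h
    rcases Nat.eq_zero_or_pos c with h0 | h0
    · rw [h0] at h3; exact h3
    · exact absurd (h3 ▸ h2) (m.bb_lt h0 (by omega))

/-- a tight face meeting the middle is small and of type (1,4) -/
lemma tight {d : D} (hd : ¬ m.out d) (hk : ¬ mkd m cs d) (hF : m.FW d = 12) {i : ℕ} (h1 : A < i) (h2 : i + 1 + A < l)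
    (hm : m.μ (m.o i) ∈ orb m.φ d) : nn m.φ d < n0 ∧ (m.Oc d).card = 1 ∧ (m.Kc d).card = 4 := by
  have hP := q.lP
  obtain ⟨s, hs, i0, a1, a2, a3, a4, r, hr, hrl, hz⟩ := q.arc_mid hd hk (by omega) hm
  have hty := (q.FW12 hd hk).2 hF
  obtain ⟨c1, c2⟩ := m.cover' q.hsc hd (q.Es_ne hd hk)
  have hp := nn_pos m.φ d
  have hsE := (m.mem_Es.mp (m.mem_Oc.mp hs).1)
  have hsmall : nn m.φ d < n0 := by
    by_contra hcon
    push Not at hcon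
    have h7 := q.ov i0 (m.bb s) a3 r hr (by omega) hz
    rw [hrl] at h7
    have h8 : 7 * m.bb s ≤ nn m.φ d := le_trans (Nat.mul_le_mul_right _ q.N7) h7
    rw [← Finset.add_sum_erase _ _ hs] at c1
    have c3 : 2 * ∑ x ∈ (m.Oc d).erase s, m.bb x ≤ ((m.Oc d).card - 1) * nn m.φ d := by
      rw [← Finset.card_erase_of_mem hs, Finset.mul_sum, ← smul_eq_mul]
      exact Finset.sum_le_card_nsmul _ _ _ fun x hx => q.half hd hk (Finset.mem_of_mem_erase hx)
    rcases hty with ⟨t1, t2⟩ | ⟨t1, t2⟩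
    · rw [t1] at c3
      have := Nat.mul_le_mul_right (nn m.φ d) t2
      omega
    · rw [t1] at c3
      rw [t2] at c2
      omega
  refine ⟨hsmall, ?_⟩
  rcases hty with ⟨t1, t2⟩ | h
  swap
  · exact h
  exfalso
  have hc2 : ((m.Oc d).erase s).card = 1 := by rw [Finset.card_erase_of_mem hs, t1]
  obtain ⟨s2, hs2⟩ := Finset.card_eq_one.mp hc2
  have hs2m : s2 ∈ (m.Oc d).erase s := by rw [hs2]; simp
  obtain ⟨hne, hs2O⟩ := Finset.mem_erase.mp hs2m
  obtain ⟨j0, hj0, -, hb1, b4, b5, -⟩ := q.arc hd hs2O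
  obtain ⟨b1, b2⟩ := q.arc_side hk hj0 b5
  have hs2E := (m.mem_Es.mp (m.mem_Oc.mp hs2O).1)
  rcases b2 l q.lmem with hl | hl
  · rw [← Finset.add_sum_erase _ _ hs, hs2, Finset.sum_singleton] at c1
    have hsum : 4 * nn m.φ d ≤ 6 * (m.bb s + m.bb s2) := by
      have := Nat.mul_le_mul_right (nn m.φ d) t2
      omega
    have hdis : i0 + m.bb s ≤ j0 ∨ j0 + m.bb s2 ≤ i0 := by
      by_contra hcon
      push Not at hcon
      apply hne
      have hv : ∃ v, i0 ≤ v ∧ j0 ≤ v ∧ v < i0 + m.bb s ∧ v < j0 + m.bb s2 := ⟨max i0 j0, by omega, by omega, by omega, by omega⟩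
      obtain ⟨v, v1, v2, v3, v4⟩ := hv
      have w1 := a4 (v - i0) (by omega)
      have w2 := b4 (v - j0) (by omega)
      rw [show i0 + (v - i0) = v by omega] at w1
      rw [show j0 + (v - j0) = v by omega, w1] at w2
      exact (q.arc_disj hsE.2 hs2E.2 (by omega) (by omega) w2).symm
    -- the start of an arc is a vertex of the face, as is its end
    have hend : ∀ v, m.μ (m.o v) ∈ orb m.φ d → ∃ y ∈ orb m.φ d, m.pos y = m.pos (m.o v) := by
      intro v hv
      refine ⟨m.φ (m.μ (m.o v)), by rw [← orb_eq _ hv]; exact f_orb _ _, ?_⟩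
      rw [m.pos_φ, ← m.pos_μ, m.μμ]
    have hs1 : ∀ t < m.bb s, m.μ (m.o (i0 + t)) ∈ orb m.φ d := by
      intro t ht; rw [a4 t ht, ← orb_eq _ hsE.1]; exact pow_orb _ _ _
    rcases hdis with h | h
    · obtain ⟨y, hy, hy2⟩ := hend i0 (by simpa using hs1 0 (by omega))
      have hx := b5 (m.bb s2 - 1) (by omega)
      have := m.face_dist q.hg hy hx
      rw [hy2, q.pos_succ, q.posd (by omega) (by omega)] at this
      omega
    · obtain ⟨y, hy, hy2⟩ := hend j0 (by simpa using b5 0 (by omega))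
      have hx := hs1 (m.bb s - 1) (by omega)
      have := m.face_dist q.hg hy hx
      rw [hy2, q.pos_succ, q.posd (by omega) (by omega)] at this
      omega
  · have hx := b5 0 (by omega)
    rw [show j0 + 0 = j0 from rfl] at hx
    have := m.face_dist q.hg hm hx
    rw [q.pos_succ, q.pos_succ] at this
    have := q.near (i+1) (by omega) (j0+1) (by omega) (by omega) (by omega)
    omega
end QH
end Quad
end MorseLTG

namespace MorseLTG
section Quad
variable {S : Type*} {G : Type*} [Group G] {σ : S → G} {R : Set (Word S)} {g : G} {W : Word S}
  {D : Type} [Fintype D] [DecidableEq D] {m : PM σ R W g D}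
namespace QH
variable {cs : Finset ℕ} {l n0 N A : ℕ}

def T (m : PM σ R W g D) (cs : Finset ℕ) (d : D) : Prop := ¬ m.out d ∧ ¬ mkd m cs d ∧ m.FW d = 12

lemma T_orb {d x : D} (h : x ∈ orb m.φ d) : T m cs x ↔ T m cs d := by
  rw [T, T, m.out_orb h, mkd, mkd, PM.FW, PM.FW, orb_eq _ h]

lemma ψμ (i : ℕ) : m.ψ (m.μ (m.o i)) = m.o (i+1) := by rw [m.ψ_apply, m.μμ, m.o_succ]
lemma ψo (i : ℕ) : m.ψ (m.o i) = m.φ (m.μ (m.o i)) := rfl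
lemma essμ (i : ℕ) : m.ess (m.μ (m.o i)) ↔ m.ess (m.o (i+1)) := by
  rw [← ψμ, m.ess_orb (f_orb _ _)]
lemma essφ (i : ℕ) : m.ess (m.φ (m.μ (m.o i))) ↔ m.ess (m.o i) := by
  rw [← ψo, m.ess_orb (f_orb _ _)]
lemma noness_next {i : ℕ} (h : ¬ m.ess (m.o (i+1))) : m.φ (m.μ (m.o (i+1))) = m.μ (m.o i) := by
  rw [← essμ, PM.ess, not_not, ψμ, ψo] at h
  exact h

lemma run_pow {a b : ℕ} (hab : a < b) (h : ∀ t, a < t → t < b → ¬ m.ess (m.o t)) {k : ℕ} (hk : k < b - a) :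
    (m.φ ^ k) (m.μ (m.o (b-1))) = m.μ (m.o (b - 1 - k)) := by
  induction k with
  | zero => rfl
  | succ k ih =>
    rw [pow_succ', Equiv.Perm.mul_apply, ih (by omega)]
    have := h (b - 1 - k) (by omega) (by omega)
    rw [show b - 1 - k = (b - 1 - (k+1)) + 1 by omega] at this
    have h2 := noness_next this
    rw [← h2, show b - 1 - k = (b - 1 - (k+1)) + 1 by omega]

lemma run_ness {a b : ℕ} (hab : a < b) (h : ∀ t, a < t → t < b → ¬ m.ess (m.o t)) {k : ℕ} (h0 : 0 < k) (hk : k < b - a) :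
    ¬ m.ess ((m.φ ^ k) (m.μ (m.o (b-1)))) := by
  rw [run_pow hab h hk, essμ]
  exact h _ (by omega) (by omega)

variable (q : QH m cs l n0 N A)
include q

lemma run {a b : ℕ} (hab : a < b) (hb : b ≤ l) (h : ∀ t, a < t → t < b → ¬ m.ess (m.o t))
    (hs : ¬ m.out (m.μ (m.o (b-1)))) : b - a ≤ nn m.φ (m.μ (m.o (b-1))) ∧
    (n0 ≤ nn m.φ (m.μ (m.o (b-1))) → N * (b - a) ≤ nn m.φ (m.μ (m.o (b-1)))) ∧ nn m.φ (m.μ (m.o (b-1))) < 2 * W.length := by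
  have hP := q.lP
  set s := m.μ (m.o (b-1)) with hsd
  have hp := nn_pos m.φ s
  have h1 : b - a ≤ nn m.φ s := by
    by_contra hcon
    have h2 := run_pow hab h (k := nn m.φ s) (by rw [← hsd] at *; omega)
    rw [← hsd, pow_nn, hsd] at h2
    have := m.o_inj _ _ (by omega) (by omega) (m.μ_inj h2)
    rw [← hsd] at this
    omega
  obtain ⟨-, i0, hi0, h7, r, hr, hrl, h8⟩ := m.arc_sub q.hW hs (⟨b-1, m.μμ _⟩ : m.chi s) (j := b - a) (by omega) h1
    (fun i => run_ness hab h)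
  have h9 := h7 0 (by omega)
  rw [Nat.add_zero, hsd, run_pow hab h (by omega)] at h9
  have h10 := m.o_inj _ _ (by omega) (by omega) (m.μ_inj h9)
  have h11 : i0 = a := by omega
  refine ⟨h1, fun hn => ?_, ?_⟩
  · have := h8 0 (b-a) (by omega)
    rw [Nat.add_zero, h11, m.o_word (by omega)] at this
    have := q.ov a (b-a) (by omega) r hr (by omega) this
    omega
  · have := q.small r hr; omega

/-- the corner at an essential vertex on the left end of a tight face -/
lemma corner {i : ℕ} (h1 : A < i) (h2 : i + 2 + A < l) (hT : T m cs (m.μ (m.o (i+1)))) (he : m.ess (m.o (i+1))) :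
    m.φ (m.μ (m.o (i+1))) ∈ m.Kc (m.μ (m.o (i+1))) ∧
    ∃ f ∈ m.Kc (m.μ (m.o i)), (m.φ ^ (m.bb f)) f = m.μ (m.o i) ∧
      m.pos f = m.pos ((m.φ ^ (m.bb (m.φ (m.μ (m.o (i+1)))))) (m.φ (m.μ (m.o (i+1))))) := by
  classical
  set d' := m.μ (m.o (i+1)) with hd'
  set d := m.μ (m.o i) with hd
  set e := m.φ d' with hed
  obtain ⟨T1, T2, T3⟩ := hT
  obtain ⟨t1, t2, t3⟩ := q.tight T1 T2 T3 (i := i+1) (by omega) (by omega) (self_orb _ _)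
  have hee : m.ess e := by rw [hed, hd', essφ]; exact he
  have heE : e ∈ m.Es d' := m.mem_Es.mpr ⟨f_orb _ _, hee⟩
  have hchi : ¬ m.chi e := by
    intro hc
    obtain ⟨s, hs, i0, a1, a2, a3, a4, -⟩ := q.arc_mid T1 T2 (i := i+1) (by omega) (self_orb _ _)
    have hO : e ∈ m.Oc d' := m.mem_Oc.mpr ⟨heE, hc⟩
    obtain ⟨x, hx⟩ := Finset.card_eq_one.mp t2
    have hse : s = e := by
      rw [hx, Finset.mem_singleton] at hs hO; rw [hs, hO]
    have a5 := a4 (i + 1 - i0) (by omega)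
    rw [show i0 + (i + 1 - i0) = i + 1 by omega, ← hd', hse] at a5
    rw [hse] at a2 a3
    set k := m.bb e - 1 - (i + 1 - i0) with hk
    have a6 : (m.φ ^ (k+1)) e = e := by
      rw [pow_succ', Equiv.Perm.mul_apply, ← a5]
    have a7 := Nat.le_of_dvd (by omega) (nn_dvd _ a6)
    have a8 := q.half T1 T2 hO
    have a9 : nn m.φ e = nn m.φ d' := nn_eq _ (f_orb _ _)
    have := nn_pos m.φ d'
    omega
  have hK : e ∈ m.Kc d' := m.mem_Kc.mpr ⟨heE, hchi⟩
  refine ⟨hK, ?_⟩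
  have horb : e ∈ orb m.ψ d := by
    have : m.ψ (m.ψ d) = e := by rw [hd, ψμ, ψo]
    rw [← this]; have h5 := pow_orb m.ψ d 2; rwa [pow_two, Equiv.Perm.mul_apply] at h5
  have hodb : m.o (i+1) ∈ orb m.ψ d := by rw [← ψμ]; exact f_orb _ _
  have hn3 : nn m.ψ e = 3 := by
    have hw := m.FW_eq (d := d') (by rw [T3, t2, t3]) heE
    have hc1 : m.chi (m.φ⁻¹ e) := by
      have : m.φ⁻¹ e = d' := by simp [hed]
      rw [this]; exact ⟨i+1, m.μμ _⟩
    have hov : 1 ≤ m.ov e := by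
      rw [m.ov_orb horb]
      refine Finset.card_pos.mpr ⟨m.o (i+1), Finset.mem_filter.mpr ⟨hodb, ⟨_, rfl⟩⟩⟩
    simp only [PM.ind, hc1, hchi, if_true, if_false, PM.wt, hee] at hw
    split_ifs at hw <;> omega
  have hψe : m.ψ e = d := by
    have h3 : nn m.ψ d = 3 := by rw [← nn_eq _ horb, hn3]
    have := pow_nn m.ψ d
    rw [h3, pow_succ', Equiv.Perm.mul_apply, pow_succ', Equiv.Perm.mul_apply, pow_one] at this
    rw [← this, hd, ψμ, ψo]
  obtain ⟨b1, b2, b3⟩ := m.bb_spec hee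
  set b := m.bb e with hb
  have hfp : ∀ t < b, (m.φ ^ t) (m.μ ((m.φ ^ (b-1)) e)) = m.μ ((m.φ ^ (b - 1 - t)) e) := by
    intro t ht
    have e1 := m.flip_pow (d := e) (j := b) (fun i => m.bb_lt) (i := b - 1) (by omega)
    have e2 := m.flip_pow (d := e) (j := b) (fun i => m.bb_lt) (i := b - 1 - t) (by omega)
    rw [← e2] at e1
    have e3 : (m.φ ^ (b-1)) = (m.φ ^ (b-1-t)) * (m.φ ^ t) := by rw [← pow_add]; congr 1; omega
    conv_lhs at e1 => rw [e3]
    rw [Equiv.Perm.mul_apply] at e1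
    have e4 := (m.φ ^ (b-1-t)).injective e1
    rw [← e4, e3]
  set f := m.μ ((m.φ ^ (b-1)) e) with hf
  have hfd : (m.φ ^ b) f = d := by
    have := hfp (b-1) (by omega)
    rw [Nat.sub_self, pow_zero, Equiv.Perm.one_apply] at this
    rw [show b = (b-1)+1 by omega, pow_succ', Equiv.Perm.mul_apply, this, ← m.ψ_apply, hψe]
  have hψf : m.ψ f = (m.φ ^ b) e := by
    rw [m.ψ_apply, hf, m.μμ, ← Equiv.Perm.mul_apply, ← pow_succ', Nat.sub_add_cancel b1]
  have hfess : m.ess f := by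
    rw [← m.ess_orb (f_orb m.ψ f), hψf]; exact b2
  have hdess : m.ess d := by rw [hd, essμ]; exact he
  have hbf : m.bb f = b := by
    obtain ⟨c1, c2, c3⟩ := m.bb_spec' (s := f) b b1 (by rw [hfd]; exact hdess)
    refine le_antisymm c3 ?_
    by_contra hcon
    push Not at hcon
    rw [hfp _ hcon, ← m.ess_orb (f_orb m.ψ _), m.ψ_apply, m.μμ, ← Equiv.Perm.mul_apply, ← pow_succ'] at c2
    exact m.bb_lt (s := e) (by omega) (by omega) c2
  refine ⟨f, m.mem_Kc.mpr ⟨m.mem_Es.mpr ⟨?_, hfess⟩, ?_⟩, by rw [hbf, hfd], ?_⟩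
  · rw [← hfd, orb_eq _ (pow_orb _ _ _)]; exact self_orb _ _
  · rw [PM.chi, hf, m.μμ, m.out_orb (pow_orb _ _ _), m.out_orb (f_orb _ _)]; exact T1
  · rw [← m.pos_ψ, hψf]

end QH
end Quad
end MorseLTG

namespace MorseLTG
section Quad
variable {S : Type*} {G : Type*} [Group G] {σ : S → G} {R : Set (Word S)} {g : G} {W : Word S}
  {D : Type} [Fintype D] [DecidableEq D] {m : PM σ R W g D}
namespace QH
variable {cs : Finset ℕ} {l n0 N A : ℕ}

noncomputable def top (m : PM σ R W g D) (i : ℕ) : G := m.pos ((m.φ ^ (m.bb (m.φ (m.μ (m.o i))))) (m.φ (m.μ (m.o i))))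

variable (q : QH m cs l n0 N A)
include q

lemma tT {i : ℕ} (h1 : A < i) (h2 : i + 1 + A < l) (hT : T m cs (m.μ (m.o i))) :
    nn m.φ (m.μ (m.o i)) < n0 ∧ (m.Oc (m.μ (m.o i))).card = 1 ∧ (m.Kc (m.μ (m.o i))).card = 4 :=
  q.tight hT.1 hT.2.1 hT.2.2 h1 h2 (self_orb _ _)

lemma top_dist {i : ℕ} (h1 : A < i) (h2 : i + 1 + A < l) (hT : T m cs (m.μ (m.o i))) :
    2 * wordDist σ (m.pos (m.o i)) (top m i) ≤ n0 := by
  have h3 := q.tT h1 h2 hT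
  have h4 : m.pos (m.o i) = m.pos (m.φ (m.μ (m.o i))) := by rw [← ψo, m.pos_ψ]
  rw [h4, top]
  have := m.face_dist q.hg (d := m.μ (m.o i)) (f_orb _ _)
    (y := ((m.φ ^ (m.bb (m.φ (m.μ (m.o i))))) (m.φ (m.μ (m.o i))))) (by rw [← orb_eq _ (f_orb m.φ (m.μ (m.o i)))]; exact pow_orb _ _ _)
  omega

lemma step {a b : ℕ} (h1 : A + 1 < a) (hab : a < b) (h2 : b + 1 + A < l) (ha : m.ess (m.o a)) (hb : m.ess (m.o b))
    (h : ∀ t, a < t → t < b → ¬ m.ess (m.o t)) (hTa : T m cs (m.μ (m.o a))) (hTb : T m cs (m.μ (m.o b))) :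
    wordDist σ (top m a) (top m b) + 1 ≤ b - a := by
  classical
  set s := m.μ (m.o (b-1)) with hs
  have hra : (m.φ ^ (b - 1 - a)) s = m.μ (m.o a) := by
    rw [hs, run_pow hab h (by omega)]; congr 2; omega
  have haO : m.μ (m.o a) ∈ orb m.φ s := by rw [← hra]; exact pow_orb _ _ _
  obtain ⟨T1, T2, T3⟩ := (T_orb haO).mp hTa
  obtain ⟨t1, t2, t3⟩ := q.tight T1 T2 T3 (i := b-1) (by omega) (by omega) (self_orb _ _)
  obtain ⟨ca, -⟩ := q.corner (i := a - 1) (by omega) (by omega) (by rwa [Nat.sub_add_cancel (by omega)])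
    (by rwa [Nat.sub_add_cancel (by omega)])
  rw [Nat.sub_add_cancel (by omega)] at ca
  obtain ⟨-, f, hf, hfs, hft⟩ := q.corner (i := b - 1) (by omega) (by omega) (by rwa [Nat.sub_add_cancel (by omega)])
    (by rwa [Nat.sub_add_cancel (by omega)])
  rw [Nat.sub_add_cancel (by omega)] at hft
  rw [← hs] at hf hfs
  rw [PM.Kc, PM.Es, orb_eq _ haO, ← PM.Es, ← PM.Kc] at ca
  set e := m.φ (m.μ (m.o a)) with he
  have hes : e = (m.φ ^ (b - a)) s := by
    rw [he, ← hra, ← Equiv.Perm.mul_apply, ← pow_succ']; congr 2; omega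
  have hss : m.ess s := by rw [hs, essμ, Nat.sub_add_cancel (by omega)]; exact hb
  have hsO : s ∈ m.Oc s := m.mem_Oc.mpr ⟨m.mem_Es.mpr ⟨self_orb _ _, hss⟩, ⟨b-1, m.μμ _⟩⟩
  have hee := (m.mem_Es.mp (m.mem_Kc.mp ca).1).2
  have hfe := (m.mem_Es.mp (m.mem_Kc.mp hf).1).2
  have hbs : m.bb s = b - a := by
    obtain ⟨c1, c2, c3⟩ := m.bb_spec' (s := s) (b - a) (by omega) (by rw [← hes]; exact hee)
    refine le_antisymm c3 ?_
    by_contra hcon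
    exact run_ness hab h (by omega) (by omega) c2
  have hh := q.half T1 T2 hsO
  have ke := m.bb_inner q.hsc T1 ca
  have kf := m.bb_inner q.hsc T1 hf
  set n := nn m.φ s with hn
  have hfo : f ∈ orb m.φ s := (m.mem_Es.mp (m.mem_Kc.mp hf).1).1
  obtain ⟨p, hp, hpf⟩ := mem_orb_lt _ hfo
  have hpn : p + m.bb f = n := by
    have : (m.φ ^ (m.bb f + p)) s = s := by rw [pow_add, Equiv.Perm.mul_apply, hpf, hfs]
    obtain ⟨k, hk⟩ := nn_dvd _ this
    rw [← hn] at hk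
    have hb1 := (m.bb_spec hfe).1
    have : k = 1 := by
      have : k < 2 := by by_contra h; have : n * 2 ≤ n * k := Nat.mul_le_mul_left _ (by omega); omega
      have : k ≠ 0 := by rintro rfl; omega
      omega
    subst this; omega
  have hp1 : b - a ≤ p := by
    by_contra hcon
    refine m.bb_lt (s := s) (i := p) ?_ (by omega) (by rw [hpf]; exact hfe)
    omega
  have hp2 : b - a + m.bb e ≤ p := by
    by_contra hcon
    refine m.bb_lt (s := e) (i := p - (b - a)) (by omega) (by omega) ?_
    rw [hes, ← Equiv.Perm.mul_apply, ← pow_add, Nat.sub_add_cancel hp1, hpf]; exact hfe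
  have hef : e ≠ f := by
    intro hef
    rw [hes, ← hpf] at hef
    have := pow_inj _ (by omega) (by omega) hef
    omega
  obtain ⟨v1, v2⟩ := m.cover' q.hsc T1 ⟨s, (m.mem_Oc.mp hsO).1⟩
  obtain ⟨x, hx⟩ := Finset.card_eq_one.mp t2
  have hxs : s = x := by rwa [hx, Finset.mem_singleton] at hsO
  rw [hx, Finset.sum_singleton, ← hxs, hbs, ← hn] at v1
  rw [t3, ← hn] at v2
  have v3 := Finset.add_sum_erase _ m.bb ca
  have hf' : f ∈ (m.Kc s).erase e := Finset.mem_erase.mpr ⟨hef.symm, hf⟩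
  have v4 := Finset.add_sum_erase _ m.bb hf'
  have v5 : 6 * ∑ z ∈ ((m.Kc s).erase e).erase f, m.bb z + 2 ≤ 2 * n := by
    have : (((m.Kc s).erase e).erase f).card = 2 := by
      rw [Finset.card_erase_of_mem hf', Finset.card_erase_of_mem ca, t3]
    have h5 := Finset.sum_le_sum (s := ((m.Kc s).erase e).erase f) (f := fun z => 6 * m.bb z + 1) (g := fun _ => n)
      fun z hz => m.bb_inner q.hsc T1 (Finset.mem_of_mem_erase (Finset.mem_of_mem_erase hz))
    simpa [Finset.sum_add_distrib, this, ← Finset.mul_sum] using h5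
  have hd : wordDist σ (top m a) (top m b) ≤ p - (b - a) - m.bb e := by
    rw [top, top, ← hft, ← hpf]
    have : (m.φ ^ p) s = (m.φ ^ (p - (b - a) - m.bb e)) ((m.φ ^ m.bb e) e) := by
      rw [hes, ← Equiv.Perm.mul_apply, ← Equiv.Perm.mul_apply, ← pow_add, ← pow_add]
      rw [← hes]; congr 2; omega
    rw [this, m.pow_φ_pos (((m.φ ^ m.bb e) e))]
    simpa using wd_le (σ := σ) (m.pos ((m.φ ^ m.bb e) e)) (m.fw ((m.φ ^ m.bb e) e) (p - (b - a) - m.bb e))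
  omega

lemma lastess {a c : ℕ} (hac : a < c) (ha : m.ess (m.o a)) : ∃ b, a ≤ b ∧ b < c ∧ m.ess (m.o b) ∧ ∀ t, b < t → t < c → ¬ m.ess (m.o t) := by
  classical
  have h0 : ((Finset.Ico a c).filter (fun t => m.ess (m.o t))).Nonempty := ⟨a, by simp [hac, ha]⟩
  have h1 := Finset.max'_mem _ h0
  simp only [Finset.mem_filter, Finset.mem_Ico] at h1
  refine ⟨_, h1.1.1, h1.1.2, h1.2, fun t ht htc he => ?_⟩
  have := Finset.le_max' ((Finset.Ico a c).filter (fun t => m.ess (m.o t))) t (by simp only [Finset.mem_filter, Finset.mem_Ico]; exact ⟨⟨by omega, htc⟩, he⟩)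
  omega

lemma row {a : ℕ} (h1 : A + 1 < a) (ha : m.ess (m.o a)) : ∀ c, a ≤ c → c + 1 + A < l → m.ess (m.o c) →
    (∀ i, a ≤ i → i ≤ c → T m cs (m.μ (m.o i))) → n0 * wordDist σ (top m a) (top m c) + (c - a) ≤ n0 * (c - a) := by
  intro c
  induction c using Nat.strong_induction_on with
  | _ c ih =>
  intro hac hc hce hT
  rcases hac.eq_or_lt with rfl | hac
  · simp [wd_self]
  obtain ⟨b, b1, b2, b3, b4⟩ := q.lastess hac ha
  have h2 := ih b b2 b1 (by omega) b3 fun i h3 h4 => hT i h3 (by omega)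
  have h3 := q.step (by omega) b2 hc b3 hce b4 (hT b b1 b2.le) (hT c hac.le le_rfl)
  have h4 := (q.tT (i := c - 1) (by omega) (by omega) (hT _ (by omega) (by omega))).1
  have h5 := (q.run b2 (by omega) b4 (hT _ (by omega) (by omega)).1).1
  have h6 := wd_tri q.hg (top m a) (top m b) (top m c)
  have h7 : c - b ≤ n0 := by omega
  have h8 : n0 * (wordDist σ (top m a) (top m c) + 1) ≤ n0 * (wordDist σ (top m a) (top m b) + (c - b)) :=
    Nat.mul_le_mul_left _ (by omega)
  have h9 : n0 * (c - a) = n0 * (b - a) + n0 * (c - b) := by rw [← mul_add]; congr 1; omega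
  rw [mul_add, mul_add, mul_one] at h8
  omega

/-- an all-tight stretch between essential vertices is short -/
lemma row_le {a c : ℕ} (h1 : A + 1 < a) (hac : a ≤ c) (hc : c + 1 + A < l) (ha : m.ess (m.o a)) (hce : m.ess (m.o c))
    (hT : ∀ i, a ≤ i → i ≤ c → T m cs (m.μ (m.o i))) : c - a ≤ n0 * n0 := by
  have h2 := q.row h1 ha c hac hc hce hT
  have h3 := q.top_dist (by omega) (by omega) (hT a le_rfl hac)
  have h4 := q.top_dist (by omega) (by omega) (hT c hac le_rfl)
  have h5 := q.posd hac (by omega)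
  have h6 := wd_tri q.hg (m.pos (m.o a)) (top m a) (m.pos (m.o c))
  have h7 := wd_tri q.hg (top m a) (top m c) (m.pos (m.o c))
  rw [wd_symm q.hg (top m c) (m.pos (m.o c))] at h7
  have h8 : n0 * (c - a) ≤ n0 * (n0 + wordDist σ (top m a) (top m c)) := Nat.mul_le_mul_left _ (by omega)
  rw [mul_add] at h8
  omega

end QH
end Quad
end MorseLTG

namespace MorseLTG

/-- cutting an interval at few places -/
lemma cut_interval (C : ℕ → Prop) (B : ℕ) {x : ℕ} [DecidablePred C] : ∀ y, x ≤ y →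
    (∀ a b, x ≤ a → a ≤ b → b ≤ y → (∀ i, a ≤ i → i < b → ¬ C i) → b - a ≤ B) →
    y - x ≤ B + (B + 1) * ((Finset.Ico x y).filter C).card := by
  intro y
  induction y using Nat.strong_induction_on with
  | _ y ih =>
  intro hxy h
  by_cases hc : ((Finset.Ico x y).filter C).Nonempty
  · have h1 := Finset.max'_mem _ hc
    set c := ((Finset.Ico x y).filter C).max' hc with hcd
    simp only [Finset.mem_filter, Finset.mem_Ico] at h1
    have h2 := ih c h1.1.2 h1.1.1 fun a b h2 h3 h4 => h a b h2 h3 (by omega)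
    have h3 := h (c+1) y (by omega) (by omega) le_rfl fun i h3 h4 h5 => by
      have := Finset.le_max' ((Finset.Ico x y).filter C) i (by simp only [Finset.mem_filter, Finset.mem_Ico]; exact ⟨⟨by omega, h4⟩, h5⟩)
      omega
    have h4 : ((Finset.Ico x c).filter C).card + 1 ≤ ((Finset.Ico x y).filter C).card := by
      rw [← Finset.card_insert_of_notMem (a := c) (by simp)]
      refine Finset.card_le_card fun i hi => ?_
      simp only [Finset.mem_insert, Finset.mem_filter, Finset.mem_Ico] at hi ⊢
      rcases hi with rfl | hi
      · exact h1
      · exact ⟨⟨hi.1.1, by omega⟩, hi.2⟩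
    have h5 := Nat.mul_le_mul_left (B+1) h4
    rw [mul_add, mul_one] at h5
    omega
  · have := h x y le_rfl hxy le_rfl fun i h1 h2 h3 => hc ⟨i, by simp [h1, h2, h3]⟩
    omega

section Quad
variable {S : Type*} {G : Type*} [Group G] {σ : S → G} {R : Set (Word S)} {g : G} {W : Word S}
  {D : Type} [Fintype D] [DecidableEq D] {m : PM σ R W g D}
namespace QH
variable {cs : Finset ℕ} {l n0 N A : ℕ}

def cut (m : PM σ R W g D) (cs : Finset ℕ) (i : ℕ) : Prop := ¬ T m cs (m.μ (m.o i)) ∧ (m.ess (m.o i) ∨ m.ess (m.o (i+1)))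

variable (q : QH m cs l n0 N A)
include q

lemma spurs [DecidablePred fun d => m.ψ d = d] : (Finset.univ.filter (fun d => m.ψ d = d)).card ≤ 4 := by
  refine (Finset.card_le_card ?_).trans ((Finset.card_image_le (f := m.o) (s := cs)).trans q.card)
  intro d hd
  obtain ⟨i, hi, h1, h2⟩ := m.spur_out q.hsc.1 q.hW (Finset.mem_filter.mp hd).2
  refine Finset.mem_image.mpr ⟨i+1, ?_, h1.symm⟩
  by_contra hc
  have hiW : i + 1 < W.length := by
    have := q.Pmem
    rcases Nat.lt_or_ge (i+1) W.length with h | h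
    · exact h
    · rw [show W.length = i + 1 by omega] at this; exact absurd this hc
  have h3 := q.gd i 2 (by omega) fun c hc' => by
    have : c ≠ i + 1 := fun h => hc (h ▸ hc')
    omega
  have h4 := red_get h3.red (i := 0) (by simp; omega)
  have h5 := m.spur_lab hi (by rw [← h1]; exact h2)
  simp only [Nat.mod_eq_of_lt hiW] at h5
  apply h4
  simpa using h5

lemma ess_count [DecidablePred fun d => ¬ m.out d ∧ m.ess d ∧ ¬ T m cs d] :
    (Finset.univ.filter (fun d => ¬ m.out d ∧ m.ess d ∧ ¬ T m cs d)).card ≤ 390 := by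
  classical
  set E := Finset.univ.filter (fun d => ¬ m.out d ∧ m.ess d ∧ ¬ T m cs d) with hE
  have h1 : E.card ≤ ∑ F ∈ m.faces, (F.filter (· ∈ E)).card := by
    refine (Finset.card_le_card ?_).trans Finset.card_biUnion_le
    intro d hd
    have := (Finset.mem_filter.mp hd).2
    refine Finset.mem_biUnion.mpr ⟨orb m.φ d, Finset.mem_image.mpr ⟨d, by simpa using this.1, rfl⟩, ?_⟩
    exact Finset.mem_filter.mpr ⟨self_orb _ _, hd⟩
  have h2 := m.curv
  have h3 : ((Finset.univ.filter (fun d => m.ψ d = d)).card : ℤ) ≤ 4 := by exact_mod_cast q.spurs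
  have h4 : ∀ F ∈ m.faces, (2 * (F.filter (· ∈ E)).card : ℤ) ≤ -13 * (12 - ∑ x ∈ F, (m.wt x : ℤ)) +
      156 * (if F ∈ cs.image (fun c => orb m.φ (m.μ (m.o (c-1)))) then 1 else 0) := by
    intro F hF
    obtain ⟨d, hd, rfl⟩ := Finset.mem_image.mp hF
    have hd : ¬ m.out d := by simpa using hd
    rw [m.FW_eq_sum]
    have e1 : 2 * ((orb m.φ d).filter (· ∈ E)).card ≤ m.FW d := by
      have a1 := m.FW_ge d
      have a2 := m.card_Es d
      have : ((orb m.φ d).filter (· ∈ E)).card ≤ (m.Es d).card := Finset.card_le_card fun x hx => by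
        have := Finset.mem_filter.mp hx
        exact m.mem_Es.mpr ⟨this.1, (Finset.mem_filter.mp this.2).2.2.1⟩
      omega
    by_cases hk : mkd m cs d
    · obtain ⟨c, hc, hcd⟩ := hk
      rw [if_pos (Finset.mem_image.mpr ⟨c, hc, orb_eq m.φ hcd⟩)]
      omega
    · have h12 := (q.FW12 hd hk).1
      have : (0:ℤ) ≤ 156 * (if orb m.φ d ∈ cs.image (fun c => orb m.φ (m.μ (m.o (c-1)))) then 1 else 0) := by
        split_ifs <;> norm_num
      rcases h12.eq_or_lt with h | h
      · have : ((orb m.φ d).filter (· ∈ E)) = ∅ := by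
          refine Finset.filter_eq_empty_iff.mpr fun x hx hxE => ?_
          exact (Finset.mem_filter.mp hxE).2.2.2 ((T_orb hx).mpr ⟨hd, hk, h.symm⟩)
        rw [this, Finset.card_empty]
        omega
      · omega
  have h5 := Finset.sum_le_sum h4
  rw [Finset.sum_add_distrib, ← Finset.mul_sum, ← Finset.mul_sum, ← Finset.mul_sum, Finset.sum_boole] at h5
  have h6 : ((m.faces.filter (· ∈ cs.image (fun c => orb m.φ (m.μ (m.o (c-1)))))).card : ℤ) ≤ 4 := by
    have : (m.faces.filter (· ∈ cs.image (fun c => orb m.φ (m.μ (m.o (c-1)))))).card ≤ 4 :=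
      (Finset.card_le_card fun x hx => (Finset.mem_filter.mp hx).2).trans (Finset.card_image_le.trans q.card)
    exact_mod_cast this
  zify at h1 ⊢
  omega

lemma cut_count [DecidablePred (cut m cs)] {x y : ℕ} (hx : A < x) (hy : y + A < l) :
    ((Finset.Ico x y).filter (cut m cs)).card ≤ 780 := by
  classical
  set E := Finset.univ.filter (fun d => ¬ m.out d ∧ m.ess d ∧ ¬ T m cs d) with hE
  have hEc : E.card ≤ 390 := q.ess_count
  have hinj : ∀ f : D → D, Function.Injective f → ((Finset.Ico x y).filter (fun i => f (m.μ (m.o i)) ∈ E)).card ≤ 390 := by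
    intro f hf
    refine (Finset.card_le_card_of_injOn (fun i => f (m.μ (m.o i))) (fun i hi => (Finset.mem_filter.mp hi).2) ?_).trans hEc
    intro i hi j hj hij
    have hi := (Finset.mem_filter.mp hi).1
    have hj := (Finset.mem_filter.mp hj).1
    rw [Finset.mem_Ico] at hi hj
    have := q.lP
    exact m.o_inj _ _ (by omega) (by omega) (m.μ_inj (hf hij))
  have h1 := hinj id Function.injective_id
  have h2 := hinj m.φ m.φ.injective
  have : (Finset.Ico x y).filter (cut m cs) ⊆ (Finset.Ico x y).filter (fun i => id (m.μ (m.o i)) ∈ E) ∪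
      (Finset.Ico x y).filter (fun i => m.φ (m.μ (m.o i)) ∈ E) := by
    intro i hi
    obtain ⟨hi, hT, he⟩ := Finset.mem_filter.mp hi
    have hi' := Finset.mem_Ico.mp hi
    have ho := q.inner (i := i) (by omega) (by omega)
    rcases he with he | he
    · refine Finset.mem_union_right _ (Finset.mem_filter.mpr ⟨hi, Finset.mem_filter.mpr ⟨Finset.mem_univ _, ?_, ?_, ?_⟩⟩)
      · rwa [m.out_orb (f_orb _ _)]
      · rwa [essφ]
      · rwa [T_orb (f_orb _ _)]
    · exact Finset.mem_union_left _ (Finset.mem_filter.mpr ⟨hi, Finset.mem_filter.mpr ⟨Finset.mem_univ _, ho, (essμ i).mpr he, hT⟩⟩)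
  have h3 := (Finset.card_le_card this).trans (Finset.card_union_le _ _)
  omega

lemma uncut {a b : ℕ} (h1 : A + 1 < a) (hab : a ≤ b) (h2 : b + 1 + A < l) (h : ∀ i, a ≤ i → i < b → ¬ cut m cs i) :
    b - a ≤ n0 * n0 + 2 * n0 + 2 * W.length / N := by
  classical
  have hN := q.N7
  obtain ⟨Z, hZ⟩ : ∃ Z, Z = 2 * W.length / N := ⟨_, rfl⟩
  rw [← hZ]
  rcases hab.eq_or_lt with rfl | hab
  · omega
  by_cases hex : ∃ t, a < t ∧ t < b ∧ m.ess (m.o t)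
  · obtain ⟨t0, t1, t2, t3⟩ := hex
    have hup : ∀ k, t0 + k < b → T m cs (m.μ (m.o (t0 + k))) := by
      intro k
      induction k with
      | zero =>
        intro hk
        by_contra hT
        exact h t0 t1.le t2 ⟨hT, Or.inl t3⟩
      | succ k ih =>
        intro hk
        by_contra hT
        by_cases he : m.ess (m.o (t0 + k + 1))
        · exact h _ (by omega) hk ⟨hT, Or.inl he⟩
        · have h4 := noness_next he
          have := (T_orb (cs := cs) (f_orb m.φ (m.μ (m.o (t0 + k + 1))))).mp (by rw [h4]; exact ih (by omega))
          exact hT this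
    have hdn : ∀ k, a + k + 1 ≤ t0 → T m cs (m.μ (m.o (t0 - 1 - k))) := by
      intro k
      induction k with
      | zero =>
        intro hk
        by_contra hT
        refine h (t0 - 1) (by omega) (by omega) ⟨hT, Or.inr ?_⟩
        rwa [Nat.sub_add_cancel (by omega)]
      | succ k ih =>
        intro hk
        by_contra hT
        have e1 : t0 - 1 - (k+1) + 1 = t0 - 1 - k := by omega
        by_cases he : m.ess (m.o (t0 - 1 - (k+1) + 1))
        · exact h _ (by omega) (by omega) ⟨hT, Or.inr he⟩
        · have h4 := noness_next he
          rw [← h4, T_orb (f_orb _ _), e1] at hT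
          exact hT (ih (by omega))
    have hall : ∀ i, a ≤ i → i < b → T m cs (m.μ (m.o i)) := by
      intro i h3 h4
      rcases Nat.lt_or_ge i t0 with h5 | h5
      · have := hdn (t0 - 1 - i) (by omega)
        rwa [show t0 - 1 - (t0 - 1 - i) = i by omega] at this
      · have := hup (i - t0) (by omega)
        rwa [show t0 + (i - t0) = i by omega] at this
    obtain ⟨c, c1, c2, c3, c4⟩ := q.lastess t2 t3
    have hex : ∃ t, a < t ∧ m.ess (m.o t) := ⟨t0, t1, t3⟩
    obtain ⟨f1, f2⟩ := Nat.find_spec hex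
    have f3 := Nat.find_min' hex ⟨t1, t3⟩
    have f4 : ∀ t, a < t → t < Nat.find hex → ¬ m.ess (m.o t) := fun t g1 g2 g3 => Nat.find_min hex g2 ⟨g1, g3⟩
    set f := Nat.find hex
    have r1 := q.row_le (a := f) (c := c) (by omega) (by omega) (by omega) f2 c3 fun i g1 g2 => hall i (by omega) (by omega)
    have r2 := (q.run f1 (by omega) f4 (hall _ (by omega) (by omega)).1).1
    have r3 := (q.run c2 (by omega) c4 (hall _ (by omega) (by omega)).1).1
    have r4 := (q.tT (i := f - 1) (by omega) (by omega) (hall _ (by omega) (by omega))).1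
    have r5 := (q.tT (i := b - 1) (by omega) (by omega) (hall _ (by omega) (by omega))).1
    omega
  · push Not at hex
    obtain ⟨r1, r2, r3⟩ := q.run hab (by omega) hex (q.inner (by omega) (by omega))
    rcases Nat.lt_or_ge (nn m.φ (m.μ (m.o (b-1)))) n0 with h3 | h3
    · omega
    · have := (Nat.le_div_iff_mul_le (by omega : 0 < N)).mpr (show (b - a) * N ≤ 2 * W.length by
        rw [mul_comm]; have := r2 h3; omega)
      rw [← hZ] at this
      omega

theorem main : l ≤ 2 * A + 4 + 782 * (n0 * n0 + 2 * n0 + 2 * W.length / N + 1) := by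
  classical
  by_cases hl : l ≤ 2 * A + 4
  · omega
  have h1 := cut_interval (cut m cs) (n0 * n0 + 2 * n0 + 2 * W.length / N) (x := A + 2) (l - A - 2) (by omega)
    fun a b h1 h2 h3 => q.uncut (by omega) h2 (by omega)
  have h2 := q.cut_count (x := A + 2) (y := l - A - 2) (by omega) (by omega)
  have h3 := Nat.mul_le_mul_left (n0 * n0 + 2 * n0 + 2 * W.length / N + 1) h2
  omega

end QH
end Quad
end MorseLTG

namespace MorseLTG
section Contr
variable {S : Type*} {R : Set (Word S)}

lemma PM.pos_take {G : Type*} [Group G] {σ : S → G} {g : G} {W : Word S}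
    {D : Type} [Fintype D] [DecidableEq D] (m : PM σ R W g D) {i : ℕ} (h : i ≤ W.length) :
    m.pos (m.o i) = g * evalWord σ (W.take i) := by
  have := m.pow_φ_pos (m.o 0) i
  rwa [m.o_add, zero_add, m.o_word (by omega), m.pos_o, List.drop_zero] at this

/-- every long relator overlaps `w` in at most the proportion `1/N` -/
def OV (R : Set (Word S)) (N n0 : ℕ) (w : Word S) : Prop :=
  ∀ z r, z <:+: w → r ∈ symmClosure R → n0 ≤ r.length → z <:+: r → N * z.length ≤ r.length

lemma gd_pt {G : Type*} [Group G] {σ : S → G} (hg : gen σ) {w : Word S} (h : Gd σ w) (a : G) {t : ℕ} (ht : t ≤ w.length) :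
    wordDist σ a (a * evalWord σ (w.take t)) = t ∧ wordDist σ (a * evalWord σ (w.take t)) (a * evalWord σ w) = w.length - t := by
  have h1 := wd_gd hg a (h.infix (List.take_prefix t w).isInfix)
  have h2 := wd_gd hg (a * evalWord σ (w.take t)) (h.infix (List.drop_suffix t w).isInfix)
  rw [mul_assoc, ← evalWord_append, List.take_append_drop] at h2
  simp only [List.length_take, List.length_drop] at h1 h2
  exact ⟨by omega, h2⟩

lemma dt_left {u v : Word S} {i k : ℕ} (h : i + k ≤ u.length) : ((u ++ v).drop i).take k = (u.drop i).take k := by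
  rw [List.drop_append_of_le_length (by omega), List.take_append_of_le_length (by simp; omega)]
lemma dt_right {u v : Word S} {i k : ℕ} (h : u.length ≤ i) : ((u ++ v).drop i).take k = (v.drop (i - u.length)).take k := by
  rw [List.drop_append, List.drop_of_length_le h, List.nil_append]
lemma dt_infix (u : Word S) (i k : ℕ) : (u.drop i).take k <:+: u :=
  (List.take_prefix _ _).isInfix.trans (List.drop_suffix _ _).isInfix

lemma quad (hsc : SmallCancellation R (1/6)) {N n0 : ℕ} (hN : 7 ≤ N) {w1 w2 w3 w4 : Word S} (g : GP R)
    (g1 : Gd (presGen R) w1) (g2 : Gd (presGen R) w2) (g3 : Gd (presGen R) w3) (g4 : Gd (presGen R) w4)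
    (h1 : evalWord (presGen R) (w1 ++ (w2 ++ (w3 ++ w4))) = 1) (hov : OV R N n0 w1)
    (pr2 : ∀ i ≤ w1.length, w2.length ≤ wordDist (presGen R) (g * evalWord (presGen R) (w1.take i)) (g * evalWord (presGen R) (w1 ++ w2)))
    (pr4 : ∀ i ≤ w1.length, w4.length ≤ wordDist (presGen R) (g * evalWord (presGen R) (w1.take i)) (g * evalWord (presGen R) (w1 ++ (w2 ++ w3))))
    (h3 : w3.length + n0 < w4.length) :
    w1.length ≤ 2 * (2 * n0) + 4 + 782 * (n0 * n0 + 2 * n0 + 2 * (w1.length + w2.length + w3.length + w4.length) / N + 1) := by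
  set σ := presGen R with hσ
  have hg : gen σ := gen_pres
  rcases Nat.eq_zero_or_pos w1.length with h0 | h0
  · omega
  set W := w1 ++ (w2 ++ (w3 ++ w4)) with hWd
  have hP : W.length = w1.length + w2.length + w3.length + w4.length := by simp [hWd]; omega
  have hW : W ≠ [] := by rw [← List.length_pos_iff]; omega
  obtain ⟨D, i1, i2, ⟨m⟩⟩ := diag hsc hW h1 g
  have hsub : {r ∈ R | r.length < 2 * W.length} ⊆ R := fun r hr => hr.1
  rw [← hP]
  have q : QH m {w1.length, w1.length + w2.length, w1.length + w2.length + w3.length, W.length} w1.length n0 N (2 * n0) := by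
    refine ⟨sc_mono hsub hsc, hg, fun r hr => rel_one r hr.1, hW, by simp, by simp, ?_, h0, Finset.card_le_four, ?_, ?_, ?_, hN, ?_⟩
    · intro c hc
      simp only [Finset.mem_insert, Finset.mem_singleton] at hc
      omega
    · intro i k hik hc
      have c1 := hc w1.length (by simp)
      have c2 := hc (w1.length + w2.length) (by simp)
      have c3 := hc (w1.length + w2.length + w3.length) (by simp)
      rcases c1 with c1 | c1
      · rw [hWd, dt_left c1]; exact g1.infix (dt_infix _ _ _)
      rw [hWd, dt_right c1]
      rcases c2 with c2 | c2
      · rw [dt_left (by omega)]; exact g2.infix (dt_infix _ _ _)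
      rw [dt_right (by omega)]
      rcases c3 with c3 | c3
      · rw [dt_left (by omega)]; exact g3.infix (dt_infix _ _ _)
      rw [dt_right (by omega)]; exact g4.infix (dt_infix _ _ _)
    · rintro r ⟨r0, hr0, k, rfl | rfl⟩
      · simpa using hr0.2
      · simpa using hr0.2
    · intro i k hik r hr hn hz
      rw [hWd, dt_left hik] at hz
      have := hov _ r (dt_infix w1 i k) (symm_mono hsub hr) hn hz
      rwa [List.length_take, List.length_drop, min_eq_left (by omega)] at this
    · intro i hi j hj hjP hd
      rw [m.pos_take (by omega), m.pos_take hjP, ← hσ] at hd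
      have e1 : W.take i = w1.take i := List.take_append_of_le_length hi
      rw [e1] at hd
      obtain ⟨p1, p2⟩ := gd_pt hg g1 g hi
      set γ := g * evalWord σ (w1.take i) with hγ
      have f2 := pr2 i hi
      have f4 := pr4 i hi
      have f1 := pr4 0 (by omega)
      have f3 := pr2 w1.length le_rfl
      rw [← hγ] at f2 f4
      by_cases c2 : j ≤ w1.length + w2.length
      · right
        have e2 : W.take j = w1 ++ w2.take (j - w1.length) := by
          rw [hWd, List.take_append, List.take_of_length_le hj, List.take_append_of_le_length (by omega)]
        rw [e2, evalWord_append, ← mul_assoc] at hd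
        obtain ⟨q1, q2⟩ := gd_pt hg g2 (g * evalWord σ w1) (t := j - w1.length) (by omega)
        rw [evalWord_append, ← mul_assoc] at f2
        have t1 := wd_tri hg γ (g * evalWord σ w1 * evalWord σ (w2.take (j - w1.length))) (g * evalWord σ w1 * evalWord σ w2)
        have t2 := wd_tri hg γ (g * evalWord σ w1 * evalWord σ (w2.take (j - w1.length))) (g * evalWord σ w1)
        rw [wd_symm hg (g * evalWord σ w1 * evalWord σ (w2.take (j - w1.length))) (g * evalWord σ w1)] at t2
        omega
      by_cases c3 : j ≤ w1.length + w2.length + w3.length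
      · exfalso
        have e2 : W.take j = w1 ++ (w2 ++ w3.take (j - w1.length - w2.length)) := by
          rw [hWd, List.take_append, List.take_of_length_le hj, List.take_append, List.take_of_length_le (by omega),
            List.take_append_of_le_length (by omega)]
        obtain ⟨q1, q2⟩ := gd_pt hg g3 (g * evalWord σ (w1 ++ w2)) (t := j - w1.length - w2.length) (by omega)
        rw [e2, ← List.append_assoc, evalWord_append, ← mul_assoc] at hd
        rw [← List.append_assoc, evalWord_append, ← mul_assoc] at f4
        have t1 := wd_tri hg γ (g * evalWord σ (w1 ++ w2) * evalWord σ (w3.take (j - w1.length - w2.length))) (g * evalWord σ (w1 ++ w2) * evalWord σ w3)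
        omega
      · left
        have e2 : W.take j = (w1 ++ (w2 ++ w3)) ++ w4.take (j - w1.length - w2.length - w3.length) := by
          rw [hWd, List.take_append, List.take_of_length_le hj, List.take_append, List.take_of_length_le (by omega),
            List.take_append, List.take_of_length_le (by omega)]
          simp
        obtain ⟨q1, q2⟩ := gd_pt hg g4 (g * evalWord σ (w1 ++ (w2 ++ w3))) (t := j - w1.length - w2.length - w3.length) (by omega)
        have e3 : g * evalWord σ (w1 ++ (w2 ++ w3)) * evalWord σ w4 = g := by
          rw [mul_assoc, ← evalWord_append]
          have : (w1 ++ (w2 ++ w3)) ++ w4 = W := by simp [hWd]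
          rw [this, h1, mul_one]
        rw [e3] at q2
        rw [e2, evalWord_append, ← mul_assoc] at hd
        set z := g * evalWord σ (w1 ++ (w2 ++ w3)) * evalWord σ (w4.take (j - w1.length - w2.length - w3.length))
        have t1 := wd_tri hg γ z (g * evalWord σ (w1 ++ (w2 ++ w3)))
        have t2 := wd_tri hg γ z g
        rw [wd_symm hg z (g * evalWord σ (w1 ++ (w2 ++ w3)))] at t1
        rw [wd_symm hg γ g] at t2
        omega
  exact q.main

/-- `i` is a nearest-point parameter for `x` on the path `g, w` -/
def Pj (R : Set (Word S)) (g : GP R) (w : Word S) (x : GP R) (i : ℕ) : Prop :=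
  i ≤ w.length ∧ ∀ k ≤ w.length, wordDist (presGen R) (g * evalWord (presGen R) (w.take i)) x ≤
    wordDist (presGen R) (g * evalWord (presGen R) (w.take k)) x

lemma pj_exists (g : GP R) (w : Word S) (x : GP R) : ∃ i, Pj R g w x i := by
  obtain ⟨i, hi, h⟩ := Finset.exists_min_image (Finset.range (w.length + 1))
    (fun k => wordDist (presGen R) (g * evalWord (presGen R) (w.take k)) x) ⟨0, by simp⟩
  refine ⟨i, by simpa [Nat.lt_succ_iff] using hi, fun k hk => h k (by simpa [Nat.lt_succ_iff] using hk)⟩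

def C0 (n0 : ℕ) : ℕ := 4 * n0 + 4 + 782 * (n0 * n0 + 2 * n0 + 1)

lemma contr0 (hsc : SmallCancellation R (1/6)) {N n0 : ℕ} (hN : 7 ≤ N) {w : Word S} (hw : Gd (presGen R) w)
    (hov : OV R N n0 w) {g x y : GP R} {i j : ℕ} (hi : Pj R g w x i) (hj : Pj R g w y j) (hij : i ≤ j)
    (h : wordDist (presGen R) x y + n0 < wordDist (presGen R) (g * evalWord (presGen R) (w.take i)) x) :
    N * (j - i) ≤ 3128 * (wordDist (presGen R) (g * evalWord (presGen R) (w.take i)) x + wordDist (presGen R) x y +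
      wordDist (presGen R) (g * evalWord (presGen R) (w.take j)) y) + N * C0 n0 := by
  set σ := presGen R with hσ
  have hg : gen σ := gen_pres
  have hjl := hj.1
  set a := g * evalWord σ (w.take i) with ha
  set b := g * evalWord σ (w.take j) with hb
  have hwt : w.take j = w.take i ++ (w.drop i).take (j - i) := by
    rw [show j = i + (j - i) by omega, List.take_add]; simp
  set w1 := (w.drop i).take (j - i) with hw1
  have hl1 : w1.length = j - i := by simp [hw1]; omega
  have e1 : a * evalWord σ w1 = b := by rw [ha, hb, mul_assoc, ← evalWord_append, ← hwt]
  have g1 : Gd σ w1 := hw.infix (dt_infix _ _ _)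
  obtain ⟨w2, g2, e2, l2⟩ := wd_spec hg b y
  obtain ⟨w3, g3, e3, l3⟩ := wd_spec hg y x
  obtain ⟨w4, g4, e4, l4⟩ := wd_spec hg x a
  have hpt : ∀ k ≤ w1.length, a * evalWord σ (w1.take k) = g * evalWord σ (w.take (i + k)) := by
    intro k hk
    rw [ha, mul_assoc, ← evalWord_append, List.take_add, hw1, List.take_take, min_eq_left (by omega)]
  rw [wd_symm hg y x] at l3
  rw [wd_symm hg x a] at l4
  have ey : a * evalWord σ (w1 ++ w2) = y := by rw [evalWord_append, ← mul_assoc, e1, e2]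
  have ex : a * evalWord σ (w1 ++ (w2 ++ w3)) = x := by
    rw [← List.append_assoc, evalWord_append, ← mul_assoc, ey, e3]
  have hq := quad hsc hN (n0 := n0) a g1 g2 g3 g4 (by
      have : a * evalWord σ (w1 ++ (w2 ++ (w3 ++ w4))) = a := by
        rw [evalWord_append, evalWord_append, evalWord_append, ← mul_assoc, e1, ← mul_assoc, e2, ← mul_assoc, e3, e4]
      exact mul_left_cancel (this.trans (mul_one a).symm))
    (fun z r hz => hov z r (hz.trans (dt_infix _ _ _)))
    (fun k hk => by rw [← hσ, hpt k hk, ey, ← l2]; exact hj.2 _ (by omega))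
    (fun k hk => by rw [← hσ, hpt k hk, ex, ← l4]; exact hi.2 _ (by omega)) (by omega)
  have t1 := wd_tri hg a x b
  have t2 := wd_tri hg x y b
  have t3 := wd_gd hg a g1
  rw [e1] at t3
  rw [wd_symm hg y b] at t2
  set Z := 2 * (w1.length + w2.length + w3.length + w4.length) / N with hZ
  have hZN : N * Z ≤ 2 * (w1.length + w2.length + w3.length + w4.length) := Nat.mul_div_le _ _
  have hq2 : w1.length ≤ C0 n0 + 782 * Z := by rw [C0]; omega
  have := Nat.mul_le_mul_left N hq2
  rw [mul_add, mul_left_comm] at this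
  rw [← hl1]
  omega

lemma contr (hsc : SmallCancellation R (1/6)) {N n0 : ℕ} (hN : 7 ≤ N) {w : Word S} (hw : Gd (presGen R) w)
    (hov : OV R N n0 w) {g x y : GP R} {i j : ℕ} (hi : Pj R g w x i) (hj : Pj R g w y j)
    (h1 : 2 * n0 < wordDist (presGen R) (g * evalWord (presGen R) (w.take i)) x)
    (h2 : 4 * wordDist (presGen R) x y ≤ wordDist (presGen R) (g * evalWord (presGen R) (w.take i)) x) :
    N * (j - i) ≤ 9384 * wordDist (presGen R) (g * evalWord (presGen R) (w.take i)) x + N * C0 n0 ∧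
    N * (i - j) ≤ 9384 * wordDist (presGen R) (g * evalWord (presGen R) (w.take i)) x + N * C0 n0 := by
  have hg : gen (presGen R) := gen_pres
  have t1 := hj.2 i hi.1
  have t2 := wd_tri hg (g * evalWord (presGen R) (w.take i)) x y
  have t3 := hi.2 j hj.1
  have t4 := wd_tri hg (g * evalWord (presGen R) (w.take j)) y x
  have t5 := wd_symm hg y x
  rcases le_total i j with h | h
  · have := contr0 hsc hN hw hov hi hj h (by omega)
    rw [Nat.sub_eq_zero_of_le h]
    constructor <;> omega
  · have := contr0 hsc hN hw hov hj hi h (by omega)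
    rw [Nat.sub_eq_zero_of_le h]
    constructor <;> omega
end Contr
end MorseLTG

namespace MorseLTG
section Morse
variable {S : Type*} {R : Set (Word S)}

def NQ (Q : ℕ) : ℕ := 32 * 9384 * Q
def rho (Q n0 : ℕ) : ℕ := 16 * (Q * C0 n0) + 2 * n0 + 4
def CQ (Q n0 : ℕ) : ℕ := rho Q n0 + (2 * (Q * (2 * rho Q n0 + 2 + Q)) + rho Q n0)

lemma bQ (hsc : SmallCancellation R (1/6)) {Q : ℕ} (hQ : 1 ≤ Q) (n0 : ℕ) {w : Word S} {g : GP R}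
    (hw : Gd (presGen R) w) (hov : OV R (NQ Q) n0 w) {f : ℕ → GP R} {T : ℕ}
    (hf : ∀ k < T, wordDist (presGen R) (f k) (f (k+1)) ≤ 1)
    (hl : ∀ i j, i ≤ j → j ≤ T → j - i ≤ Q * (wordDist (presGen R) (f i) (f j) + Q))
    (h0 : f 0 = g) (hT : f T = g * evalWord (presGen R) w) {n : ℕ} (hn : n ≤ T) :
    ∃ k ≤ w.length, wordDist (presGen R) (f n) (g * evalWord (presGen R) (w.take k)) ≤ CQ Q n0 := by
  classical
  set σ := presGen R with hσ
  have hg : gen σ := gen_pres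
  have hlip : ∀ i k, i + k ≤ T → wordDist σ (f i) (f (i+k)) ≤ k := by
    intro i k
    induction k with
    | zero => intro _; simp [wd_self]
    | succ k ih =>
      intro h
      have := wd_tri hg (f i) (f (i+k)) (f (i+(k+1)))
      have := ih (by omega)
      have := hf (i+k) (by omega)
      rw [add_assoc] at this
      omega
  have hlip' : ∀ i j, i ≤ j → j ≤ T → wordDist σ (f i) (f j) ≤ j - i := by
    intro i j hij hj
    have := hlip i (j - i) (by omega)
    rwa [Nat.add_sub_cancel' hij] at this
  choose π hπ using fun k => pj_exists g w (f k)
  set γ : ℕ → GP R := fun k => g * evalWord σ (w.take k) with hγ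
  set δ : ℕ → ℕ := fun k => wordDist σ (γ (π k)) (f k) with hδ
  have hδl : ∀ i j, i ≤ j → j ≤ T → δ j ≤ δ i + (j - i) ∧ δ i ≤ δ j + (j - i) := by
    intro i j hij hj
    have h1 := hlip' i j hij hj
    have h2 : δ j ≤ wordDist σ (γ (π i)) (f j) := (hπ j).2 _ (hπ i).1
    have h3 : δ i ≤ wordDist σ (γ (π j)) (f i) := (hπ i).2 _ (hπ j).1
    have h4 := wd_tri hg (γ (π i)) (f i) (f j)
    have h5 := wd_tri hg (γ (π j)) (f j) (f i)
    have h6 := wd_symm hg (f i) (f j)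
    change _ ≤ δ i + _ at h4
    change _ ≤ δ j + _ at h5
    constructor <;> omega
  have hγd : ∀ i j, i ≤ j → j ≤ w.length → wordDist σ (γ i) (γ j) = j - i := by
    intro i j hij hj
    have h1 := gd_pt hg (hw.infix (List.take_prefix j w).isInfix) g (t := i) (by simp; omega)
    rw [List.take_take, min_eq_left hij, List.length_take, min_eq_left hj] at h1
    exact h1.2
  have hρ : 1 ≤ rho Q n0 := by rw [rho]; omega
  by_cases hc : δ n ≤ CQ Q n0
  · exact ⟨π n, (hπ n).1, by rw [wd_symm hg]; exact hc⟩
  exfalso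
  have hC : rho Q n0 ≤ CQ Q n0 := by rw [CQ]; omega
  have hδ0 : δ 0 = 0 := by
    have : δ 0 ≤ _ := (hπ 0).2 0 (by omega)
    rw [List.take_zero, evalWord_nil, mul_one, h0, wd_self] at this; omega
  have hδT : δ T = 0 := by
    have : δ T ≤ _ := (hπ T).2 w.length le_rfl
    rw [hT, List.take_length] at this; exact Nat.le_zero.mp (this.trans (wd_self _).le)
  -- excursion
  have hex : ∃ k, n ≤ k ∧ δ k ≤ rho Q n0 := ⟨T, hn, by omega⟩
  obtain ⟨b1, b2⟩ := Nat.find_spec hex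
  have b3 : ∀ k, n ≤ k → k < Nat.find hex → rho Q n0 < δ k := by
    intro k h1 h2
    by_contra h3
    exact Nat.find_min hex h2 ⟨h1, by omega⟩
  have b4 : Nat.find hex ≤ T := Nat.find_min' hex ⟨hn, by omega⟩
  set n2 := Nat.find hex with hn2
  have a1 : δ (Nat.findGreatest (fun k => δ k ≤ rho Q n0) n) ≤ rho Q n0 :=
    Nat.findGreatest_spec (P := fun k => δ k ≤ rho Q n0) (Nat.zero_le n) (by simp [hδ0])
  have a2 : ∀ k, Nat.findGreatest (fun k => δ k ≤ rho Q n0) n < k → k ≤ n → rho Q n0 < δ k := by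
    intro k h1 h2
    by_contra h3
    exact Nat.findGreatest_is_greatest h1 h2 (by omega)
  have a3 := Nat.findGreatest_le (P := fun k => δ k ≤ rho Q n0) n
  set n1 := Nat.findGreatest (fun k => δ k ≤ rho Q n0) n with hn1
  have hbig : ∀ k, n1 < k → k < n2 → rho Q n0 < δ k := by
    intro k h1 h2
    rcases le_total k n with h | h
    · exact a2 k h1 h
    · exact b3 k h h2
  have hcon : ∀ x y, rho Q n0 < δ x → 4 * wordDist σ (f x) (f y) ≤ δ x →
      32 * (Q * (π y - π x)) ≤ δ x + 32 * (Q * C0 n0) ∧ 32 * (Q * (π x - π y)) ≤ δ x + 32 * (Q * C0 n0) := by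
    intro x y h1 h2
    rw [rho] at h1
    obtain ⟨h3, h4⟩ := contr hsc (by rw [NQ]; omega) hw hov (hπ x) (hπ y) (by change 2 * n0 < δ x; omega) h2
    have e : ∀ X, NQ Q * X = 9384 * (32 * (Q * X)) := fun X => by rw [NQ]; ring
    rw [e, e] at h3 h4
    change 9384 * (32 * (Q * (π y - π x))) ≤ 9384 * δ x + _ at h3
    change 9384 * (32 * (Q * (π x - π y))) ≤ 9384 * δ x + _ at h4
    constructor <;> omega
  have hmain : ∀ e m, m + e = n2 → n1 < m → 4 * (Q * (π n2 - π m)) ≤ 2 * (n2 - m) + rho Q n0 ∧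
      4 * (Q * (π m - π n2)) ≤ 2 * (n2 - m) + rho Q n0 := by
    intro e
    induction e using Nat.strong_induction_on with
    | _ e ih =>
    intro m hm h1
    rcases Nat.eq_zero_or_pos e with rfl | he
    · rw [Nat.add_zero] at hm; subst hm; simp
    have hD := hbig m h1 (by omega)
    have hr : rho Q n0 = 16 * (Q * C0 n0) + 2 * n0 + 4 := rfl
    by_cases hj : m + δ m / 4 < n2
    · have h2 := hlip m (δ m / 4) (by omega)
      obtain ⟨h3, h4⟩ := hcon m (m + δ m / 4) hD (by omega)
      obtain ⟨h5, h6⟩ := ih (e - δ m / 4) (by omega) (m + δ m / 4) (by omega) (by omega)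
      have h7 : Q * (π n2 - π m) ≤ Q * (π (m + δ m / 4) - π m) + Q * (π n2 - π (m + δ m / 4)) := by
        rw [← mul_add]; exact Nat.mul_le_mul_left _ (by omega)
      have h8 : Q * (π m - π n2) ≤ Q * (π m - π (m + δ m / 4)) + Q * (π (m + δ m / 4) - π n2) := by
        rw [← mul_add]; exact Nat.mul_le_mul_left _ (by omega)
      constructor <;> omega
    · have h2 := hlip' m n2 (by omega) b4
      obtain ⟨h3, h4⟩ := hcon m n2 hD (by omega)
      have h5 := (hδl m n2 (by omega) b4).2
      constructor <;> omega
  have hn1n : n1 < n := by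
    rcases a3.lt_or_eq with h | h
    · exact h
    · rw [h] at a1; omega
  have hn2n : n < n2 := by
    rcases b1.lt_or_eq with h | h
    · exact h
    · rw [← h] at b2; omega
  obtain ⟨m1, m2⟩ := hmain (n2 - (n1 + 1)) (n1+1) (by omega) (by omega)
  have d1 := (hδl n1 (n1+1) (by omega) (by omega)).1
  have d2 := (hδl n1 n (by omega) (by omega)).1
  have t1 := wd_tri hg (f n1) (f (n1+1)) (f n2)
  have t2 := hlip n1 1 (by omega)
  have t3 := wd_tri hg (f (n1+1)) (γ (π (n1+1))) (f n2)
  have t4 := wd_tri hg (γ (π (n1+1))) (γ (π n2)) (f n2)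
  rw [wd_symm hg (f (n1+1)) (γ (π (n1+1)))] at t3
  change _ ≤ δ (n1+1) + _ at t3
  change _ ≤ _ + δ n2 at t4
  obtain ⟨Δ, hΔ1, hΔ2⟩ : ∃ Δ, wordDist σ (γ (π (n1+1))) (γ (π n2)) ≤ Δ ∧ 4 * (Q * Δ) ≤ 2 * (n2 - (n1+1)) + rho Q n0 := by
    rcases le_total (π (n1+1)) (π n2) with h | h
    · exact ⟨_, (hγd _ _ h (hπ _).1).le, m1⟩
    · refine ⟨_, ?_, m2⟩
      rw [wd_symm hg]; exact (hγd _ _ h (hπ _).1).le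
  have t5 := hl n1 n2 (by omega) b4
  have t6 : Q * (wordDist σ (f n1) (f n2) + Q) ≤ Q * ((2 * rho Q n0 + 2 + Q) + Δ) := Nat.mul_le_mul_left _ (by omega)
  rw [mul_add Q (2 * rho Q n0 + 2 + Q) Δ] at t6
  have hCQ : CQ Q n0 = rho Q n0 + (2 * (Q * (2 * rho Q n0 + 2 + Q)) + rho Q n0) := rfl
  omega
end Morse
end MorseLTG

namespace MorseLTG
section PartA
variable {S : Type*} {R : Set (Word S)}

/-- overlaps of two relators: small, or the lengths agree -/
lemma ov6 (hsc : SmallCancellation R (1/6)) {z r r' : Word S} (hz : z ≠ []) (hr : r ∈ symmClosure R)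
    (hr' : r' ∈ symmClosure R) (h : z <:+: r) (h' : z <:+: r') : 6 * z.length < r'.length ∨ r'.length = r.length := by
  obtain ⟨a, ha, hal, hza⟩ := infix_pre hr h
  obtain ⟨b, hb, hbl, hzb⟩ := infix_pre hr' h'
  by_cases hab : a = b
  · right; rw [← hbl, ← hab, hal]
  · left
    have := hsc.2 b hb z ⟨hz, a, ha, b, hb, hab, hza, hzb⟩ hzb.isInfix
    rw [hbl] at this
    have h2 : (6 : ℝ) * z.length < r'.length := by linarith
    exact_mod_cast h2

lemma gd_rel (hsc : SmallCancellation R (1/6)) {z r : Word S} (hr : r ∈ symmClosure R) (h : z <:+: r)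
    (hl : 3 * z.length < r.length) : Gd (presGen R) z := by
  refine geo hsc (red_infix (symm_red hsc.1 hr) h) fun y r' h1 h2 h3 h4 => ?_
  have := h2.length_le
  rcases ov6 hsc h1 hr h3 (h2.trans h) h4 with h5 | h5 <;> omega

lemma cyc_half (hsc : SmallCancellation R (1/6)) {a b : Word S} (hr : a ++ b ∈ symmClosure R) (g : GP R)
    (hl : a.length ≤ b.length) : a.length ≤ 3 * wordDist (presGen R) g (g * evalWord (presGen R) a) + 6 := by
  have hg : gen (presGen R) := gen_pres
  by_cases h : 3 * a.length < (a ++ b).length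
  · rw [wd_gd hg g (gd_rel hsc hr (List.prefix_append a b).isInfix h)]; omega
  rw [List.length_append] at h
  set k := (a.length + b.length - 1) / 3 with hk
  by_cases hk0 : a.length = 0
  · omega
  have hka : k ≤ a.length := by omega
  have hlen : (a.take k).length = k := by simp; omega
  have h1 := wd_gd hg g (gd_rel hsc hr ((List.take_prefix k a).isInfix.trans (List.prefix_append a b).isInfix) (by
    rw [hlen, List.length_append]; omega))
  have h2 := wd_le (σ := presGen R) (g * evalWord (presGen R) (a.take k)) (a.drop k)
  rw [mul_assoc, ← evalWord_append, List.take_append_drop, List.length_drop] at h2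
  have h3 := wd_tri hg g (g * evalWord (presGen R) a) (g * evalWord (presGen R) (a.take k))
  rw [wd_symm hg (g * evalWord (presGen R) a), h1, hlen] at h3
  omega

lemma cyc (hsc : SmallCancellation R (1/6)) {r : Word S} (hr : r ∈ symmClosure R) (g : GP R) {i j : ℕ} (hij : i ≤ j)
    (hj : j ≤ r.length) : min (j - i) (r.length - (j - i)) ≤
      3 * wordDist (presGen R) (g * evalWord (presGen R) (r.take i)) (g * evalWord (presGen R) (r.take j)) + 6 := by
  have hg : gen (presGen R) := gen_pres
  have e0 := symm_eval rel_one hr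
  set a := (r.drop i).take (j - i) with ha
  have hal : a.length = j - i := by simp [ha]; omega
  have e1 : r.take j = r.take i ++ a := by
    rw [ha, ← List.take_append_drop i (r.take j), List.take_take, min_eq_left hij, List.drop_take]
  have e2 : r = r.take i ++ (a ++ r.drop j) := by
    rw [← List.append_assoc, ← e1, List.take_append_drop]
  have hrot : a ++ (r.drop j ++ r.take i) ∈ symmClosure R := by
    refine symm_rot hr ?_
    rw [← List.append_assoc]
    nth_rw 1 [e2]
    exact List.isRotated_append
  have hbl : (r.drop j ++ r.take i).length = r.length - (j - i) := by simp; omega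
  rcases le_total a.length (r.drop j ++ r.take i).length with h | h
  · have := cyc_half hsc hrot (g * evalWord (presGen R) (r.take i)) h
    rw [mul_assoc, ← evalWord_append, ← e1] at this
    omega
  · have := cyc_half hsc (symm_rot hrot List.isRotated_append) (g * evalWord (presGen R) (r.take j)) h
    rw [evalWord_append, mul_assoc, ← mul_assoc (evalWord _ (r.take j)), ← evalWord_append, List.take_append_drop, e0,
      one_mul, wd_symm hg] at this
    omega

lemma partA (hsc : SmallCancellation R (1/6)) {r z : Word S} (hr : r ∈ symmClosure R) (hz : z <:+: r) {N : ℕ} (hN : 1 ≤ N)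
    (h1 : r.length ≤ N * z.length) (h2 : 2 * z.length ≤ r.length) {M : ℝ → ℝ} {I : Set ℤ} {p : ℤ → GP R}
    (hM : DMorseOn (presGen R) M I p) {s : ℤ} (hs : s ∈ I) (ht : s + z.length ∈ I)
    (hp : ∀ i : ℕ, i ≤ z.length → p (s + i) = p s * evalWord (presGen R) (z.take i)) :
    (r.length : ℝ) ≤ 12 * M (3 * N) + 36 := by
  have hg : gen (presGen R) := gen_pres
  obtain ⟨r', hr', hl, hpre⟩ := infix_pre hr hz
  rw [← hl] at h1 h2 ⊢
  clear hl hz hr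
  have e0 := symm_eval rel_one hr'
  set n := r'.length with hn
  set m := z.length with hm
  have hzt : ∀ i ≤ m, r'.take i = z.take i := by
    intro i hi
    obtain ⟨y, rfl⟩ := hpre
    rw [List.take_append_of_le_length hi]
  set g := p s with hgs
  set c : ℕ → GP R := fun i => g * evalWord (presGen R) (r'.take i) with hc
  have hcd : ∀ i j, i ≤ j → wordDist (presGen R) (c i) (c j) ≤ j - i := by
    intro i j hij
    have := wd_le (σ := presGen R) (c i) ((r'.take j).drop i)
    rw [hc] at this ⊢
    simp only at this ⊢
    have e1 : r'.take j = r'.take i ++ (r'.take j).drop i := by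
      conv_lhs => rw [← List.take_append_drop i (r'.take j), List.take_take, min_eq_left hij]
    rw [mul_assoc, ← evalWord_append, ← e1, List.length_drop, List.length_take] at this
    omega
  have hcyc : ∀ i j, i ≤ j → j ≤ n → min (j - i) (n - (j - i)) ≤ 3 * wordDist (presGen R) (c i) (c j) + 6 :=
    fun i j hij hj => cyc hsc hr' g hij hj
  have hNr : (1 : ℝ) ≤ N := by exact_mod_cast hN
  set q : ℤ → GP R := fun j => c (n - j.toNat) with hq
  have key : ∀ i j : ℤ, 0 ≤ i → i ≤ j → j ≤ ((n - m : ℕ) : ℤ) →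
      ((j : ℝ) - i) / (3 * N) - 3 * N ≤ (wordDist (presGen R) (q i) (q j) : ℝ) ∧
      (wordDist (presGen R) (q i) (q j) : ℝ) ≤ 3 * N * ((j : ℝ) - i) + 3 * N := by
    intro i j hi hij hj
    lift i to ℕ using hi
    lift j to ℕ using (by omega)
    have a1 := hcd (n - j) (n - i) (by omega)
    have a2 := hcyc (n - j) (n - i) (by omega) (by omega)
    rw [wd_symm hg] at a1 a2
    simp only [hq, Int.toNat_natCast]
    set d := wordDist (presGen R) (c (n - i)) (c (n - j))
    have hij' : i ≤ j := by omega
    have hkr : (((j - i : ℕ)) : ℝ) = ((j : ℤ) : ℝ) - ((i : ℤ) : ℝ) := by push_cast [hij']; ring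
    rw [← hkr]
    have a3 : j - i ≤ N * (3 * d + 6) := by
      rcases le_total (j - i) (n - (j - i)) with h | h
      · have : 1 * (3 * d + 6) ≤ N * (3 * d + 6) := Nat.mul_le_mul_right _ hN
        omega
      · have : N * m ≤ N * (3 * d + 6) := Nat.mul_le_mul_left _ (by omega)
        omega
    have a4 : ((j - i : ℕ) : ℝ) ≤ N * (3 * d + 6) := by exact_mod_cast a3
    have a5 : (d : ℝ) ≤ ((j - i : ℕ) : ℝ) := by
      have : d ≤ j - i := by omega
      exact_mod_cast this
    have a6 : (0 : ℝ) ≤ ((j - i : ℕ) : ℝ) := Nat.cast_nonneg _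
    constructor
    · rw [sub_le_iff_le_add, div_le_iff₀ (by positivity)]
      nlinarith
    · nlinarith
  have hQG : DQGeoOn (presGen R) (3 * N) (Set.Icc 0 ((n - m : ℕ) : ℤ)) q := by
    refine ⟨fun k h3 h4 => ?_, fun i hi j hj => ?_⟩
    · obtain ⟨h3, -⟩ := h3
      obtain ⟨-, h4⟩ := h4
      lift k to ℕ using h3
      have := hcd (n - (k+1)) (n - k) (by omega)
      rw [wd_symm hg] at this
      simp only [hq]
      rw [show ((k : ℤ) + 1).toNat = k + 1 by omega, Int.toNat_natCast]
      omega
    · rcases le_total i j with h | h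
      · rw [abs_of_nonneg (by rw [sub_nonneg]; exact_mod_cast h)]
        exact key i j hi.1 h hj.2
      · rw [abs_sub_comm, abs_of_nonneg (by rw [sub_nonneg]; exact_mod_cast h), wd_symm hg]
        exact key j i hj.1 h hi.2
  obtain ⟨v, ⟨hv1, hv2⟩, hv⟩ := hM (3 * N) (by linarith) s hs (s + m) ht (by omega) q 0 ((n - m : ℕ) : ℤ) (by omega) hQG
    (by simp only [hq, hc]; rw [Int.toNat_zero, Nat.sub_zero, List.take_length, e0, mul_one])
    (by simp only [hq, hc]; rw [Int.toNat_natCast, hp m le_rfl, Nat.sub_sub_self (by omega), hzt m le_rfl])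
    (((n - m) / 2 : ℕ) : ℤ) ⟨by omega, by omega⟩
  obtain ⟨i, rfl⟩ : ∃ i : ℕ, v = s + i := ⟨(v - s).toNat, by omega⟩
  have him : i ≤ m := by omega
  rw [hp i him, ← hzt i him] at hv
  simp only [hq, Int.toNat_natCast] at hv
  have b1 := hcyc i (n - (n - m) / 2) (by omega) (by omega)
  rw [wd_symm hg] at b1
  change (wordDist (presGen R) (c (n - (n - m) / 2)) (c i) : ℝ) ≤ _ at hv
  have b2 : n ≤ 12 * wordDist (presGen R) (c (n - (n - m) / 2)) (c i) + 36 := by omega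
  have b3 : (n : ℝ) ≤ 12 * wordDist (presGen R) (c (n - (n - m) / 2)) (c i) + 36 := by exact_mod_cast b2
  linarith
end PartA
end MorseLTG

namespace MorseLTG
section Gauge
variable {S : Type*} {R : Set (Word S)}

lemma gauge_exists (F : ℕ → ℕ) : ∃ M, IsMorseGauge M ∧ ∀ t : ℝ, 1 ≤ t → (F ⌈t⌉₊ : ℝ) ≤ M t := by
  set f : ℝ → ℝ := fun s => ((∑ i ∈ Finset.range (⌈s + 1⌉₊ + 1), F i : ℕ) : ℝ) with hf
  have hmono : Monotone f := by
    intro a b hab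
    have : ⌈a + 1⌉₊ ≤ ⌈b + 1⌉₊ := Nat.ceil_mono (by linarith)
    exact Nat.cast_le.mpr (Finset.sum_le_sum_of_subset (Finset.range_mono (by omega)))
  have hint : ∀ a b, IntervalIntegrable f MeasureTheory.volume a b := fun a b => hmono.intervalIntegrable
  have hpos : ∀ s, 0 ≤ f s := fun s => Nat.cast_nonneg _
  refine ⟨fun t => ∫ s in (0 : ℝ)..t, f s, ⟨?_, ?_, ?_⟩, ?_⟩
  · intro a ha b hb hab
    simp only
    rw [← intervalIntegral.integral_add_adjacent_intervals (hint 0 a) (hint a b)]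
    have := intervalIntegral.integral_nonneg (μ := MeasureTheory.volume) hab fun u _ => hpos u
    linarith
  · exact (intervalIntegral.continuous_primitive hint 0).continuousOn
  · intro t ht
    exact intervalIntegral.integral_nonneg (by linarith) fun u _ => hpos u
  · intro t ht
    simp only
    rw [← intervalIntegral.integral_add_adjacent_intervals (hint 0 (t-1)) (hint (t-1) t)]
    have h1 := intervalIntegral.integral_nonneg (μ := MeasureTheory.volume) (show 0 ≤ t - 1 by linarith) fun u _ => hpos u
    have h2 : ∫ s in (t-1)..t, f (t - 1) ≤ ∫ s in (t-1)..t, f s :=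
      intervalIntegral.integral_mono_on (by linarith) (by simp) (hint _ _) fun x hx => hmono hx.1
    have h3 : (F ⌈t⌉₊ : ℝ) ≤ f (t - 1) := by
      simp only [hf, sub_add_cancel]
      exact Nat.cast_le.mpr (Finset.single_le_sum (fun i _ => Nat.zero_le _) (Finset.self_mem_range_succ _))
    simp only [intervalIntegral.integral_const, sub_sub_cancel, one_smul] at h2
    linarith

lemma morse_of_ov (hsc : SmallCancellation R (1/6)) (n0 : ℕ → ℕ) : ∃ M', IsMorseGauge M' ∧ ∀ (I : Set ℤ) (p : ℤ → GP R),
    (∀ s ∈ I, ∀ t ∈ I, s ≤ t → ∃ w, t = s + w.length ∧ Gd (presGen R) w ∧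
      (∀ i : ℕ, i ≤ w.length → p (s + i) = p s * evalWord (presGen R) (w.take i)) ∧
      ∀ Q, 1 ≤ Q → OV R (NQ Q) (n0 Q) w) → DMorseOn (presGen R) M' I p := by
  obtain ⟨M', hM', hF⟩ := gauge_exists fun Q => CQ Q (n0 Q)
  refine ⟨M', hM', fun I p h Q hQ s hs t ht hst q a b hab hq hqa hqb n hn => ?_⟩
  obtain ⟨w, rfl, hw, hp, hov⟩ := h s hs t ht hst
  have hQ' : 1 ≤ ⌈Q⌉₊ := Nat.one_le_ceil_iff.mpr (by linarith)
  have hQc := Nat.le_ceil Q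
  set Qn := ⌈Q⌉₊ with hQn
  obtain ⟨T, rfl⟩ : ∃ T : ℕ, b = a + T := ⟨(b - a).toNat, by omega⟩
  obtain ⟨m, rfl⟩ : ∃ m : ℕ, n = a + m := ⟨(n - a).toNat, by have := hn.1; omega⟩
  have hm : m ≤ T := by have := hn.2; omega
  obtain ⟨k, hk, hd⟩ := bQ hsc hQ' (n0 Qn) (g := p s) hw (hov _ hQ') (f := fun i : ℕ => q (a + i)) (T := T)
    (fun k hk => by
      have := hq.1 (a + k) ⟨by omega, by omega⟩ ⟨by omega, by omega⟩
      simpa [add_assoc] using this)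
    (fun i j hij hj => by
      have := (hq.2 (a + i) ⟨by omega, by omega⟩ (a + j) ⟨by omega, by omega⟩).1
      have e : ((a + (j:ℤ) : ℤ) : ℝ) - ((a + (i:ℤ) : ℤ) : ℝ) = ((j - i : ℕ) : ℝ) := by push_cast [hij]; ring
      rw [e, Nat.abs_cast, sub_le_iff_le_add, div_le_iff₀ (by linarith)] at this
      have h2 : ((j - i : ℕ) : ℝ) ≤ Qn * ((wordDist (presGen R) (q (a + i)) (q (a + j)) : ℝ) + Qn) := by
        have h3 : (0 : ℝ) ≤ wordDist (presGen R) (q (a + i)) (q (a + j)) := Nat.cast_nonneg _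
        nlinarith
      exact_mod_cast h2)
    (by simpa using hqa) (by rw [hqb, hp _ le_rfl, List.take_length]) hm
  refine ⟨s + k, ⟨by omega, by omega⟩, ?_⟩
  rw [hp k hk]
  exact (Nat.cast_le.mpr hd).trans (hF Q hQ)

/-- geodesics are labelled by geodesic words -/
lemma label {I : Set ℤ} (hI : I.OrdConnected) {p : ℤ → GP R} (hp : DGeodesicOn (presGen R) I p) {s t : ℤ} (hs : s ∈ I) (ht : t ∈ I)
    (hst : s ≤ t) : ∃ w, t = s + w.length ∧ Gd (presGen R) w ∧
      (∀ i : ℕ, i ≤ w.length → p (s + i) = p s * evalWord (presGen R) (w.take i)) := by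
  have hg : gen (presGen R) := gen_pres
  have key : ∀ n : ℕ, s + n ∈ I → ∃ w : Word S, w.length = n ∧
      (∀ i : ℕ, i ≤ w.length → p (s + i) = p s * evalWord (presGen R) (w.take i)) := by
    intro n
    induction n with
    | zero => exact fun _ => ⟨[], rfl, fun i hi => by
        have : i = 0 := by simpa using hi
        subst this; simp [evalWord_nil]⟩
    | succ n ih =>
      intro h
      have h' : s + n ∈ I := hI.out hs h ⟨by omega, by omega⟩
      obtain ⟨w, hw, hi⟩ := ih h'
      obtain ⟨v, -, h2, h3⟩ := wd_spec hg (p (s + n)) (p (s + (n + 1 : ℕ)))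
      have h4 := hp _ h' _ h
      rw [h3] at h4
      have hv : v.length = 1 := by push_cast at h4; simpa using h4
      refine ⟨w ++ v, by simp [hw, hv], fun i hiw => ?_⟩
      rw [List.length_append, hv, hw] at hiw
      rcases Nat.lt_or_ge n i with h5 | h5
      · obtain rfl : i = n + 1 := by omega
        have e := hi n hw.ge
        rw [← hw, List.take_length, hw] at e
        rw [List.take_of_length_le (by simp [hw, hv]), evalWord_append, ← mul_assoc, ← e, h2]
      · rw [List.take_append_of_le_length (by omega)]
        exact hi i (by omega)
  obtain ⟨w, hw, hi⟩ := key (t - s).toNat (by convert ht using 1; omega)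
  refine ⟨w, by omega, ?_, hi⟩
  refine gd_of_wd hg (p s) ?_
  have h1 := hi w.length le_rfl
  rw [List.take_length] at h1
  have h2 := hp s hs (s + w.length) (by convert ht using 1; omega)
  rw [h1] at h2
  simp at h2
  omega
end Gauge
end MorseLTG

namespace MorseLTG
section Select
variable {S : Type*} {R : Set (Word S)}

lemma OV.infix {N n0 : ℕ} {w z : Word S} (h : OV R N n0 w) (hz : z <:+: w) : OV R N n0 z :=
  fun y r h1 => h y r (h1.trans hz)

lemma winv_infix {z w : Word S} (h : z <:+: w) : wordInv z <:+: wordInv w := by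
  obtain ⟨a, b, rfl⟩ := h
  exact ⟨wordInv b, wordInv a, by simp [wordInv_append]⟩

lemma OV.inv {N n0 : ℕ} {w : Word S} (h : OV R N n0 w) : OV R N n0 (wordInv w) := by
  intro z r h1 h2 h3 h4
  have h5 := winv_infix h1
  rw [wordInv_wordInv] at h5
  have := h _ _ h5 (symm_inv h2) (by simpa using h3) (winv_infix h4)
  simpa using this

lemma select (F : ℕ → Set (Word S)) (F1 : ∀ L w z, w ∈ F L → z <:+: w → z ∈ F L) (F2 : ∀ L L' w, L ≤ L' → w ∈ F L' → w ∈ F L)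
    (F3 : ∀ L, ∀ w ∈ F L, Gd (presGen R) w) (B : ℕ → ℕ)
    (F4 : ∀ L N w r, w ∈ F L → w.length ≤ L → r ∈ symmClosure R → w <:+: r → r.length < N * w.length → r.length ≤ B N)
    (cl : ∀ L, ∃ N, 1 ≤ N ∧ ∀ n, ∃ w r, w ∈ F L ∧ r ∈ symmClosure R ∧ n ≤ r.length ∧ w <:+: r ∧ r.length < N * w.length) :
    ∃ m' : ℕ → ℕ, ∀ k, ∃ N, 1 ≤ N ∧ ∀ T, ∃ x r, r ∈ symmClosure R ∧ x <:+: r ∧ r.length ≤ N * x.length ∧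
      2 * x.length ≤ r.length ∧ T ≤ x.length ∧ ∀ N' ≤ k, 1 ≤ N' → OV R N' (m' N') x := by
  classical
  by_cases hB : ∀ N, 1 ≤ N → ∃ L ν, ∀ w ∈ F L, OV R N ν w
  · choose! Lf ν hν using hB
    refine ⟨ν, fun k => ?_⟩
    set L := ∑ i ∈ Finset.range (k+1), Lf i with hL
    obtain ⟨N, hN, h⟩ := cl L
    refine ⟨N, hN, fun T => ?_⟩
    obtain ⟨w, r, hw, hr, hn, hwr, hlt⟩ := h (N * T)
    refine ⟨w, r, hr, hwr, hlt.le, (F3 _ _ hw).half rel_one hr hwr, ?_, fun N' h1 h2 => hν N' h2 w (F2 _ L w ?_ hw)⟩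
    · exact (Nat.lt_of_mul_lt_mul_left (hn.trans_lt hlt)).le
    · exact Finset.single_le_sum (fun i _ => Nat.zero_le _) (Finset.mem_range.mpr (by omega))
  · push Not at hB
    obtain ⟨N, hN, hbad⟩ := hB
    refine ⟨fun N' => B N' + 1, fun k => ?_⟩
    set K := N + 2 * k with hK
    refine ⟨K, by omega, fun T => ?_⟩
    set n := K * T + 2 * K with hn
    have hex : ∃ ρ, n ≤ ρ ∧ ∃ w r, w ∈ F n ∧ r ∈ symmClosure R ∧ r.length = ρ ∧ w <:+: r ∧ ρ < K * w.length := by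
      obtain ⟨w, hw, hov⟩ := hbad n n
      unfold OV at hov
      push Not at hov
      obtain ⟨z, r, h1, h2, h3, h4, h5⟩ := hov
      exact ⟨_, h3, z, r, F1 _ _ _ hw h1, h2, rfl, h4, h5.trans_le (Nat.mul_le_mul_right _ (by omega))⟩
    obtain ⟨hρ, w, r, hw, hr, hrl, hwr, hlt⟩ := Nat.find_spec hex
    have hmin : ∀ ρ, _ → Nat.find hex ≤ ρ := fun ρ h => Nat.find_min' hex h
    set ρ := Nat.find hex
    have hK0 : 0 < K := by omega
    have hq1 : ρ < K * (ρ / K + 1) := by rw [mul_add, mul_one]; exact Nat.lt_mul_div_succ ρ hK0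
    have hq2 : K * (ρ / K) ≤ ρ := Nat.mul_div_le ρ K
    have hlw : ρ / K + 1 ≤ w.length := by
      have : ρ / K < w.length := Nat.div_lt_of_lt_mul hlt
      omega
    set x := w.take (ρ / K + 1) with hx
    have hxl : x.length = ρ / K + 1 := by simp [hx]; omega
    have hxw : x <:+: w := (List.take_prefix _ _).isInfix
    have hxF := F1 _ _ _ hw hxw
    refine ⟨x, r, hr, hxw.trans hwr, ?_, (F3 _ _ hxF).half rel_one hr (hxw.trans hwr), ?_, ?_⟩
    · rw [hrl, hxl]; exact hq1.le
    · rw [hxl]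
      have : T ≤ ρ / K := (Nat.le_div_iff_mul_le hK0).mpr (by rw [Nat.mul_comm]; omega)
      omega
    · intro N' hk h1 z r' hz hr' hm hzr
      by_contra hc
      push Not at hc
      change B N' + 1 ≤ _ at hm
      have hzF := F1 _ _ _ hxF hz
      rcases Nat.lt_or_ge r'.length n with h | h
      · have := F4 n N' z r' hzF (hzr.length_le.trans h.le) hr' hzr hc
        omega
      · have h2 := hmin r'.length ⟨h, z, r', hzF, hr', rfl, hzr, hc.trans_le (Nat.mul_le_mul_right _ (by omega))⟩
        have h3 := hz.length_le
        have h4 : 2 * N' * z.length ≤ K * x.length := Nat.mul_le_mul (by omega) h3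
        rw [hxl, mul_add, mul_one] at h4
        have h5 : 2 * N' * z.length = 2 * (N' * z.length) := by ring
        have h6 : 2 * K ≤ ρ := by
          have : 0 ≤ K * T := Nat.zero_le _
          omega
        omega
end Select
end MorseLTG

namespace MorseLTG
section Ray
variable {S : Type*} {R : Set (Word S)}

lemma red_append {W y : Word S} (hW : ReducedWord W) (hy : ReducedWord y)
    (h : ∀ a ∈ W.getLast?, ∀ b ∈ y.head?, b ≠ fl a) : ReducedWord (W ++ y) := by
  rw [red_iff] at *
  rw [List.isChain_append]
  refine ⟨hW, hy, fun a ha b hb h1 => ?_⟩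
  by_contra h2
  refine h a ha b hb (Prod.ext h1.symm ?_)
  simp only [fl]
  revert h2; generalize a.2 = a; generalize b.2 = b
  cases a <;> cases b <;> simp

lemma junction {W x : Word S} (hW : ReducedWord W) (hx : ReducedWord x) (h0 : x ≠ []) :
    ∃ y, (y <:+: x ∨ wordInv y <:+: x) ∧ x.length ≤ 2 * y.length ∧ y.length ≤ x.length ∧ ReducedWord (W ++ y) := by
  have hl := List.length_pos_iff.mpr h0
  rcases W.eq_nil_or_concat with rfl | ⟨W', a, rfl⟩
  · exact ⟨x, Or.inl List.infix_rfl, by omega, le_rfl, by simpa using hx⟩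
  have hh : x.length / 2 < x.length := by omega
  by_cases hc : x[x.length / 2] = fl a
  · have e : (x.take (x.length / 2 + 1)) = x.take (x.length / 2) ++ [fl a] := by rw [List.take_add_one]; simp [hh, hc]
    refine ⟨wordInv (x.take (x.length / 2 + 1)), Or.inr ?_, by simp; omega, by simp, red_append hW ?_ ?_⟩
    · rw [wordInv_wordInv]; exact (List.take_prefix _ _).isInfix
    · exact reduced_inv (red_infix hx (List.take_prefix _ _).isInfix)
    · intro a' ha b hb
      rw [e, wordInv_append] at hb
      simp [wordInv] at ha hb
      subst ha; subst hb
      simpa [fl] using (fl_ne a).symm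
  · refine ⟨x.drop (x.length / 2), Or.inl (List.drop_suffix _ _).isInfix, by simp; omega, by simp, red_append hW ?_ ?_⟩
    · exact red_infix hx (List.drop_suffix _ _).isInfix
    · intro a' ha b hb
      simp [hh] at ha hb
      subst ha; subst hb; exact hc

lemma infix_app {z u v : Word S} (h : z <:+: u ++ v) : z <:+: u ∨ z <:+: v ∨ ∃ s p, z = s ++ p ∧ s <:+ u ∧ p <+: v := by
  obtain ⟨a, b, h⟩ := h
  rw [List.append_assoc, List.append_eq_append_iff] at h
  rcases h with ⟨c, h1, h2⟩ | ⟨c, h1, h2⟩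
  · rw [List.append_eq_append_iff] at h2
    rcases h2 with ⟨d, h3, h4⟩ | ⟨d, h3, h4⟩
    · exact Or.inl ⟨a, d, by rw [h1, h3]; simp⟩
    · exact Or.inr (Or.inr ⟨c, d, h3, ⟨a, h1.symm⟩, ⟨b, h4.symm⟩⟩)
  · exact Or.inr (Or.inl ⟨c, b, by rw [h2]; simp⟩)

lemma suffix_app {s u v : Word S} (h : s <:+ u ++ v) : s <:+ v ∨ ∃ s', s = s' ++ v ∧ s' <:+ u := by
  obtain ⟨a, h⟩ := h
  rw [List.append_eq_append_iff] at h
  rcases h with ⟨c, h1, h2⟩ | ⟨c, h1, h2⟩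
  · exact Or.inr ⟨c, h2, ⟨a, h1.symm⟩⟩
  · exact Or.inl ⟨c, h2.symm⟩

lemma blocks {W y : ℕ → Word S} (h0 : W 0 = []) (hs : ∀ k, W (k+1) = W k ++ y k) (hl : ∀ k, (W k).length ≤ (y k).length) :
    ∀ k z, z ≠ [] → z <:+: W k → ∃ i j z1 z2, z1 <:+: z ∧ z1 <:+: y i ∧ z2 <:+: z ∧ z2 <:+: y j ∧
      z.length ≤ 2 * z1.length + z2.length ∧ (z.length ≤ z1.length + z2.length ∨ (y i).length ≤ z.length) := by
  intro k
  induction k with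
  | zero => intro z hz h; rw [h0] at h; exact absurd (List.infix_nil.mp h) hz
  | succ k ih =>
    intro z hz h
    rw [hs] at h
    rcases infix_app h with h | h | ⟨s, p, rfl, hsu, hp⟩
    · exact ih z hz h
    · exact ⟨k, k, z, [], List.infix_rfl, h, List.nil_infix, List.nil_infix, by simp; omega, by simp⟩
    · have hpi : p <:+: s ++ p := (List.suffix_append s p).isInfix
      have hsi : s <:+: s ++ p := (List.prefix_append s p).isInfix
      cases k with
      | zero =>
        rw [h0, List.suffix_nil] at hsu
        subst hsu
        exact ⟨0, 0, p, [], List.infix_rfl, hp.isInfix, List.nil_infix, List.nil_infix, by simp; omega, by simp⟩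
      | succ k =>
        rw [hs] at hsu
        rcases suffix_app hsu with h1 | ⟨s', rfl, h1⟩
        · exact ⟨k, k+1, s, p, hsi, h1.isInfix, hpi, hp.isInfix, by simp; omega, by simp⟩
        · have := h1.length_le
          have := hl k
          exact ⟨k, k+1, y k, p, (List.suffix_append s' _).isInfix.trans hsi, List.infix_rfl, hpi, hp.isInfix,
            by simp; omega, by right; simp; omega⟩

lemma final_ray (hsc : SmallCancellation R (1/6)) (hσc : CaySigmaCompact (presGen R)) (m' : ℕ → ℕ)
    (hsel : ∀ k, ∃ N, 1 ≤ N ∧ ∀ T, ∃ x r, r ∈ symmClosure R ∧ x <:+: r ∧ r.length ≤ N * x.length ∧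
      2 * x.length ≤ r.length ∧ T ≤ x.length ∧ ∀ N' ≤ k, 1 ≤ N' → OV R N' (m' N') x) : False := by
  have hg : gen (presGen R) := gen_pres
  obtain ⟨Ms, hMs, hray⟩ := hσc
  choose N hN hsel using fun k => hsel (k + 12)
  set thr : ℕ → ℕ := fun k => m' 12 + ⌈12 * Ms k (3 * (2 * N k : ℕ)) + 36⌉₊ + 1 with hthr
  have step : ∀ k (W : Word S), ReducedWord W → ∃ y, ReducedWord (W ++ y) ∧ W.length ≤ y.length ∧ thr k ≤ y.length ∧
      (∃ r ∈ symmClosure R, y <:+: r ∧ r.length ≤ 2 * N k * y.length ∧ 2 * y.length ≤ r.length) ∧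
      ∀ N' ≤ k + 12, 1 ≤ N' → OV R N' (m' N') y := by
    intro k W hW
    obtain ⟨x, r, hr, hxr, h1, h2, h3, h4⟩ := hsel k (2 * (W.length + thr k))
    have ht : 0 < thr k := by simp [hthr]
    have hx0 : x ≠ [] := by rw [← List.length_pos_iff]; omega
    obtain ⟨y, hy, h5, h6, h7⟩ := junction hW (red_infix (symm_red hsc.1 hr) hxr) hx0
    have h8 : r.length ≤ 2 * N k * y.length := by
      have : N k * x.length ≤ N k * (2 * y.length) := Nat.mul_le_mul_left _ h5
      linarith
    refine ⟨y, h7, by omega, by omega, ?_, ?_⟩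
    · rcases hy with hy | hy
      · exact ⟨r, hr, hy.trans hxr, h8, by omega⟩
      · refine ⟨wordInv r, symm_inv hr, ?_, by simpa using h8, by simp; omega⟩
        have := winv_infix (hy.trans hxr)
        rwa [wordInv_wordInv] at this
    · intro N' h9 h10
      rcases hy with hy | hy
      · exact (h4 N' h9 h10).infix hy
      · have := ((h4 N' h9 h10).infix hy).inv
        rwa [wordInv_wordInv] at this
  choose! Y hY1 hY2 hY3 hY4 hY5 using step
  set W : ℕ → Word S := fun k => Nat.rec [] (fun k W => W ++ Y k W) k with hWd
  set y : ℕ → Word S := fun k => Y k (W k) with hyd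
  have W0 : W 0 = [] := rfl
  have Ws : ∀ k, W (k+1) = W k ++ y k := fun k => rfl
  have Wr : ∀ k, ReducedWord (W k) := by
    intro k
    induction k with
    | zero => rw [W0]; exact List.isChain_nil
    | succ k ih => exact hY1 k _ ih
  have y2 : ∀ k, (W k).length ≤ (y k).length := fun k => hY2 k _ (Wr k)
  have y3 : ∀ k, thr k ≤ (y k).length := fun k => hY3 k _ (Wr k)
  have y4 : ∀ k, ∃ r ∈ symmClosure R, y k <:+: r ∧ r.length ≤ 2 * N k * (y k).length ∧ 2 * (y k).length ≤ r.length :=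
    fun k => hY4 k _ (Wr k)
  have y5 : ∀ k, ∀ N' ≤ k + 12, 1 ≤ N' → OV R N' (m' N') (y k) := fun k => hY5 k _ (Wr k)
  have hbl := blocks W0 Ws y2
  clear_value y W
  have hm12 : ∀ k, m' 12 < (y k).length := fun k => by have := y3 k; simp only [hthr] at this; omega
  have six : ∀ k z r', z <:+: y k → r' ∈ symmClosure R → r' ≠ [] → z <:+: r' → 6 * z.length < r'.length := by
    intro k z r' hz hr' h0 hzr
    have hl0 := List.length_pos_iff.mpr h0
    rcases eq_or_ne z [] with rfl | hz0
    · simpa using hl0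
    obtain ⟨r, hr, hyr, -, h2⟩ := y4 k
    have := hm12 k
    rcases ov6 hsc hz0 hr hr' (hz.trans hyr) hzr with h | h
    · exact h
    · have := y5 k 12 (by omega) (by omega) z r' hz hr' (by omega) hzr
      omega
  have Wg : ∀ k, Gd (presGen R) (W k) := by
    intro k
    refine geo hsc (Wr k) fun z r hz hzW hr hzr => ?_
    have hz0 := List.length_pos_iff.mpr hz
    have hr0 : r ≠ [] := by rintro rfl; exact hz (List.infix_nil.mp hzr)
    obtain ⟨i, j, z1, z2, a1, a2, a3, a4, a5, a6⟩ := hbl k z hz hzW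
    rcases Nat.lt_or_ge r.length (m' 12) with h | h
    · have b1 := six i z1 r a2 hr hr0 (a1.trans hzr)
      have b2 := six j z2 r a4 hr hr0 (a3.trans hzr)
      have := hzr.length_le
      have := hm12 i
      omega
    · have b1 := y5 i 12 (by omega) (by omega) z1 r a2 hr h (a1.trans hzr)
      have b2 := y5 j 12 (by omega) (by omega) z2 r a4 hr h (a3.trans hzr)
      omega
  have ypre : ∀ k, y k <:+: W (k+1) := fun k => by rw [Ws]; exact (List.suffix_append _ _).isInfix
  have Wpre : ∀ i k, W i <+: W (i + k) := by
    intro i k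
    induction k with
    | zero => exact List.prefix_rfl
    | succ k ih => rw [← add_assoc, Ws]; exact ih.trans (List.prefix_append _ _)
  have Wlen : ∀ k, k ≤ (W k).length := by
    intro k
    induction k with
    | zero => omega
    | succ k ih => rw [Ws, List.length_append]; have := hm12 k; omega
  have Wov : ∀ N, 1 ≤ N → ∀ k, OV R N (m' (3 * N) + 3 * N * (W (3 * N)).length) (W k) := by
    intro N hN k z r hzW hr hn hzr
    rcases eq_or_ne z [] with rfl | hz
    · simp
    obtain ⟨i, j, z1, z2, a1, a2, a3, a4, a5, a6⟩ := hbl k z hz hzW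
    have aux : ∀ i z', z' <:+: y i → z' <:+: r → 3 * N * z'.length ≤ r.length := by
      intro i z' h1 h2
      rcases Nat.lt_or_ge i (3 * N) with h | h
      · have h3 : z'.length ≤ (W (3 * N)).length := by
          refine (h1.trans ((ypre i).trans ?_)).length_le
          obtain ⟨e, he⟩ := Nat.exists_eq_add_of_le (show i + 1 ≤ 3 * N from h)
          rw [he]; exact (Wpre _ _).isInfix
        have := Nat.mul_le_mul_left (3 * N) h3
        omega
      · exact y5 i (3 * N) (by omega) (by omega) z' r h1 hr (by omega) h2
    have b1 := aux i z1 a2 (a1.trans hzr)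
    have b2 := aux j z2 a4 (a3.trans hzr)
    have b3 := Nat.mul_le_mul_left N a5
    nlinarith
  set p : ℤ → GP R := fun n => evalWord (presGen R) ((W n.toNat).take n.toNat) with hp
  have hpW : ∀ (n k : ℕ), n ≤ (W k).length → p n = evalWord (presGen R) ((W k).take n) := by
    intro n k hn
    simp only [hp, Int.toNat_natCast]
    congr 1
    rcases le_total n k with h | h
    · obtain ⟨e, rfl⟩ := Nat.exists_eq_add_of_le h
      obtain ⟨v, hv⟩ := Wpre n e
      rw [← hv, List.take_append_of_le_length (Wlen n)]
    · obtain ⟨e, rfl⟩ := Nat.exists_eq_add_of_le h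
      obtain ⟨v, hv⟩ := Wpre k e
      rw [← hv, List.take_append_of_le_length hn]
  have lab : ∀ (s t : ℕ), s ≤ t → ∀ k, t ≤ (W k).length → ∀ i : ℕ, i ≤ t - s →
      p ((s : ℤ) + i) = p s * evalWord (presGen R) ((((W k).drop s).take (t - s)).take i) := by
    intro s t hst k hk i hi
    rw [List.take_take, min_eq_left hi, hpW s k (by omega), ← evalWord_append, ← List.take_add]
    exact_mod_cast hpW (s + i) k (by omega)
  obtain ⟨M', hM', hmor⟩ := morse_of_ov hsc (fun Q => m' (3 * NQ Q) + 3 * NQ Q * (W (3 * NQ Q)).length)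
  have hlab : ∀ s ∈ Set.Ici (0:ℤ), ∀ t ∈ Set.Ici (0:ℤ), s ≤ t → ∃ w, t = s + w.length ∧ Gd (presGen R) w ∧
      (∀ i : ℕ, i ≤ w.length → p (s + i) = p s * evalWord (presGen R) (w.take i)) ∧
      ∀ Q, 1 ≤ Q → OV R (NQ Q) (m' (3 * NQ Q) + 3 * NQ Q * (W (3 * NQ Q)).length) w := by
    intro s hs t ht hst
    lift s to ℕ using hs
    lift t to ℕ using ht
    have hst' : s ≤ t := by exact_mod_cast hst
    have hl : (((W t).drop s).take (t - s)).length = t - s := by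
      have := Wlen t
      simp; omega
    refine ⟨((W t).drop s).take (t - s), by rw [hl]; omega, (Wg t).infix (dt_infix _ _ _), fun i hi => ?_, fun Q hQ => ?_⟩
    · exact lab s t hst' t (Wlen t) i (by omega)
    · exact (Wov (NQ Q) (by rw [NQ]; omega) t).infix (dt_infix _ _ _)
  have hgeo : DGeodesicRay (presGen R) p := by
    refine ⟨by simp [hp, evalWord_nil], ?_⟩
    have key : ∀ s ∈ Set.Ici (0:ℤ), ∀ t ∈ Set.Ici (0:ℤ), s ≤ t → (wordDist (presGen R) (p s) (p t) : ℤ) = t - s := by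
      intro s hs t ht hst
      obtain ⟨w, h1, h2, h3, -⟩ := hlab s hs t ht hst
      have h4 := h3 _ le_rfl
      rw [List.take_length] at h4
      rw [h1, h4, wd_gd hg _ h2]; omega
    intro s hs t ht
    rcases le_total s t with h | h
    · rw [key s hs t ht h, abs_of_nonneg (by omega)]
    · rw [wd_symm hg, key t ht s hs h, abs_sub_comm, abs_of_nonneg (by omega)]
  obtain ⟨n, hn⟩ := hray p hgeo M' hM' (hmor _ p hlab)
  obtain ⟨r, hr, hyr, h1, h2⟩ := y4 n
  have e : (((W (n+1)).drop (W n).length).take ((W n).length + (y n).length - (W n).length)) = y n := by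
    rw [Ws]; simp
  have hlt : (W n).length + (y n).length ≤ (W (n+1)).length := by rw [Ws]; simp
  have h3 := partA hsc hr hyr (N := 2 * N n) (by have := hN n; omega) h1 h2 hn (s := (W n).length) (by simp)
    (by rw [Set.mem_Ici]; omega) (fun i hi => by
      have := lab (W n).length ((W n).length + (y n).length) (by omega) (n+1) hlt i (by omega)
      rwa [e] at this)
  have h4 := y3 n
  simp only [hthr] at h4
  have h5 : r.length ≤ ⌈12 * Ms n (3 * (2 * N n : ℕ)) + 36⌉₊ := by
    have := h3.trans (Nat.le_ceil _)
    exact_mod_cast this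
  omega
end Ray
end MorseLTG

namespace MorseLTG
section Final
variable {S : Type*} {R : Set (Word S)}

/-- words labelling subpaths of geodesics that are `L`-locally `M`-Morse -/
def FF (R : Set (Word S)) (M : ℝ → ℝ) (L : ℕ) : Set (Word S) :=
  {w | ∃ (I : Set ℤ) (p : ℤ → GP R) (s : ℤ), I.OrdConnected ∧ DGeodesicOn (presGen R) I p ∧ DLocMorseOn (presGen R) M L I p ∧
    s ∈ I ∧ s + w.length ∈ I ∧ ∀ i : ℕ, i ≤ w.length → p (s + i) = p s * evalWord (presGen R) (w.take i)}

lemma main (hsc : SmallCancellation R (1/6)) (hσc : CaySigmaCompact (presGen R)) : CayGeodesicMLTG (presGen R) := by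
  have hg : gen (presGen R) := gen_pres
  intro M hM
  by_contra hno
  refine Exists.elim (select (R := R) (FF R M) ?_ ?_ ?_ (fun N => ⌈12 * M (3 * N) + 36⌉₊) ?_ ?_) fun m' h => final_ray hsc hσc m' h
  · rintro L w z ⟨I, p, s, hI, hp, hL, hs, ht, hw⟩ ⟨a, b, rfl⟩
    have e : ∀ i : ℕ, i ≤ z.length → p (s + a.length + i) = p s * evalWord (presGen R) (a ++ z.take i) := by
      intro i hi
      have h1 := hw (a.length + i) (by simp; omega)
      rw [List.append_assoc, List.take_length_add_append, List.take_append_of_le_length hi] at h1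
      rw [← h1]; push_cast; rw [add_assoc]
    have h0 := e 0 (by omega)
    simp only [Nat.cast_zero, add_zero, List.take_zero, List.append_nil] at h0
    have hs' : s + a.length ∈ I := hI.out hs ht ⟨by omega, by simp; omega⟩
    refine ⟨I, p, s + a.length, hI, hp, hL, hs', hI.out hs' ht ⟨by omega, by simp; omega⟩, fun i hi => ?_⟩
    rw [e i hi, h0, evalWord_append, mul_assoc]
  · rintro L L' w hLL ⟨I, p, s, hI, hp, hL, hs, ht, hw⟩
    exact ⟨I, p, s, hI, hp, fun a ha b hb hab h => hL a ha b hb hab (h.trans (by exact_mod_cast hLL)), hs, ht, hw⟩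
  · rintro L w ⟨I, p, s, hI, hp, hL, hs, ht, hw⟩
    refine gd_of_wd hg (p s) ?_
    have h1 := hw _ le_rfl
    rw [List.take_length] at h1
    have h2 := hp s hs _ ht
    rw [h1] at h2
    simp at h2
    omega
  · rintro L N w r ⟨I, p, s, hI, hp, hL, hs, ht, hw⟩ hwL hr hwr hlt
    have hG : Gd (presGen R) w := by
      refine gd_of_wd hg (p s) ?_
      have h1 := hw _ le_rfl
      rw [List.take_length] at h1
      have h2 := hp s hs _ ht
      rw [h1] at h2
      simp at h2
      omega
    have hN : 1 ≤ N := by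
      by_contra h
      have : N = 0 := by omega
      subst this; omega
    have h1 := partA hsc hr hwr hN hlt.le (hG.half rel_one hr hwr)
      (hL s hs _ ht (by omega) (by simpa using hwL)) (s := s) ⟨le_rfl, by omega⟩ ⟨by omega, le_rfl⟩ hw
    have := h1.trans (Nat.le_ceil _)
    exact_mod_cast this
  · by_contra hcl
    push Not at hcl
    obtain ⟨L, hL⟩ := hcl
    choose! n0 hn0 using hL
    obtain ⟨M', hM', hmor⟩ := morse_of_ov hsc (fun Q => n0 (NQ Q))
    refine hno ⟨L + 1, M', by positivity, hM', fun I hI p hp hloc => hmor I p fun s hs t ht hst => ?_⟩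
    obtain ⟨w, h1, h2, h3⟩ := label hI hp hs ht hst
    refine ⟨w, h1, h2, h3, fun Q hQ z r hz hr hn hzr => ?_⟩
    refine hn0 (NQ Q) (by rw [NQ]; omega) z r ?_ hr hn hzr
    obtain ⟨a, b, rfl⟩ := hz
    have e : ∀ i : ℕ, i ≤ z.length → p (s + a.length + i) = p s * evalWord (presGen R) (a ++ z.take i) := by
      intro i hi
      have h4 := h3 (a.length + i) (by simp; omega)
      rw [List.append_assoc, List.take_length_add_append, List.take_append_of_le_length hi] at h4
      rw [← h4]; push_cast; rw [add_assoc]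
    have h0 := e 0 (by omega)
    simp only [Nat.cast_zero, add_zero, List.take_zero, List.append_nil] at h0
    rw [h1] at ht
    have hs' : s + a.length ∈ I := hI.out hs ht ⟨by omega, by simp; omega⟩
    refine ⟨I, p, s + a.length, hI, hp, fun c hc d hd hcd h => hloc c hc d hd hcd (h.trans (by linarith)),
      hs', hI.out hs' ht ⟨by omega, by simp; omega⟩, fun i hi => ?_⟩
    rw [e i hi, h0, evalWord_append, mul_assoc]
end Final
end MorseLTG

open MorseLTG in
/-- a `C'(1/6)` group with σ-compact Morse boundary satisfies the
geodesic Morse local-to-global property. -/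
theorem stmt3 {S : Type*} [Fintype S] (R : Set (Word S))
    (hsc : SmallCancellation R (1 / 6))
    (hσc : CaySigmaCompact (presGen R)) :
    CayGeodesicMLTG (presGen R) := by
  exact main hsc hσc
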